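/- arXiv:2601.17395 — 2 statements merged into one kernel-verified Lean document; each statement's English description precedes it below -/
import Mathlib

section
/- Let n ∈ ℕ. Let (C,u) be an equicharacteristic ℤ-valued field with uniformizer π such that O_u is excellent, and let (K,v) be a henselian valued field extension of (C,u) in which π is still a uniformizer, such that Kv/Cu is separable. If (R4_n) holds, then there exists a valued field extension (K',v') of (C,u) in which π is a uniformizer, which is henselian, complete and ℤ-valued, such that Th_{∃_n}(K',C) = Th_{∃_n}(K,C) (as L_ring(C)-theories) and the residue field K'v' is an elementary extension of Kv. -/
open FirstOrder FirstOrder.Language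

universe u v w x

namespace Paper



/-! ### Syntactic fragments -/

/-- `IsExistsN n φ`: `φ` is an `∃_n`-formula, i.e. of the form `∃ x₁ … x_m ψ`
with `m ≤ n` and `ψ` quantifier-free. -/
inductive IsExistsN {L : Language} {α : Type*} : ℕ → ∀ {k : ℕ}, L.BoundedFormula α k → Prop
  | qf {n k : ℕ} {φ : L.BoundedFormula α k} : φ.IsQF → IsExistsN n φ
  | ex {n k : ℕ} {φ : L.BoundedFormula α (k + 1)} : IsExistsN n φ → IsExistsN (n + 1) φ.ex

/-- `φ` is an existential formula. -/
def IsExists {L : Language} {α : Type*} {k : ℕ} (φ : L.BoundedFormula α k) : Prop :=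
  ∃ n : ℕ, IsExistsN n φ

/-- Positive boolean combinations of formulas satisfying `P`. -/
inductive IsPosBC {L : Language} {α : Type*} (P : ∀ {k : ℕ}, L.BoundedFormula α k → Prop) :
    ∀ {k : ℕ}, L.BoundedFormula α k → Prop
  | base {k : ℕ} {φ : L.BoundedFormula α k} : P φ → IsPosBC P φ
  | inf {k : ℕ} {φ ψ : L.BoundedFormula α k} :
      IsPosBC P φ → IsPosBC P ψ → IsPosBC P (φ ⊓ ψ)
  | sup {k : ℕ} {φ ψ : L.BoundedFormula α k} :
      IsPosBC P φ → IsPosBC P ψ → IsPosBC P (φ ⊔ ψ)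

/-- The `∃₁`-fragment: positive boolean combinations of formulas of the form `η` or `∃ y η`
with `η` quantifier-free. -/
def IsE1 {L : Language} {α : Type*} {k : ℕ} (φ : L.BoundedFormula α k) : Prop :=
  IsPosBC (fun {k} φ => φ.IsQF ∨ ∃ ψ : L.BoundedFormula α (k + 1), ψ.IsQF ∧ φ = ψ.ex) φ

/-- `∃_n∃₁`-formulas: `∃ x₁ … x_m ψ` with `m ≤ n` and `ψ` in the `∃₁`-fragment. -/
inductive IsExistsNE1 {L : Language} {α : Type*} : ℕ → ∀ {k : ℕ}, L.BoundedFormula α k → Prop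
  | e1 {n k : ℕ} {φ : L.BoundedFormula α k} : IsE1 φ → IsExistsNE1 n φ
  | ex {n k : ℕ} {φ : L.BoundedFormula α (k + 1)} : IsExistsNE1 n φ → IsExistsNE1 (n + 1) φ.ex

/-- The `∃^n`-fragments, defined inductively: `∃^0`-formulas are the quantifier-free ones,
and an `∃^{n+1}`-formula is of the form `ψ` or `∃ x ψ` with `ψ` a positive boolean
combination of `∃^n`-formulas. -/
def IsExpN {L : Language} {α : Type*} : ℕ → ∀ {k : ℕ}, L.BoundedFormula α k → Prop
  | 0, _, φ => φ.IsQF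
  | n + 1, k, φ => IsPosBC (IsExpN n) φ ∨
      ∃ ψ : L.BoundedFormula α (k + 1), IsPosBC (IsExpN n) ψ ∧ φ = ψ.ex



/-! ### The language of rings with constants, and realization -/

/-- The `Language.ring`-structure on a ring. -/
noncomputable def ringStructure (M : Type*) [CommRing M] : Language.ring.Structure M :=
  (FirstOrder.Ring.compatibleRingOfRing M).toStructure

/-- The `L_ring(α)`-structure on a ring `M` with constants interpreted via `f : α → M`. -/
noncomputable def ringConStructure {α M : Type*} [CommRing M] (f : α → M) :
    (Language.ring[[α]]).Structure M :=
  letI := ringStructure M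
  letI := constantsOn.structure f
  inferInstance

/-- `M ⊨ φ` for an `L_ring(α)`-sentence, with constants interpreted via `f`. -/
def RealizeRing (M : Type*) [CommRing M] {α : Type*} (f : α → M)
    (φ : (Language.ring[[α]]).Sentence) : Prop :=
  @Sentence.Realize _ M (ringConStructure f) φ

/-- The unary relation symbol `O` for the valuation ring. -/
inductive ValRel : ℕ → Type
  | isO : ValRel 1

/-- The language with a single unary predicate `O`. -/
def oLang : Language := ⟨fun _ => Empty, ValRel⟩

/-- The language of valued fields `L_val = L_ring ∪ {O}`. -/
abbrev Lval : Language := Language.ring.sum oLang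

/-- The `oLang`-structure on `M` in which `O` is interpreted as the set `O`. -/
def oStructure {M : Type*} (O : Set M) : oLang.Structure M where
  funMap := fun f _ => f.elim
  RelMap := fun {_} r => match r with
    | .isO => fun xs => xs 0 ∈ O

/-- The `L_val(α)`-structure on a ring `M`, with `O` interpreted as the set `O` and
constants interpreted via `f : α → M`. -/
noncomputable def valConStructure {α M : Type*} [CommRing M] (O : Set M) (f : α → M) :
    (Lval[[α]]).Structure M :=
  letI := ringStructure M
  letI := oStructure O
  letI : Lval.Structure M := inferInstance
  letI := constantsOn.structure f
  inferInstance

/-- `M ⊨ φ` for an `L_val(α)`-sentence. -/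
def RealizeVal (M : Type*) [CommRing M] (O : Set M) {α : Type*} (f : α → M)
    (φ : (Lval[[α]]).Sentence) : Prop :=
  @Sentence.Realize _ M (valConStructure O f) φ



abbrev Zm0 : Type := WithZero (Multiplicative ℤ)

variable {K : Type*} [Field K] {Γ : Type*} [LinearOrderedCommGroupWithZero Γ]

/-- `π` is a uniformizer of `(K, v)`: `v π` is minimal positive
(multiplicatively: `0 < v π < 1` and `v π` is the largest value `< 1`). -/
def IsUniformizer (v : Valuation K Γ) (π : K) : Prop :=
  0 < v π ∧ v π < 1 ∧ ∀ x : K, v x < 1 → v x ≤ v π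

/-- The valuation ring of `v`, as a set. -/
def Oset (v : Valuation K Γ) : Set K := {x | v x ≤ 1}

/-- The residue field `Kv` of the valued field `(K, v)`. -/
abbrev ResF (v : Valuation K Γ) : Type _ :=
  IsLocalRing.ResidueField v.valuationSubring

/-- The residue map `O_v → Kv`. -/
abbrev resMap (v : Valuation K Γ) : v.valuationSubring →+* ResF v :=
  IsLocalRing.residue _

/-- `(K, v)` is a henselian valued field. -/
abbrev IsHenselian (v : Valuation K Γ) : Prop :=
  HenselianLocalRing v.valuationSubring

/-- compatibility of a ring homomorphism between residue fields with the residue maps,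
for an extension `(K, v)` of `(C, u)`. -/
def ResCompat {C : Type*} [Field C] {Γ₀ : Type*} [LinearOrderedCommGroupWithZero Γ₀]
    (u : Valuation C Γ₀) [Algebra C K] (v : Valuation K Γ)
    (g : ResF u →+* ResF v) : Prop :=
  ∀ (x : u.valuationSubring) (hx : algebraMap C K ↑x ∈ v.valuationSubring),
    g (resMap u x) = resMap v ⟨algebraMap C K ↑x, hx⟩

/-- `(K, v)` is complete (with respect to the valuation uniformity). -/
def IsCompleteValued (v : Valuation K Γ) : Prop :=
  letI : Valued K Γ := Valued.mk' v
  CompleteSpace K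



/-- `E/F` admits a separating transcendence basis. -/
def HasSepTransBasis (F E : Type*) [Field F] [Field E] [Algebra F E] : Prop :=
  ∃ s : Set E, AlgebraicIndependent F ((↑) : s → E) ∧
    Algebra.IsSeparable (IntermediateField.adjoin F s) E

/-- The field extension `E/F` is separable: every finitely generated subextension
admits a separating transcendence basis. -/
def IsSepExt (F E : Type*) [Field F] [Field E] [Algebra F E] : Prop :=
  ∀ s : Finset E, HasSepTransBasis F (IntermediateField.adjoin F (s : Set E))

/-- The extension given by a ring homomorphism `f : F →+* E` of fields is separable. -/
def IsSepExtHom {F E : Type*} [Field F] [Field E] (f : F →+* E) : Prop :=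
  letI := f.toAlgebra
  IsSepExt F E

/-- `trdeg(E/F) ≤ d`: there is a finite transcendence basis with at most `d` elements. -/
def TrdegLE (F E : Type*) [CommRing F] [CommRing E] [Algebra F E] (d : ℕ) : Prop :=
  ∃ s : Finset E, s.card ≤ d ∧ IsTranscendenceBasis F (Subtype.val : ((s : Set E)) → E)

/-- `F` is a large field: `F` is existentially closed in `F((t))`. -/
def LargeField (F : Type u) [Field F] : Prop :=
  ∀ φ : (Language.ring[[F]]).Sentence, IsExists φ →
    RealizeRing (LaurentSeries F) (algebraMap F (LaurentSeries F)) φ →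
    RealizeRing F (id : F → F) φ

/-- `(R4_n)`: whenever a valuation `w` on a field `E` is trivial on a large subfield `F` of `E`
with residue field `Eu = F` (via the residue map), every `∃_n`-`L_ring(F)`-sentence true in `E`
is true in `F`. -/
def R4N (n : ℕ) : Prop :=
  ∀ (E : Type u) [Field E] (Γ : Type u) [LinearOrderedCommGroupWithZero Γ]
    (w : Valuation E Γ) (F : Subfield E),
    LargeField.{u} F →
    (∀ y : F, (y : E) ≠ 0 → w y = 1) →
    (∀ y : E, w y ≤ 1 → ∃ x : F, w (y - x) < 1) →
    ∀ φ : (Language.ring[[F]]).Sentence, IsExistsN n φ →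
      RealizeRing E ((↑) : F → E) φ → RealizeRing F (id : F → F) φ

/-- Excellence of the valuation ring of an (equicharacteristic, `ℤ`-valued) valued field
`(C, u)`, via the characterization: the fraction field of the completion (i.e. the completion
of `C`) is a separable extension of `C`. -/
def ExcellentCompletion (C : Type u) [Field C] (u : Valuation C Zm0) : Prop :=
  letI : Valued C Zm0 := Valued.mk' u
  letI : Field (UniformSpace.Completion C) := UniformSpace.Completion.instField
  IsSepExtHom (UniformSpace.Completion.coeRingHom : C →+* UniformSpace.Completion C)


/-- `Th_P(K, fK) ⊆ Th_P(L, fL)`: every positive boolean combination of `L_ring(α)`-sentences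
of the fragment `P` that is true in `K` is true in `L`. -/
def ThRingSub {α : Type*} (P : ∀ {k : ℕ}, (Language.ring[[α]]).BoundedFormula Empty k → Prop)
    (K : Type*) [CommRing K] (fK : α → K) (L : Type*) [CommRing L] (fL : α → L) : Prop :=
  ∀ φ : (Language.ring[[α]]).Sentence, IsPosBC P φ →
    RealizeRing K fK φ → RealizeRing L fL φ

/-- `Th_P(K, OK, fK) ⊆ Th_P(L, OL, fL)` for `L_val(α)`-sentences. -/
def ThValSub {α : Type*} (P : ∀ {k : ℕ}, (Lval[[α]]).BoundedFormula Empty k → Prop)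
    (K : Type*) [CommRing K] (OK : Set K) (fK : α → K)
    (L : Type*) [CommRing L] (OL : Set L) (fL : α → L) : Prop :=
  ∀ φ : (Lval[[α]]).Sentence, IsPosBC P φ →
    RealizeVal K OK fK φ → RealizeVal L OL fL φ

end Paper

namespace Paper

/-- Existential transfer from `M` to `N` over `C`: for every finite tuple of `M` and finitely many
polynomials over `C` there is a tuple of `N` on which the same polynomials vanish. -/
def ExLe (C : Type*) (M N : Type*) [CommRing C] [CommRing M] [CommRing N] [Algebra C M]
    [Algebra C N] : Prop :=
  ∀ (m : ℕ) (x : Fin m → M) (P : Finset (MvPolynomial (Fin m) C)),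
    ∃ y : Fin m → N, ∀ p ∈ P, MvPolynomial.aeval x p = 0 ↔ MvPolynomial.aeval y p = 0

section Logic

variable {C M N : Type*} [CommRing C] [CommRing M] [CommRing N] [Algebra C M] [Algebra C N]

theorem ExLe.trans {Q : Type*} [CommRing Q] [Algebra C Q] (h : ExLe C M N) (h' : ExLe C N Q) :
    ExLe C M Q := by
  intro m x P
  obtain ⟨y, hy⟩ := h m x P
  obtain ⟨z, hz⟩ := h' m y P
  exact ⟨z, fun p hp => (hy p hp).trans (hz p hp)⟩

theorem ExLe.of_injective (f : M →ₐ[C] N) (hf : Function.Injective f) : ExLe C M N := by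
  intro m x P
  refine ⟨f ∘ x, fun p _ => ?_⟩
  rw [show MvPolynomial.aeval (f ∘ x) p = f (MvPolynomial.aeval x p) by
    rw [← AlgHom.comp_apply, MvPolynomial.comp_aeval]; rfl, map_eq_zero_iff f hf]

theorem exists_term_poly {k : ℕ} (t : (Language.ring[[C]]).Term (Empty ⊕ Fin k)) :
    ∃ p : MvPolynomial (Fin k) C,
      (∀ x : Fin k → M, @Term.realize _ M (ringConStructure (algebraMap C M)) _
        (Sum.elim default x) t = MvPolynomial.aeval x p) ∧
      (∀ x : Fin k → N, @Term.realize _ N (ringConStructure (algebraMap C N)) _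
        (Sum.elim default x) t = MvPolynomial.aeval x p) := by
  induction t with
  | var a =>
    rcases a with a | i
    · exact a.elim
    · exact ⟨MvPolynomial.X i, fun x => by simp, fun x => by simp⟩
  | @func l f ts ih =>
    choose p hp hq using ih
    rcases f with f | f
    · cases f with
      | add =>
        refine ⟨p 0 + p 1, fun x => ?_, fun x => ?_⟩
        · rw [map_add, ← hp, ← hp]; rfl
        · rw [map_add, ← hq, ← hq]; rfl
      | mul =>
        refine ⟨p 0 * p 1, fun x => ?_, fun x => ?_⟩
        · rw [map_mul, ← hp, ← hp]; rfl
        · rw [map_mul, ← hq, ← hq]; rfl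
      | neg =>
        refine ⟨-p 0, fun x => ?_, fun x => ?_⟩
        · rw [map_neg, ← hp]; rfl
        · rw [map_neg, ← hq]; rfl
      | zero => exact ⟨0, fun x => by rw [map_zero]; rfl, fun x => by rw [map_zero]; rfl⟩
      | one => exact ⟨1, fun x => by rw [map_one]; rfl, fun x => by rw [map_one]; rfl⟩
    · cases l with
      | zero =>
        let c : C := f
        exact ⟨MvPolynomial.C c, fun x => (MvPolynomial.aeval_C x c).symm,
          fun x => (MvPolynomial.aeval_C x c).symm⟩
      | succ l => exact PEmpty.elim f

theorem exists_finset_poly_of_isQF {k : ℕ} {φ : (Language.ring[[C]]).BoundedFormula Empty k}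
    (h : φ.IsQF) : ∃ P : Finset (MvPolynomial (Fin k) C),
      ∀ (x : Fin k → M) (y : Fin k → N),
        (∀ p ∈ P, MvPolynomial.aeval x p = 0 ↔ MvPolynomial.aeval y p = 0) →
        (@BoundedFormula.Realize _ M (ringConStructure (algebraMap C M)) _ _ φ default x ↔
          @BoundedFormula.Realize _ N (ringConStructure (algebraMap C N)) _ _ φ default y) := by
  classical
  induction h with
  | falsum => exact ⟨∅, fun x y _ => Iff.rfl⟩
  | of_isAtomic h =>
    cases h with
    | equal t₁ t₂ =>
      obtain ⟨p₁, h1, h1'⟩ := exists_term_poly (M := M) (N := N) t₁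
      obtain ⟨p₂, h2, h2'⟩ := exists_term_poly (M := M) (N := N) t₂
      refine ⟨{p₁ - p₂}, fun x y hxy => ?_⟩
      have := hxy (p₁ - p₂) (by simp)
      rw [map_sub, map_sub, sub_eq_zero, sub_eq_zero, ← h1, ← h1', ← h2, ← h2'] at this
      exact this
    | rel R ts =>
      rcases R with R | R
      · exact (R : Empty).elim
      · exact (R : Empty).elim
  | imp _ _ ih₁ ih₂ =>
    obtain ⟨P₁, h1⟩ := ih₁
    obtain ⟨P₂, h2⟩ := ih₂
    refine ⟨P₁ ∪ P₂, fun x y hxy => ?_⟩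
    exact imp_congr (h1 x y fun p hp => hxy p (Finset.mem_union_left _ hp))
      (h2 x y fun p hp => hxy p (Finset.mem_union_right _ hp))

theorem exists_witness_of_isExistsN {n k : ℕ} {φ : (Language.ring[[C]]).BoundedFormula Empty k}
    (h : IsExistsN n φ) : ∀ (x : Fin k → M),
      @BoundedFormula.Realize _ M (ringConStructure (algebraMap C M)) _ _ φ default x →
      ∃ (m : ℕ) (z : Fin m → M) (e : Fin k → Fin m) (P : Finset (MvPolynomial (Fin m) C)),
        ∀ y : Fin m → N, (∀ p ∈ P, MvPolynomial.aeval z p = 0 ↔ MvPolynomial.aeval y p = 0) →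
          @BoundedFormula.Realize _ N (ringConStructure (algebraMap C N)) _ _ φ default
            (y ∘ e) := by
  induction h with
  | @qf n k φ h =>
    intro x hx
    obtain ⟨P, hP⟩ := exists_finset_poly_of_isQF (M := M) (N := N) h
    exact ⟨k, x, id, P, fun y hy => (hP x y hy).1 hx⟩
  | @ex n k φ h ih =>
    intro x hx
    let := ringConStructure (algebraMap C M)
    let := ringConStructure (algebraMap C N)
    obtain ⟨a, ha⟩ := BoundedFormula.realize_ex.1 hx
    obtain ⟨m, z, e, P, hP⟩ := ih _ ha
    refine ⟨m, z, e ∘ Fin.castSucc, P, fun y hy => ?_⟩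
    refine BoundedFormula.realize_ex.2 ⟨y (e (Fin.last k)), ?_⟩
    have := hP y hy
    convert this using 1
    ext i
    refine Fin.lastCases ?_ (fun i => ?_) i <;> simp

theorem ExLe.realize_of_isExistsN (hMN : ExLe C M N) {n : ℕ}
    {φ : (Language.ring[[C]]).Sentence} (h : IsExistsN n φ)
    (hφ : RealizeRing M (algebraMap C M) φ) : RealizeRing N (algebraMap C N) φ := by
  obtain ⟨m, z, e, P, hP⟩ := exists_witness_of_isExistsN (M := M) (N := N) h _ hφ
  obtain ⟨y, hy⟩ := hMN m z P
  have := hP y hy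
  rwa [Subsingleton.elim (y ∘ e) default] at this

theorem thRingSub_of_forall_isExistsN {α A B : Type*} [CommRing A] [CommRing B] {f : α → A}
    {g : α → B} {n : ℕ} (H : ∀ φ : (Language.ring[[α]]).Sentence, IsExistsN n φ →
      RealizeRing A f φ → RealizeRing B g φ) :
    ThRingSub (fun {k} φ => IsExistsN (k := k) n φ) A f B g := by
  let := ringConStructure f
  let := ringConStructure g
  have key : ∀ {k : ℕ} (φ : (Language.ring[[α]]).BoundedFormula Empty k),
      IsPosBC (fun {k} φ => IsExistsN (k := k) n φ) φ → ∀ hk : k = 0,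
      ((hk ▸ φ : (Language.ring[[α]]).BoundedFormula Empty 0).Realize
        (default : Empty → A) default →
      (hk ▸ φ : (Language.ring[[α]]).BoundedFormula Empty 0).Realize
        (default : Empty → B) default) := by
    intro k φ h
    induction h with
    | base h => rintro rfl; exact H _ h
    | inf _ _ h1 h2 =>
      rintro rfl h
      simp only [BoundedFormula.realize_inf] at h ⊢
      exact ⟨h1 rfl h.1, h2 rfl h.2⟩
    | sup _ _ h1 h2 =>
      rintro rfl h
      simp only [BoundedFormula.realize_sup] at h ⊢
      exact h.imp (h1 rfl) (h2 rfl)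
  intro φ h hφ
  exact key φ h rfl hφ

theorem isExistsN_onBoundedFormula {L L' : Language} (g : L →ᴸ L') {α : Type*} {n k : ℕ}
    {φ : L.BoundedFormula α k} (h : IsExistsN n φ) : IsExistsN n (g.onBoundedFormula φ) := by
  induction h with
  | qf h => exact .qf (by
      induction h with
      | falsum => exact .falsum
      | of_isAtomic h =>
        cases h with
        | equal t₁ t₂ => exact .of_isAtomic (.equal _ _)
        | rel R ts => exact .of_isAtomic (.rel _ _)
      | imp _ _ h1 h2 => exact .imp h1 h2)
  | ex h ih => exact .ex ih

theorem realizeRing_onSentence {α β A : Type*} [CommRing A] (g : α → β) (f : β → A)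
    (φ : (Language.ring[[α]]).Sentence) :
    RealizeRing A f ((Language.ring.lhomWithConstantsMap g).onSentence φ) ↔
      RealizeRing A (f ∘ g) φ := by
  let := ringConStructure f
  let := ringConStructure (f ∘ g)
  have : (Language.ring.lhomWithConstantsMap g).IsExpansionOn A := by
    constructor
    · intro n F xs
      rcases F with F | F
      · rfl
      · cases n with
        | zero => rfl
        | succ n => exact PEmpty.elim F
    · intro n R xs
      rcases R with R | R
      · exact (R : Empty).elim
      · exact (R : Empty).elim
  exact LHom.realize_onSentence A _ φ

end Logic

end Paper

namespace Paper

/-- Separability of a field extension in the form of Mac Lane's criterion: a nontrivial relation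
`∑ cᵢ yᵢ ^ p = 0` with `cᵢ` in the base field and `yᵢ` in the extension implies one with
the same coefficients and `yᵢ` in the base field. -/
def SepHom {F L : Type*} [CommRing F] [CommRing L] (f : F →+* L) : Prop :=
  ∀ p : ℕ, p.Prime → CharP F p → ∀ (m : ℕ) (c : Fin m → F) (y : Fin m → L),
    ∑ i, f (c i) * y i ^ p = 0 → (∃ i, y i ≠ 0) →
      ∃ z : Fin m → F, ∑ i, c i * z i ^ p = 0 ∧ ∃ i, z i ≠ 0

theorem SepHom.exists_of_fintype {F L : Type*} [CommRing F] [CommRing L] {f : F →+* L}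
    (hf : SepHom f) {p : ℕ} (hp : p.Prime) [CharP F p] {ι : Type*} [Fintype ι] (c : ι → F)
    (y : ι → L) (h : ∑ i, f (c i) * y i ^ p = 0) (hy : ∃ i, y i ≠ 0) :
    ∃ z : ι → F, ∑ i, c i * z i ^ p = 0 ∧ ∃ i, z i ≠ 0 := by
  let e := Fintype.equivFin ι
  obtain ⟨i, hi⟩ := hy
  obtain ⟨z, hz, j, hj⟩ := hf p hp inferInstance _ (c ∘ e.symm) (y ∘ e.symm)
    (by rw [← h]; exact Equiv.sum_comp e.symm fun i => f (c i) * y i ^ p) ⟨e i, by simpa⟩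
  refine ⟨z ∘ e, ?_, e.symm j, by simpa⟩
  rw [← hz, ← Equiv.sum_comp e]
  simp

theorem SepHom.comp {F L M : Type*} [Field F] [Field L] [Field M] {f : F →+* L} {g : L →+* M}
    (hg : SepHom g) (hf : SepHom f) : SepHom (g.comp f) := by
  intro p hp hF m c y h hy
  have : CharP L p := (RingHom.charP_iff f f.injective p).1 hF
  obtain ⟨z, hz, hz'⟩ := hg p hp this m (fun i => f (c i)) y h hy
  exact hf p hp hF m c z hz hz'

theorem SepHom.of_comp {F L M : Type*} [CommRing F] [CommRing L] [CommRing M] {f : F →+* L}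
    {g : L →+* M} (h : SepHom (g.comp f)) (hg : Function.Injective g) : SepHom f := by
  intro p hp hF m c y hy ⟨i, hi⟩
  refine h p hp hF m c (g ∘ y) ?_ ⟨i, by simpa [map_eq_zero_iff g hg]⟩
  rw [← map_zero g, ← hy, map_sum]
  simp

theorem SepHom.of_comp_bijective {F L M : Type*} [Field F] [Field L] [CommRing M] {f : F →+* L}
    {g : L →+* M} (h : SepHom (g.comp f)) (hf : Function.Bijective f) : SepHom g := by
  intro p hp hF m c y hy hy'
  have hF' : CharP F p := (RingHom.charP_iff f f.injective p).2 hF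
  choose c' hc' using fun i => hf.2 (c i)
  obtain ⟨z, hz, i, hi⟩ := h p hp hF' m c' y (by simpa [hc'] using hy) hy'
  refine ⟨f ∘ z, ?_, i, by simpa [map_eq_zero_iff f hf.1]⟩
  rw [← map_zero f, ← hz, map_sum]
  simp [hc']

/-- Over a field of characteristic `p`, finitely many elements are combinations, with `p`-th power
coefficients, of a family which is independent over the `p`-th powers. -/
theorem exists_pow_basis {F : Type*} [Field F] {p : ℕ} (hp : p.Prime) [CharP F p] {ι : Type*}
    [Fintype ι] (c : ι → F) :
    ∃ (r : ℕ) (d : Fin r → F) (a : ι → Fin r → F),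
      (∀ i, c i = ∑ j, d j * a i j ^ p) ∧
        ∀ z : Fin r → F, ∑ j, d j * z j ^ p = 0 → ∀ j, z j = 0 := by
  have : Fact p.Prime := ⟨hp⟩
  let E := (frobenius F p).fieldRange
  let W := Submodule.span E (Set.range c)
  have : FiniteDimensional E W := FiniteDimensional.span_of_finite E (Set.finite_range c)
  let b := Module.finBasis E W
  have hE : ∀ x : E, ∃ y, y ^ p = (x : F) := fun x => by
    obtain ⟨y, hy⟩ := RingHom.mem_fieldRange.1 x.2
    exact ⟨y, by rw [← hy, frobenius_def]⟩
  choose g hg using hE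
  let c' : ι → W := fun i => ⟨c i, Submodule.subset_span ⟨i, rfl⟩⟩
  refine ⟨_, fun j => (b j : F), fun i j => g (b.repr (c' i) j), fun i => ?_, fun z hz j => ?_⟩
  · have := congrArg (Subtype.val) (b.sum_repr (c' i))
    rw [show (c' i : F) = c i from rfl] at this
    rw [← this]
    push_cast
    refine Finset.sum_congr rfl fun j _ => ?_
    rw [hg, mul_comm]; rfl
  · let z' : Fin _ → E := fun j => ⟨z j ^ p, RingHom.mem_fieldRange.2 ⟨z j, frobenius_def ..⟩⟩
    have h0 : ∑ j, z' j • b j = 0 := by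
      apply Subtype.ext
      push_cast
      rw [← hz]
      refine Finset.sum_congr rfl fun j _ => ?_
      rw [mul_comm]; rfl
    have := Fintype.linearIndependent_iff.1 b.linearIndependent z' h0 j
    have h1 : z j ^ p = 0 := congrArg Subtype.val this
    exact pow_eq_zero_iff hp.ne_zero |>.1 h1

theorem SepHom.linearIndepOn_pow {F L : Type*} [Field F] [Field L] [Algebra F L]
    (h : SepHom (algebraMap F L)) {p : ℕ} (hp : p.Prime) [CharP F p] (s : Finset L)
    (hs : LinearIndepOn F _root_.id (s : Set L)) : LinearIndepOn F (· ^ p) (s : Set L) := by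
  have : Fact p.Prime := ⟨hp⟩
  have : CharP L p := (RingHom.charP_iff _ (algebraMap F L).injective p).1 inferInstance
  have hs' : LinearIndependent F (fun i : s => (i : L)) := hs
  refine show LinearIndependent F (fun i : s => (i : L) ^ p) from ?_
  rw [Fintype.linearIndependent_iff] at hs' ⊢
  intro c hc
  obtain ⟨r, d, a, hda, hd⟩ := exists_pow_basis hp c
  have key : ∑ j, algebraMap F L (d j) * (∑ i : s, a i j • (i : L)) ^ p = 0 := by
    rw [← hc]
    simp_rw [hda, Finset.sum_smul, sum_pow_char]
    rw [Finset.sum_comm]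
    refine Finset.sum_congr rfl fun j _ => ?_
    rw [Finset.mul_sum]
    refine Finset.sum_congr rfl fun i _ => ?_
    rw [Algebra.smul_def, Algebra.smul_def, mul_pow, map_mul, map_pow, mul_assoc]
  have h0 : ∀ j, ∑ i : s, a i j • (i : L) = 0 := by
    by_contra! hne
    obtain ⟨z, hz, j, hj⟩ := h.exists_of_fintype hp d _ key hne
    exact hj (hd z hz j)
  intro i
  rw [hda]
  exact Finset.sum_eq_zero fun j _ => by rw [hs' _ (h0 j) i, zero_pow hp.ne_zero, mul_zero]

theorem sepHom_of_forall_linearIndependent {F L : Type*} [Field F] [Field L] [Algebra F L]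
    (H : ∀ p : ℕ, p.Prime → CharP F p → ∀ (r : ℕ) (x : Fin r → L), LinearIndependent F x →
      LinearIndependent F (fun i => x i ^ p)) : SepHom (algebraMap F L) := by
  intro p hp hF m c y hy ⟨i₀, hi₀⟩
  have : Fact p.Prime := ⟨hp⟩
  have : CharP L p := (RingHom.charP_iff _ (algebraMap F L).injective p).1 inferInstance
  let W := Submodule.span F (Set.range y)
  have : FiniteDimensional F W := FiniteDimensional.span_of_finite F (Set.finite_range y)
  let b := Module.finBasis F W
  let y' : Fin m → W := fun i => ⟨y i, Submodule.subset_span ⟨i, rfl⟩⟩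
  have hb : LinearIndependent F (fun j => (b j : L)) :=
    b.linearIndependent.map' W.subtype (by simp)
  have hyb : ∀ i, y i = ∑ j, algebraMap F L (b.repr (y' i) j) * (b j : L) := fun i => by
    have := congrArg (Subtype.val) (b.sum_repr (y' i))
    rw [show (y' i : L) = y i from rfl] at this
    rw [← this]
    push_cast
    exact Finset.sum_congr rfl fun j _ => Algebra.smul_def _ _
  have hbp := Fintype.linearIndependent_iff.1 (H p hp hF _ _ hb)
    (fun j => ∑ i, c i * b.repr (y' i) j ^ p) (by
      rw [← hy]
      simp_rw [hyb, sum_pow_char, Finset.sum_smul, Finset.mul_sum]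
      rw [Finset.sum_comm]
      refine Finset.sum_congr rfl fun j _ => Finset.sum_congr rfl fun i _ => ?_
      rw [Algebra.smul_def, mul_pow, map_mul, map_pow, mul_assoc])
  have : ∃ j, b.repr (y' i₀) j ≠ 0 := by
    by_contra! h
    apply hi₀
    rw [hyb]
    simp [h]
  obtain ⟨j, hj⟩ := this
  exact ⟨fun i => b.repr (y' i) j, hbp j, i₀, hj⟩

theorem sepHom_of_isSeparable (F L : Type*) [Field F] [Field L] [Algebra F L]
    [Algebra.IsSeparable F L] : SepHom (algebraMap F L) := by
  refine sepHom_of_forall_linearIndependent fun p hp hF r x hx => ?_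
  have : ExpChar F p := .prime hp
  simpa using hx.map_pow_expChar_pow_of_isSeparable p 1

theorem sepHom_mvPolynomial (F σ : Type*) [Field F] :
    SepHom (MvPolynomial.C : F →+* MvPolynomial σ F) := by
  intro p hp hF m c y hy ⟨i, hi⟩
  have : ExpChar F p := .prime hp
  obtain ⟨n, hn⟩ := MvPolynomial.ne_zero_iff.1 hi
  refine ⟨fun j => (y j).coeff n, ?_, i, hn⟩
  have := congrArg (MvPolynomial.coeff (p • n)) hy
  simpa [MvPolynomial.coeff_sum, MvPolynomial.coeff_C_mul, ← MvPolynomial.map_frobenius_expand p,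
    MvPolynomial.coeff_map, MvPolynomial.coeff_expand_smul p hp.ne_zero, frobenius_def] using this

theorem SepHom.fractionRing {F R L : Type*} [Field F] [CommRing R] [IsDomain R] [Field L]
    [Algebra R L] [IsFractionRing R L] {f : F →+* R} (hf : SepHom f) :
    SepHom ((algebraMap R L).comp f) := by
  intro p hp hF m c y hy ⟨i₀, hi₀⟩
  obtain ⟨b, hb⟩ := IsLocalization.exist_integer_multiples_of_finite (nonZeroDivisors R) y
  choose z hz using hb
  have hb0 : algebraMap R L b ≠ 0 := IsLocalization.to_map_ne_zero_of_mem_nonZeroDivisors L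
    le_rfl b.2
  refine hf p hp hF m c z ?_ ⟨i₀, fun h => ?_⟩
  · apply IsFractionRing.injective R L
    rw [map_zero, ← mul_zero (algebraMap R L b ^ p), ← hy, map_sum, Finset.mul_sum]
    refine Finset.sum_congr rfl fun i _ => ?_
    rw [map_mul, map_pow, hz, Algebra.smul_def, mul_pow, RingHom.comp_apply]
    ring
  · have := hz i₀
    rw [h, map_zero, Algebra.smul_def] at this
    exact (mul_ne_zero hb0 hi₀) this.symm

theorem sepHom_of_isSepExt {F L : Type*} [Field F] [Field L] [Algebra F L] (h : IsSepExt F L) :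
    SepHom (algebraMap F L) := by
  classical
  intro p hp hF m c y hy ⟨i₀, hi₀⟩
  let S : Finset L := Finset.univ.image y
  obtain ⟨s, hs, hsep⟩ := h S
  let E := IntermediateField.adjoin F (S : Set L)
  have hE : SepHom (algebraMap F E) := by
    have h1 : SepHom (algebraMap F (IntermediateField.adjoin F s)) := by
      have h2 := (sepHom_mvPolynomial F s).fractionRing
        (L := FractionRing (MvPolynomial s F))
      have hr : Set.range ((↑) : s → E) = s := Subtype.range_coe
      let e := hs.aevalEquivField.symm.toAlgHom
      have h3 : SepHom (algebraMap F (IntermediateField.adjoin F (Set.range ((↑) : s → E)))) := by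
        have h4 : (algebraMap (MvPolynomial s F) (FractionRing (MvPolynomial s F))).comp
            MvPolynomial.C = e.toRingHom.comp (algebraMap F _) := by
          rw [← MvPolynomial.algebraMap_eq, ← IsScalarTower.algebraMap_eq]
          exact e.comp_algebraMap.symm
        rw [h4] at h2
        exact SepHom.of_comp h2 e.toRingHom.injective
      rwa [hr] at h3
    have := SepHom.comp (sepHom_of_isSeparable (IntermediateField.adjoin F s) E) h1
    rwa [← IsScalarTower.algebraMap_eq] at this
  have hyE : ∀ i, y i ∈ E := fun i => IntermediateField.subset_adjoin F _ (by simp [S])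
  refine hE p hp hF m c (fun i => ⟨y i, hyE i⟩) ?_ ⟨i₀, fun h => hi₀ (congrArg Subtype.val h)⟩
  apply Subtype.ext
  push_cast
  exact hy

theorem SepHom.exists_separating {F L : Type*} [Field F] [Field L] [Algebra F L]
    (h : SepHom (algebraMap F L)) [Algebra.EssFiniteType F L] :
    ∃ s : Finset L, AlgebraicIndependent F ((↑) : s → L) ∧
      Algebra.IsSeparable (IntermediateField.adjoin F (s : Set L)) L := by
  obtain _ | ⟨p, hp, hpk⟩ := CharP.exists' F
  · obtain ⟨s, hs, hs'⟩ := exists_isTranscendenceBasis_and_isSeparable_of_perfectField F L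
    exact ⟨s, hs.1, hs'⟩
  · have : ExpChar F p := .prime hp.1
    obtain ⟨s, hs, hs'⟩ :=
      exists_isTranscendenceBasis_and_isSeparable_of_linearIndepOn_pow_of_essFiniteType
        (k := F) (K := L) p hp.1 (fun s hs => h.linearIndepOn_pow hp.1 s hs)
    exact ⟨s, hs.1, hs'⟩

end Paper

namespace Paper

/-- A henselianity condition for a valuation subring, phrased through equations
`1 + y + ∑ aᵢ y ^ (i + 2) = 0` with all `aᵢ` in the maximal ideal. -/
def HensV {K : Type*} [Field K] (A : ValuationSubring K) : Prop :=
  ∀ (n : ℕ) (a : ℕ → K), (∀ i < n, a i ∈ A.nonunits) →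
    ∃ y ∈ A, 1 + y + ∑ i ∈ Finset.range n, a i * y ^ (i + 2) = 0

section

variable {K : Type*} [Field K]

theorem mem_maximalIdeal_iff_nonunits {A : ValuationSubring K} (x : A) :
    x ∈ IsLocalRing.maximalIdeal A ↔ (x : K) ∈ A.nonunits := by
  rw [ValuationSubring.coe_mem_nonunits_iff]

theorem HensV.of_le {A B : ValuationSubring K} (h : HensV A) (hAB : A ≤ B) : HensV B := by
  intro n a ha
  obtain ⟨y, hy, hy'⟩ := h n a fun i hi => ValuationSubring.nonunits_le_nonunits.2 hAB (ha i hi)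
  exact ⟨y, hAB hy, hy'⟩

theorem hensV_of_henselianLocalRing {A : ValuationSubring K} [HenselianLocalRing A] :
    HensV A := by
  intro n a ha
  have hA : ∀ i < n, a i ∈ A := fun i hi => A.nonunits_subset (ha i hi)
  let b : ℕ → A := fun i => if h : i < n then ⟨a i, hA i h⟩ else 0
  have hb : ∀ i < n, (b i : K) = a i := fun i hi => by simp [b, hi]
  have hbm : ∀ i < n, b i ∈ IsLocalRing.maximalIdeal A := fun i hi => by
    rw [mem_maximalIdeal_iff_nonunits, hb i hi]; exact ha i hi
  let g : Polynomial A := Polynomial.X ^ n +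
    ∑ i ∈ Finset.range n, Polynomial.C (b i) * Polynomial.X ^ (n - 1 - i)
  let f : Polynomial A := Polynomial.X ^ (n + 1) + g
  have hg : g.degree < (n + 1 : ℕ) := by
    refine lt_of_le_of_lt (Polynomial.degree_add_le _ _) (max_lt ?_ ?_)
    · rw [Polynomial.degree_X_pow]; exact_mod_cast Nat.lt_succ_self n
    · refine lt_of_le_of_lt (Polynomial.degree_sum_le _ _) ?_
      rw [Finset.sup_lt_iff (by exact WithBot.bot_lt_coe _)]
      intro i _
      refine lt_of_le_of_lt (Polynomial.degree_C_mul_X_pow_le _ _) ?_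
      exact_mod_cast (by omega : n - 1 - i < n + 1)
  have hf : f.Monic := Polynomial.monic_X_pow_add hg
  have hsum : ∀ z : A, ∑ i ∈ Finset.range n, b i * z ^ (n - 1 - i) ∈ IsLocalRing.maximalIdeal A :=
    fun z => Ideal.sum_mem _ fun i hi => Ideal.mul_mem_right _ _ (hbm i (Finset.mem_range.1 hi))
  have hf0 : f.eval (-1) ∈ IsLocalRing.maximalIdeal A := by
    have : f.eval (-1) = ∑ i ∈ Finset.range n, b i * (-1) ^ (n - 1 - i) := by
      simp only [f, g, Polynomial.eval_add, Polynomial.eval_pow, Polynomial.eval_X,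
        Polynomial.eval_finsetSum, Polynomial.eval_mul, Polynomial.eval_C]
      ring
    rw [this]
    exact hsum _
  have hf1 : IsUnit (f.derivative.eval (-1)) := by
    have h1 : f.derivative.eval (-1) - (-1) ^ n ∈ IsLocalRing.maximalIdeal A := by
      have : f.derivative.eval (-1) - (-1) ^ n = ∑ i ∈ Finset.range n,
          b i * (((n - 1 - i : ℕ) : A) * (-1) ^ (n - 1 - i - 1)) := by
        simp only [f, g, Polynomial.derivative_add, Polynomial.derivative_sum,
          Polynomial.derivative_X_pow, Polynomial.derivative_C_mul, Polynomial.eval_add,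
          Polynomial.eval_pow, Polynomial.eval_X, Polynomial.eval_natCast,
          Polynomial.eval_finsetSum, Polynomial.eval_mul, Polynomial.eval_C]
        rcases n with _ | n
        · simp
        · simp; ring
      rw [this]
      exact Ideal.sum_mem _ fun i hi => Ideal.mul_mem_right _ _ (hbm i (Finset.mem_range.1 hi))
    by_contra hu
    have h2 : (-1 : A) ^ n ∈ IsLocalRing.maximalIdeal A := by
      have := Ideal.sub_mem _ ((IsLocalRing.mem_maximalIdeal _).2 hu) h1
      simpa using this
    exact (IsLocalRing.mem_maximalIdeal _).1 h2 ((isUnit_one.neg).pow n)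
  obtain ⟨z, hz, hz'⟩ := HenselianLocalRing.is_henselian f hf (-1) hf0 hf1
  have hzu : IsUnit z := by
    by_contra hu
    have := Ideal.sub_mem _ ((IsLocalRing.mem_maximalIdeal _).2 hu) hz'
    simp at this
  obtain ⟨y, hy⟩ := hzu.exists_left_inv
  refine ⟨y, y.2, ?_⟩
  have key : 1 + y + ∑ i ∈ Finset.range n, b i * y ^ (i + 2) = 0 := by
    have h0 : y ^ (n + 1) * f.eval z = 0 := by rw [hz.eq_zero, mul_zero]
    rw [← h0]
    simp only [f, g, Polynomial.eval_add, Polynomial.eval_pow, Polynomial.eval_X,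
        Polynomial.eval_finsetSum, Polynomial.eval_mul, Polynomial.eval_C]
    rw [mul_add, mul_add, ← mul_pow, hy, one_pow, pow_succ, mul_right_comm, ← mul_pow, hy,
      one_pow, one_mul, Finset.mul_sum, ← add_assoc]
    congr 1
    refine Finset.sum_congr rfl fun i hi => ?_
    have : n + 1 = (i + 2) + (n - 1 - i) := by have := Finset.mem_range.1 hi; omega
    have h2 : y ^ (n - 1 - i) * z ^ (n - 1 - i) = 1 := by rw [← mul_pow, hy, one_pow]
    rw [← pow_succ, this, pow_add]
    linear_combination (-(b i * y ^ (i + 2))) * h2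
  have := congrArg (Subtype.val) key
  push_cast at this
  rw [← this]
  congr 1
  exact Finset.sum_congr rfl fun i hi => by rw [hb i (Finset.mem_range.1 hi)]

theorem HensV.exists_root {A : ValuationSubring K} (h : HensV A) (f : Polynomial A) (a₀ : A)
    (h0 : f.eval a₀ ∈ IsLocalRing.maximalIdeal A) (h1 : IsUnit (f.derivative.eval a₀)) :
    ∃ a, f.eval a = 0 ∧ a - a₀ ∈ IsLocalRing.maximalIdeal A := by
  let g := Polynomial.taylor a₀ f
  have hg0 : g.coeff 0 = f.eval a₀ := Polynomial.taylor_coeff_zero _ _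
  have hg1 : g.coeff 1 = f.derivative.eval a₀ := Polynomial.taylor_coeff_one _ _
  obtain ⟨b, hb⟩ := h1.exists_left_inv
  let n := g.natDegree
  obtain ⟨y, hy, hy'⟩ := h n (fun i => (g.coeff (i + 2) * g.coeff 0 ^ (i + 1) * b ^ (i + 2) : A))
    fun i _ => by
      rw [← mem_maximalIdeal_iff_nonunits]
      refine Ideal.mul_mem_right _ _ (Ideal.mul_mem_left _ _ ?_)
      rw [pow_succ]
      exact Ideal.mul_mem_left _ _ (hg0 ▸ h0)
  let Y : A := ⟨y, hy⟩
  have hY : 1 + Y + ∑ i ∈ Finset.range n,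
      (g.coeff (i + 2) * g.coeff 0 ^ (i + 1) * b ^ (i + 2)) * Y ^ (i + 2) = 0 := by
    apply Subtype.ext
    push_cast
    rw [← hy']
    push_cast
    rfl
  let z := g.coeff 0 * b * Y
  have hz : g.eval z = 0 := by
    rw [Polynomial.eval_eq_sum_range' (n := n + 2) (by omega), Finset.sum_range_succ',
      Finset.sum_range_succ']
    rw [← mul_zero (g.coeff 0), ← hY, mul_add, mul_add, Finset.mul_sum]
    have e1 : g.coeff (0 + 1) * z ^ (0 + 1) = g.coeff 0 * Y := by
      rw [zero_add, pow_one, hg1]; simp only [z]; linear_combination (g.coeff 0 * Y) * hb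
    rw [e1, pow_zero, mul_one, add_assoc, add_comm, add_comm (g.coeff 0 * Y)]
    congr 1
    refine Finset.sum_congr rfl fun i _ => ?_
    simp only [z]; ring
  refine ⟨z + a₀, ?_, ?_⟩
  · rwa [Polynomial.taylor_eval] at hz
  · rw [add_sub_cancel_right]
    exact Ideal.mul_mem_right _ _ (Ideal.mul_mem_right _ _ (hg0 ▸ h0))

end

section Lift

variable {K : Type*} [Field K] {A : ValuationSubring K} {C : Type*} [Field C] [Algebra C A]

theorem HensV.exists_lift_of_essFiniteType (hA : HensV A) {E : Type*} [Field E] [Algebra C E]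
    [Algebra.EssFiniteType C E] (hE : SepHom (algebraMap C E))
    (Φ : E →+* IsLocalRing.ResidueField A)
    (hΦ : ∀ c, Φ (algebraMap C E c) = IsLocalRing.residue A (algebraMap C A c)) :
    ∃ l : E →+* A, (∀ c, l (algebraMap C E c) = algebraMap C A c) ∧
      ∀ x, IsLocalRing.residue A (l x) = Φ x := by
  obtain ⟨s, hs, hsep⟩ := hE.exists_separating
  let B := IntermediateField.adjoin C (s : Set E)
  choose t ht using fun x : s => IsLocalRing.residue_surjective (R := A) (Φ x)
  have hcomp : ∀ q : MvPolynomial s C, IsLocalRing.residue A (MvPolynomial.aeval t q) =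
      Φ (MvPolynomial.aeval ((↑) : s → E) q) := by
    intro q
    induction q using MvPolynomial.induction_on with
    | C c => simp [hΦ]
    | add p q hp hq => simp [hp, hq]
    | mul_X p i hp => simp [hp, ht]
  have hunit : ∀ q : nonZeroDivisors (MvPolynomial s C),
      IsUnit ((MvPolynomial.aeval t : MvPolynomial s C →ₐ[C] A).toRingHom q) := by
    intro q
    rw [← IsLocalRing.residue_ne_zero_iff_isUnit]
    refine (hcomp q).trans_ne ?_
    rw [map_ne_zero_iff Φ Φ.injective]
    intro h
    exact nonZeroDivisors.ne_zero q.2 (hs.eq_zero_of_aeval_eq_zero _ h)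
  let ψ₀ : FractionRing (MvPolynomial s C) →+* A := IsLocalization.lift hunit
  have hr : Set.range ((↑) : s → E) = s := Subtype.range_coe
  have hψ : ∃ ψ : B →+* A, (∀ c, ψ (algebraMap C B c) = algebraMap C A c) ∧
      ∀ x : B, IsLocalRing.residue A (ψ x) = Φ x := by
    have : ∃ ψ : IntermediateField.adjoin C (Set.range ((↑) : s → E)) →+* A,
        (∀ c, ψ (algebraMap C _ c) = algebraMap C A c) ∧
        ∀ x, IsLocalRing.residue A (ψ x) = Φ x := by
      let e := hs.aevalEquivField
      have hψ₀ : ∀ q, ψ₀ (algebraMap _ _ q) = MvPolynomial.aeval t q :=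
        fun q => IsLocalization.lift_eq hunit q
      refine ⟨ψ₀.comp e.symm.toAlgHom.toRingHom, fun c => ?_, fun x => ?_⟩
      · have : e.symm (algebraMap C _ c) = algebraMap (MvPolynomial s C) _ (MvPolynomial.C c) := by
          rw [AlgEquiv.commutes, IsScalarTower.algebraMap_apply C (MvPolynomial s C)]
          rfl
        simp only [RingHom.comp_apply]
        refine (congrArg ψ₀ this).trans ?_
        rw [hψ₀]; simp
      · have : (IsLocalRing.residue A).comp ψ₀ =
            Φ.comp ((IntermediateField.val _).toRingHom.comp e.toAlgHom.toRingHom) := by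
          refine IsLocalization.ringHom_ext (nonZeroDivisors (MvPolynomial s C)) ?_
          refine RingHom.ext fun q => ?_
          simp only [RingHom.comp_apply]
          rw [hψ₀, hcomp]
          exact congrArg Φ (hs.aevalEquivField_algebraMap_apply_coe q).symm
        exact (RingHom.congr_fun this (e.symm x)).trans
          (congrArg (fun z => Φ (Subtype.val z)) (e.apply_symm_apply x))
    rwa [hr] at this
  obtain ⟨ψ, hψC, hψ⟩ := hψ
  have : Algebra.EssFiniteType B E := Algebra.EssFiniteType.of_comp C B E
  have : FiniteDimensional B E := by
    obtain ⟨T, hT⟩ := IntermediateField.fg_top B E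
    have hfin : FiniteDimensional B (IntermediateField.adjoin B (T : Set E)) :=
      IntermediateField.finiteDimensional_adjoin fun x _ => Algebra.IsIntegral.isIntegral x
    rw [hT] at hfin
    exact Module.Finite.equiv IntermediateField.topEquiv.toLinearEquiv
  let pb := Field.powerBasisOfFiniteOfSeparable B E
  let f := (minpoly B pb.gen).map ψ
  obtain ⟨a₀, ha₀⟩ := IsLocalRing.residue_surjective (R := A) (Φ pb.gen)
  have hev : ∀ q : Polynomial B, IsLocalRing.residue A ((q.map ψ).eval a₀) =
      Φ (Polynomial.aeval pb.gen q) := by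
    intro q
    induction q using Polynomial.induction_on' with
    | add p q hp hq => simp [hp, hq]
    | monomial n c => simp [hψ, ha₀]
  obtain ⟨a, ha, haa⟩ := hA.exists_root f a₀
    (by rw [← IsLocalRing.residue_eq_zero_iff, hev, minpoly.aeval, map_zero])
    (by
      rw [← IsLocalRing.residue_ne_zero_iff_isUnit, Polynomial.derivative_map, hev,
        map_ne_zero_iff Φ Φ.injective]
      exact (Algebra.IsSeparable.isSeparable B pb.gen).aeval_derivative_ne_zero (minpoly.aeval _ _))
  let := ψ.toAlgebra
  have hroot : Polynomial.aeval a (minpoly B pb.gen) = 0 := by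
    rw [Polynomial.aeval_def, ← Polynomial.eval_map]; exact ha
  let l := pb.lift a hroot
  refine ⟨l.toRingHom, fun c => ?_, fun x => ?_⟩
  · rw [IsScalarTower.algebraMap_apply C B E]
    exact (l.commutes _).trans (hψC c)
  · let ρ : E →ₐ[B] IsLocalRing.ResidueField A :=
      { Φ with commutes' := fun b => (hψ b).symm }
    have : (IsScalarTower.toAlgHom B A (IsLocalRing.ResidueField A)).comp l = ρ := by
      refine pb.algHom_ext ?_
      rw [AlgHom.comp_apply, pb.lift_gen]
      change IsLocalRing.residue A a = Φ pb.gen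
      rw [← ha₀, ← sub_eq_zero, ← map_sub, IsLocalRing.residue_eq_zero_iff]
      exact haa
    exact AlgHom.congr_fun this x

theorem HensV.exists_lift_adjoin (hA : HensV A) {L : Type*} [Field L] [Algebra C L]
    (hL : SepHom (algebraMap C L)) (Φ : L →+* IsLocalRing.ResidueField A)
    (hΦ : ∀ c, Φ (algebraMap C L c) = IsLocalRing.residue A (algebraMap C A c)) (S : Finset L) :
    ∃ l : IntermediateField.adjoin C (S : Set L) →+* A,
      (∀ c, l (algebraMap C _ c) = algebraMap C A c) ∧
        ∀ x, IsLocalRing.residue A (l x) = Φ x := by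
  have : Algebra.EssFiniteType C (IntermediateField.adjoin C (S : Set L)) :=
    IntermediateField.essFiniteType_iff.2 (IntermediateField.fg_adjoin_finset S)
  let ι := (IntermediateField.adjoin C (S : Set L)).val.toRingHom
  exact hA.exists_lift_of_essFiniteType (SepHom.of_comp (g := ι) hL ι.injective) (Φ.comp ι) hΦ

theorem HensV.exLe (hA : HensV A) {L : Type*} [Field L] [Algebra C L]
    (hL : SepHom (algebraMap C L)) (Φ : L →+* IsLocalRing.ResidueField A)
    (hΦ : ∀ c, Φ (algebraMap C L c) = IsLocalRing.residue A (algebraMap C A c)) :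
    ExLe C L A := by
  classical
  intro m x P
  let S : Finset L := Finset.univ.image x
  obtain ⟨l, hl, -⟩ := hA.exists_lift_adjoin hL Φ hΦ S
  let E := IntermediateField.adjoin C (S : Set L)
  let x' : Fin m → E := fun i => ⟨x i, IntermediateField.subset_adjoin C _ (by simp [S])⟩
  let l' : E →ₐ[C] A := { l with commutes' := hl }
  refine ⟨fun i => l (x' i), fun p _ => ?_⟩
  have h1 : MvPolynomial.aeval x p = (MvPolynomial.aeval x' p : E) := by
    rw [← IntermediateField.val_mk (S := E) (x := MvPolynomial.aeval x' p) (hx := Subtype.property _)]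
    change _ = E.val (MvPolynomial.aeval x' p)
    rw [← AlgHom.comp_apply, MvPolynomial.comp_aeval]; rfl
  have h2 : MvPolynomial.aeval (fun i => l (x' i)) p = l' (MvPolynomial.aeval x' p) := by
    rw [← AlgHom.comp_apply, MvPolynomial.comp_aeval]; rfl
  rw [h1, h2, map_eq_zero_iff l' l'.toRingHom.injective]
  simp

end Lift

end Paper

namespace Paper

/-- Existential transfer along a pair of ring homomorphisms with the same source. -/
def ExHom {C M N : Type*} [CommRing C] [CommRing M] [CommRing N] (f : C →+* M) (g : C →+* N) :
    Prop :=
  ∀ (m : ℕ) (x : Fin m → M) (P : Finset (MvPolynomial (Fin m) C)),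
    ∃ y : Fin m → N, ∀ p ∈ P, MvPolynomial.eval₂ f x p = 0 ↔ MvPolynomial.eval₂ g y p = 0

section ExHom

variable {C M N Q : Type*} [CommRing C] [CommRing M] [CommRing N] [CommRing Q] {f : C →+* M}
  {g : C →+* N} {h : C →+* Q}

theorem ExHom.trans (hfg : ExHom f g) (hgh : ExHom g h) : ExHom f h := by
  intro m x P
  obtain ⟨y, hy⟩ := hfg m x P
  obtain ⟨z, hz⟩ := hgh m y P
  exact ⟨z, fun p hp => (hy p hp).trans (hz p hp)⟩

theorem ExHom.of_injective (e : M →+* N) (he : Function.Injective e) (hef : e.comp f = g) :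
    ExHom f g := by
  intro m x P
  refine ⟨e ∘ x, fun p _ => ?_⟩
  rw [← hef, ← MvPolynomial.eval₂_comp_left, map_eq_zero_iff e he]

theorem ExHom.realize_of_isExistsN (hfg : ExHom f g) {n : ℕ}
    {φ : (Language.ring[[C]]).Sentence} (hφ : IsExistsN n φ)
    (h : RealizeRing M f φ) : RealizeRing N g φ := by
  let := f.toAlgebra
  let := g.toAlgebra
  exact ExLe.realize_of_isExistsN (C := C) (M := M) (N := N) hfg hφ h

end ExHom

open Filter

section Germ

variable {I : Type*} (U : Ultrafilter I) {K : Type*} [Field K]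

/-- The diagonal embedding of a field into its ultrapower. -/
noncomputable def constGerm : K →+* Germ (U : Filter I) K :=
  (Germ.coeRingHom (U : Filter I)).comp (Pi.constRingHom I K)

theorem constGerm_apply (a : K) : constGerm U a = ((fun _ => a : I → K) : Germ (U : Filter I) K) :=
  rfl

theorem eval₂_germ {C : Type*} [CommRing C] (f : C →+* K) {m : ℕ} (x : Fin m → I → K)
    (p : MvPolynomial (Fin m) C) :
    MvPolynomial.eval₂ ((constGerm U).comp f) (fun j => (x j : Germ (U : Filter I) K)) p =
      ((fun i => MvPolynomial.eval₂ f (fun j => x j i) p : I → K) : Germ (U : Filter I) K) := by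
  have h1 := MvPolynomial.eval₂_comp_left (Germ.coeRingHom (R := K) (U : Filter I))
    ((Pi.constRingHom I K).comp f) x p
  refine h1.symm.trans ?_
  refine congrArg (Germ.coeRingHom (R := K) (U : Filter I)) (funext fun i => ?_)
  exact MvPolynomial.eval₂_comp_left (Pi.evalRingHom (fun _ : I => K) i) _ x p

theorem germ_coe_eq_zero {x : I → K} :
    (x : Germ (U : Filter I) K) = 0 ↔ ∀ᶠ i in (U : Filter I), x i = 0 :=
  Germ.coe_eq

theorem exHom_germ {C : Type*} [CommRing C] (f : C →+* K) : ExHom ((constGerm U).comp f) f := by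
  intro m x P
  choose x' hx' using fun j => Quotient.exists_rep (x j)
  have hx : x = fun j => (x' j : Germ (U : Filter I) K) := funext fun j => (hx' j).symm
  have key : ∀ p ∈ P, ∀ᶠ i in (U : Filter I), MvPolynomial.eval₂ ((constGerm U).comp f) x p = 0 ↔
      MvPolynomial.eval₂ f (fun j => x' j i) p = 0 := by
    intro p _
    rw [hx, eval₂_germ, germ_coe_eq_zero]
    by_cases h : ∀ᶠ i in (U : Filter I), MvPolynomial.eval₂ f (fun j => x' j i) p = 0
    · filter_upwards [h] with i hi
      simp [h, hi]
    · have h' := Ultrafilter.eventually_not.2 h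
      filter_upwards [h'] with i hi
      exact iff_of_false h hi
  obtain ⟨i, hi⟩ := ((eventually_all_finset P).2 key).exists
  exact ⟨fun j => x' j i, hi⟩

/-- The ultrapower of a valuation subring. -/
noncomputable def germV (A : ValuationSubring K) : ValuationSubring (Germ (U : Filter I) K) where
  carrier := {x | x.LiftPred (· ∈ A)}
  mul_mem' {x y} := by
    refine Germ.inductionOn₂ x y fun x y hx hy => ?_
    exact hx.mp (hy.mono fun i hy hx => A.mul_mem _ _ hx hy)
  one_mem' := Eventually.of_forall fun _ => A.one_mem
  add_mem' {x y} := by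
    refine Germ.inductionOn₂ x y fun x y hx hy => ?_
    exact hx.mp (hy.mono fun i hy hx => A.add_mem _ _ hx hy)
  zero_mem' := Eventually.of_forall fun _ => A.zero_mem
  neg_mem' {x} := by
    refine Germ.inductionOn x fun x hx => ?_
    exact hx.mono fun i hx => A.neg_mem _ hx
  mem_or_inv_mem' x := by
    refine Germ.inductionOn x fun x => ?_
    have := Ultrafilter.eventually_or.1 (Eventually.of_forall (f := (U : Filter I)) fun i =>
      A.mem_or_inv_mem (x i))
    exact this

variable {U}

theorem coe_mem_germV {A : ValuationSubring K} {x : I → K} :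
    (x : Germ (U : Filter I) K) ∈ germV U A ↔ ∀ᶠ i in (U : Filter I), x i ∈ A := Iff.rfl

theorem coe_mem_nonunits_germV {A : ValuationSubring K} {x : I → K} :
    (x : Germ (U : Filter I) K) ∈ (germV U A).nonunits ↔
      ∀ᶠ i in (U : Filter I), x i ∈ A.nonunits := by
  simp_rw [ValuationSubring.mem_nonunits_iff_or]
  rw [germ_coe_eq_zero, Ultrafilter.eventually_or, Ultrafilter.eventually_not]
  rfl

theorem HensV.germV {A : ValuationSubring K} (h : HensV A) : HensV (germV U A) := by
  intro n a ha
  choose a' ha' using fun j => Quotient.exists_rep (a j)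
  have hx : a = fun j => (a' j : Germ (U : Filter I) K) := funext fun j => (ha' j).symm
  have hev : ∀ᶠ i in (U : Filter I), ∀ j ∈ Finset.range n, a' j i ∈ A.nonunits := by
    refine (eventually_all_finset _).2 fun j hj => coe_mem_nonunits_germV.1 ?_
    have := ha j (Finset.mem_range.1 hj)
    rwa [hx] at this
  have hev' : ∀ i, ∃ y, (∀ j ∈ Finset.range n, a' j i ∈ A.nonunits) →
      y ∈ A ∧ 1 + y + ∑ j ∈ Finset.range n, a' j i * y ^ (j + 2) = 0 := fun i => by
    by_cases hi : ∀ j ∈ Finset.range n, a' j i ∈ A.nonunits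
    · obtain ⟨y, hy⟩ := h n (fun j => a' j i) fun j hj => hi j (Finset.mem_range.2 hj)
      exact ⟨y, fun _ => hy⟩
    · exact ⟨0, fun h => absurd h hi⟩
  choose y hy using hev'
  refine ⟨(y : Germ (U : Filter I) K), hev.mono fun i hi => (hy i hi).1, ?_⟩
  have hsum : (1 + (y : Germ (U : Filter I) K) + ∑ j ∈ Finset.range n, a j * y ^ (j + 2)) =
      ((fun i => 1 + y i + ∑ j ∈ Finset.range n, a' j i * y i ^ (j + 2) : I → K) :
        Germ (U : Filter I) K) := by
    rw [hx]
    let c := Germ.coeRingHom (R := K) (U : Filter I)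
    have : (fun i => 1 + y i + ∑ j ∈ Finset.range n, a' j i * y i ^ (j + 2)) =
      1 + y + ∑ j ∈ Finset.range n, a' j * y ^ (j + 2) := by
      ext i; simp
    rw [this]
    change 1 + c y + ∑ j ∈ Finset.range n, c (a' j) * c y ^ (j + 2) = c _
    simp only [map_add, map_one, map_sum, map_mul, map_pow]
  rw [hsum]
  exact (germ_coe_eq_zero U).2 (hev.mono fun i hi => (hy i hi).2)

end Germ

section Coarse

variable {K : Type*} [Field K]

/-- The coarsening of a valuation subring in which a given element becomes invertible. -/
def coarse (A : ValuationSubring K) (t : K) (ht : t ∈ A) : ValuationSubring K where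
  carrier := {y | ∃ k : ℕ, t ^ k * y ∈ A}
  mul_mem' := by
    rintro x y ⟨k, hk⟩ ⟨l, hl⟩
    exact ⟨k + l, by convert A.mul_mem _ _ hk hl using 1; ring⟩
  one_mem' := ⟨0, by simpa using A.one_mem⟩
  add_mem' := by
    rintro x y ⟨k, hk⟩ ⟨l, hl⟩
    refine ⟨k + l, ?_⟩
    convert A.add_mem _ _ (A.mul_mem _ _ (pow_mem ht l) hk) (A.mul_mem _ _ (pow_mem ht k) hl)
      using 1
    ring
  zero_mem' := ⟨0, by simpa using A.zero_mem⟩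
  neg_mem' := by
    rintro x ⟨k, hk⟩
    exact ⟨k, by simpa using A.neg_mem _ hk⟩
  mem_or_inv_mem' x := by
    rcases A.mem_or_inv_mem x with h | h
    · exact .inl ⟨0, by simpa⟩
    · exact .inr ⟨0, by simpa⟩

variable {A : ValuationSubring K} {t : K}

theorem mem_coarse {ht : t ∈ A} {y : K} : y ∈ coarse A t ht ↔ ∃ k : ℕ, t ^ k * y ∈ A := Iff.rfl

theorem le_coarse (ht : t ∈ A) : A ≤ coarse A t ht := fun y hy => ⟨0, by simpa using hy⟩

theorem mem_nonunits_coarse (ht : t ∈ A.nonunits) (ht0 : t ≠ 0) {y : K} :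
    y ∈ (coarse A t (A.nonunits_le ht)).nonunits ↔ ∀ k : ℕ, ∃ z ∈ A, y = t ^ k * z := by
  rw [ValuationSubring.mem_nonunits_iff_or, mem_coarse]
  constructor
  · rintro (rfl | h) k
    · exact ⟨0, A.zero_mem, by simp⟩
    · push Not at h
      refine ⟨y / t ^ k, ?_, by field_simp⟩
      have := (A.mem_or_inv_mem (t ^ k * y⁻¹)).resolve_left (h k)
      rwa [mul_inv, inv_inv, mul_comm, ← div_eq_mul_inv] at this
  · intro h
    by_cases hy : y = 0
    · exact .inl hy
    right
    rintro ⟨k, hk⟩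
    obtain ⟨z, hz, hyz⟩ := h (k + 1)
    have h1 : t * z ∈ A.nonunits := by
      rw [ValuationSubring.mem_nonunits_iff, map_mul]
      exact lt_of_le_of_lt (mul_le_of_le_one_right' ((A.valuation_le_one_iff _).2 hz)) ht
    rcases (ValuationSubring.mem_nonunits_iff_or A).1 h1 with h0 | h0
    · apply hy; rw [hyz, pow_succ, mul_assoc, h0, mul_zero]
    · apply h0
      convert hk using 1
      rw [hyz]
      have : z ≠ 0 := by rintro rfl; simp at hyz; exact hy hyz
      field_simp
      ring

end Coarse

end Paper

namespace Paper

theorem HensV.exHom {C K L : Type*} [Field C] [Field K] [Field L] {A : ValuationSubring K}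
    (hA : HensV A) (f : C →+* A) {g : C →+* L} (hg : SepHom g)
    (Φ : L →+* IsLocalRing.ResidueField A)
    (hΦ : ∀ c, Φ (g c) = IsLocalRing.residue A (f c)) : ExHom g (A.subtype.comp f) := by
  let := f.toAlgebra
  let := g.toAlgebra
  have h : ExHom g f := hA.exLe (C := C) (L := L) hg Φ hΦ
  exact h.trans (ExHom.of_injective A.subtype Subtype.val_injective rfl)

open Filter

section Approx

variable {K : Type*} [Field K] (A : ValuationSubring K) (ϖ : K)

/-- Two sequences whose `n`-th entries agree modulo the `n`-th power of `ϖ`. -/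
def ApproxEq (y z : ℕ → K) : Prop :=
  ∀ n, ∃ a ∈ A, y n - z n = ϖ ^ n * a

/-- A compatible family of maps to `A` approximating a ring homomorphism to its completion. -/
structure ApproxHom (R : Type*) [CommRing R] (τ : ℕ → R → K) : Prop where
  mem : ∀ n r, τ n r ∈ A
  approx_one : ApproxEq A ϖ (fun n => τ n 1) 1
  approx_zero : ApproxEq A ϖ (fun n => τ n 0) 0
  approx_add : ∀ r s, ApproxEq A ϖ (fun n => τ n (r + s)) (fun n => τ n r + τ n s)
  approx_mul : ∀ r s, ApproxEq A ϖ (fun n => τ n (r * s)) (fun n => τ n r * τ n s)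
  exists_not_mem : ∀ r, r ≠ 0 → ∃ k : ℕ, ∀ᶠ n in atTop, ¬ ∃ a ∈ A, τ n r = ϖ ^ k * a

variable {A ϖ}

theorem const_mem_nonunits_germV (U : Ultrafilter ℕ) (hϖ : ϖ ∈ A.nonunits) :
    constGerm U ϖ ∈ (germV U A).nonunits :=
  coe_mem_nonunits_germV.2 (Eventually.of_forall fun _ => hϖ)

/-- The finest coarsening of the ultrapower of `A` in which `ϖ` is a unit. -/
noncomputable abbrev coarseGerm (U : Ultrafilter ℕ) (hϖ : ϖ ∈ A.nonunits) :
    ValuationSubring (Germ (U : Filter ℕ) K) :=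
  coarse (germV U A) (constGerm U ϖ) ((germV U A).nonunits_le (const_mem_nonunits_germV U hϖ))

theorem coe_mem_nonunits_coarseGerm {U : Ultrafilter ℕ} {hϖ : ϖ ∈ A.nonunits} (h0 : ϖ ≠ 0)
    {y : ℕ → K} : (y : Germ (U : Filter ℕ) K) ∈ (coarseGerm U hϖ).nonunits ↔
      ∀ k : ℕ, ∀ᶠ n in (U : Filter ℕ), ∃ a ∈ A, y n = ϖ ^ k * a := by
  have h0' : constGerm U ϖ ≠ 0 := (map_ne_zero _).2 h0
  refine (mem_nonunits_coarse (const_mem_nonunits_germV U hϖ) h0').trans (forall_congr' fun k => ?_)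
  constructor
  · rintro ⟨z, hz, hyz⟩
    induction z using Germ.inductionOn with | h z
    have h1 : ((constGerm U ϖ) ^ k * (z : Germ (U : Filter ℕ) K)) =
        ((fun n => ϖ ^ k * z n : ℕ → K) : Germ (U : Filter ℕ) K) := rfl
    rw [h1, Germ.coe_eq] at hyz
    filter_upwards [hyz, coe_mem_germV.1 hz] with n hn hn'
    exact ⟨z n, hn', hn⟩
  · intro h
    refine ⟨((fun n => y n / ϖ ^ k : ℕ → K) : Germ (U : Filter ℕ) K), ?_, ?_⟩
    · rw [coe_mem_germV]
      filter_upwards [h] with n ⟨a, ha, hn⟩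
      rw [hn]
      convert ha using 1
      field_simp
    · have h1 : ((constGerm U ϖ) ^ k * ((fun n => y n / ϖ ^ k : ℕ → K) : Germ (U : Filter ℕ) K)) =
        ((fun n => ϖ ^ k * (y n / ϖ ^ k) : ℕ → K) : Germ (U : Filter ℕ) K) := rfl
      rw [h1]
      congr 1
      ext n
      field_simp

theorem pow_mul_mem_of_le (hϖ : ϖ ∈ A) {k n : ℕ} (hkn : k ≤ n) {a : K} (ha : a ∈ A) :
    ∃ b ∈ A, ϖ ^ n * a = ϖ ^ k * b :=
  ⟨ϖ ^ (n - k) * a, A.mul_mem _ _ (pow_mem hϖ _) ha, by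
    rw [← mul_assoc, ← pow_add, Nat.add_sub_cancel' hkn]⟩

theorem ApproxEq.sub_mem {U : Ultrafilter ℕ} (hU : (U : Filter ℕ) ≤ atTop)
    (hϖ : ϖ ∈ A.nonunits) (h0 : ϖ ≠ 0) {y z : ℕ → K} (h : ApproxEq A ϖ y z) :
    (y : Germ (U : Filter ℕ) K) - (z : Germ (U : Filter ℕ) K) ∈ (coarseGerm U hϖ).nonunits := by
  refine (coe_mem_nonunits_coarseGerm (y := y - z) h0).2 fun k => ?_
  filter_upwards [hU (eventually_ge_atTop k)] with n hn
  obtain ⟨a, ha, h⟩ := h n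
  obtain ⟨b, hb, h'⟩ := pow_mul_mem_of_le (A.nonunits_le hϖ) hn ha
  exact ⟨b, hb, h.trans h'⟩

theorem residue_eq_iff {F : Type*} [Field F] {B : ValuationSubring F} {x y : B} :
    IsLocalRing.residue B x = IsLocalRing.residue B y ↔ (x - y : F) ∈ B.nonunits := by
  rw [← sub_eq_zero, ← map_sub, IsLocalRing.residue_eq_zero_iff, mem_maximalIdeal_iff_nonunits]
  rfl

theorem ApproxHom.exHom {C R L : Type*} [Field C] [CommRing R] [IsDomain R] [Field L] [Algebra R L]
    [IsFractionRing R L] (hA : HensV A) (hϖ : ϖ ∈ A.nonunits) (h0 : ϖ ≠ 0) {τ : ℕ → R → K}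
    (hτ : ApproxHom A ϖ R τ) (i : C →+* K) {g : C →+* L} (hg : SepHom g)
    (hi : ∀ c, ∃ k : ℕ, ϖ ^ k * i c ∈ A)
    (S : Set C) (hS : ∀ c, ∃ a ∈ S, ∃ b ∈ S, b ≠ 0 ∧ c * b = a)
    (hgood : ∀ a ∈ S, i a ∈ A ∧ ∃ r, g a = algebraMap R L r ∧
      ApproxEq A ϖ (fun n => τ n r) (fun _ => i a)) :
    ExHom g i := by
  let U : Ultrafilter ℕ := hyperfilter ℕ
  have hU : (U : Filter ℕ) ≤ atTop := by
    rw [← Nat.cofinite_eq_atTop]; exact hyperfilter_le_cofinite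
  let B := coarseGerm U hϖ
  have hB : HensV B := hA.germV.of_le (le_coarse _)
  let t : R → B := fun r => ⟨((fun n => τ n r : ℕ → K) : Germ (U : Filter ℕ) K),
    le_coarse _ (coe_mem_germV.2 (Eventually.of_forall fun n => hτ.mem n r))⟩
  let T : R →+* IsLocalRing.ResidueField B :=
    { toFun := fun r => IsLocalRing.residue B (t r)
      map_one' := by
        rw [← map_one (IsLocalRing.residue B), residue_eq_iff]
        exact hτ.approx_one.sub_mem hU hϖ h0
      map_zero' := by
        rw [← map_zero (IsLocalRing.residue B), residue_eq_iff]
        exact hτ.approx_zero.sub_mem hU hϖ h0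
      map_add' := fun r s => by
        rw [← map_add (IsLocalRing.residue B), residue_eq_iff]
        exact (hτ.approx_add r s).sub_mem hU hϖ h0
      map_mul' := fun r s => by
        rw [← map_mul (IsLocalRing.residue B), residue_eq_iff]
        exact (hτ.approx_mul r s).sub_mem hU hϖ h0 }
  have hT : Function.Injective T := by
    rw [injective_iff_map_eq_zero]
    intro r hr
    by_contra hr0
    obtain ⟨k, hk⟩ := hτ.exists_not_mem r hr0
    have h1 : IsLocalRing.residue B (t r) = IsLocalRing.residue B 0 := hr.trans (map_zero _).symm
    rw [residue_eq_iff] at h1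
    have h2 := (coe_mem_nonunits_coarseGerm (y := fun n => τ n r - 0) h0).1 h1 k
    obtain ⟨n, hn, a, ha, hn'⟩ := ((Filter.Eventually.filter_mono hU hk).and h2).exists
    exact hn ⟨a, ha, by rw [← hn', sub_zero]⟩
  let Φ : L →+* IsLocalRing.ResidueField B := IsFractionRing.lift hT
  let f : C →+* B := ((constGerm U).comp i).codRestrict B.toSubring fun c => by
    obtain ⟨k, hk⟩ := hi c
    exact mem_coarse.2 ⟨k, coe_mem_germV (x := fun _ => ϖ ^ k * i c).2 (Eventually.of_forall fun _ => hk)⟩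
  have hΦ' : ∀ a ∈ S, Φ (g a) = IsLocalRing.residue B (f a) := by
    intro a ha
    obtain ⟨_, r, hr, hr'⟩ := hgood a ha
    rw [hr, IsFractionRing.lift_algebraMap]
    exact residue_eq_iff.2 (hr'.sub_mem hU hϖ h0)
  have hΦ : ∀ c, Φ (g c) = IsLocalRing.residue B (f c) := by
    intro c
    obtain ⟨a, ha, b, hb, hb0, hab⟩ := hS c
    have h1 : Φ (g b) ≠ 0 := by simpa using hb0
    apply mul_right_cancel₀ h1
    conv_rhs => rw [hΦ' b hb, ← map_mul, ← map_mul, hab, ← hΦ' a ha]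
    rw [← map_mul, ← map_mul, hab]
  have h2 : ExHom g ((constGerm U).comp i) := hB.exHom f hg Φ hΦ
  exact h2.trans (exHom_germ U i)

end Approx

end Paper

namespace Paper

theorem sepHom_powerSeries (F : Type*) [Field F] : SepHom (PowerSeries.C (R := F)) := by
  classical
  intro p hp _ m c y hy ⟨i₀, hi₀⟩
  have hex : ∃ n, ∃ i, PowerSeries.coeff n (y i) ≠ 0 := by
    by_contra! h
    exact hi₀ (PowerSeries.ext fun n => by simpa using h n i₀)
  have hdvd : ∀ i, (PowerSeries.X : PowerSeries F) ^ Nat.find hex ∣ y i := fun i => by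
    rw [PowerSeries.X_pow_dvd_iff]
    intro n hn
    by_contra h
    exact Nat.find_min hex hn ⟨i, h⟩
  choose w hw using hdvd
  have h1 : ∑ i, PowerSeries.C (c i) * w i ^ p = 0 := by
    have h2 : (PowerSeries.X ^ Nat.find hex) ^ p * ∑ i, PowerSeries.C (c i) * w i ^ p = 0 := by
      rw [← hy, Finset.mul_sum]
      refine Finset.sum_congr rfl fun i _ => ?_
      rw [hw i]
      ring
    exact (mul_eq_zero.1 h2).resolve_left (pow_ne_zero _ (pow_ne_zero _ PowerSeries.X_ne_zero))
  refine ⟨fun i => PowerSeries.constantCoeff (w i), ?_, ?_⟩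
  · simpa using congrArg PowerSeries.constantCoeff h1
  · obtain ⟨i, hi⟩ := Nat.find_spec hex
    refine ⟨i, ?_⟩
    rw [hw i] at hi
    simpa [PowerSeries.coeff_X_pow_mul'] using hi

theorem sepHom_laurentSeries (F : Type*) [Field F] : SepHom (algebraMap F (LaurentSeries F)) :=
  SepHom.fractionRing (L := LaurentSeries F) (sepHom_powerSeries F)

open Filter

section Large

variable {F : Type*} [Field F] (A : ValuationSubring F)

/-- Nonzero elements tending to zero in the topology of a valuation subring. -/
noncomputable def punctured : Filter F :=
  ⨅ f : {f : F // f ≠ 0}, 𝓟 {x | x ≠ 0 ∧ ∃ a ∈ A, x = f * a}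

instance punctured_neBot : (punctured A).NeBot := by
  refine iInf_neBot_of_directed (α := F) ?_ ?_
  · rintro ⟨f, hf⟩ ⟨g, hg⟩
    have key : ∀ f g : F, g ≠ 0 → f / g ∈ A → {x : F | x ≠ 0 ∧ ∃ a ∈ A, x = f * a} ⊆
        {x | x ≠ 0 ∧ ∃ a ∈ A, x = g * a} := by
      rintro f g hg h x ⟨hx, a, ha, rfl⟩
      exact ⟨hx, f / g * a, A.mul_mem _ _ h ha, by field_simp⟩
    rcases A.mem_or_inv_mem (f / g) with h | h
    · exact ⟨⟨f, hf⟩, le_rfl, principal_mono.2 (key f g hg h)⟩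
    · rw [inv_div] at h
      exact ⟨⟨g, hg⟩, principal_mono.2 (key g f hf h), le_rfl⟩
  · rintro ⟨f, hf⟩
    exact principal_neBot_iff.2 ⟨f, hf, 1, A.one_mem, by simp⟩

/-- An ultrafilter of nonzero elements tending to zero. -/
noncomputable def smallU : Ultrafilter F := Ultrafilter.of (punctured A)

theorem eventually_smallU {f : F} (hf : f ≠ 0) :
    ∀ᶠ x in (smallU A : Filter F), x ≠ 0 ∧ ∃ a ∈ A, x = f * a :=
  (Ultrafilter.of_le (punctured A)) (mem_iInf_of_mem ⟨f, hf⟩ (mem_principal_self _))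

/-- The finest coarsening of the ultrapower of `A` that contains the base field. -/
noncomputable def overV : ValuationSubring (Germ (smallU A : Filter F) F) where
  carrier := {y | ∃ f : F, f ≠ 0 ∧ constGerm _ f * y ∈ germV (smallU A) A}
  mul_mem' := by
    rintro x y ⟨f, hf, h⟩ ⟨g, hg, h'⟩
    refine ⟨f * g, mul_ne_zero hf hg, ?_⟩
    convert (germV (smallU A) A).mul_mem _ _ h h' using 1
    rw [map_mul]; ring
  one_mem' := ⟨1, one_ne_zero, by simpa using (germV (smallU A) A).one_mem⟩
  add_mem' := by
    rintro x y ⟨f, hf, h⟩ ⟨g, hg, h'⟩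
    have key : ∀ (x y : Germ (smallU A : Filter F) F) (f g : F), g ≠ 0 → f / g ∈ A →
        constGerm _ f * x ∈ germV (smallU A) A → constGerm _ g * y ∈ germV (smallU A) A →
        constGerm _ f * (x + y) ∈ germV (smallU A) A := by
      intro x y f g hg h hx hy
      rw [mul_add]
      refine (germV (smallU A) A).add_mem _ _ hx ?_
      have h1 : constGerm (smallU A) (f / g) ∈ germV (smallU A) A :=
        coe_mem_germV.2 (Eventually.of_forall fun _ => h)
      convert (germV (smallU A) A).mul_mem _ _ h1 hy using 1
      rw [← mul_assoc, ← map_mul, div_mul_cancel₀ _ hg]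
    rcases A.mem_or_inv_mem (f / g) with h1 | h1
    · exact ⟨f, hf, key x y f g hg h1 h h'⟩
    · rw [inv_div] at h1
      exact ⟨g, hg, by rw [add_comm]; exact key y x g f hf h1 h' h⟩
  zero_mem' := ⟨1, one_ne_zero, by simpa using (germV (smallU A) A).zero_mem⟩
  neg_mem' := by
    rintro x ⟨f, hf, h⟩
    exact ⟨f, hf, by simpa using (germV (smallU A) A).neg_mem _ h⟩
  mem_or_inv_mem' x := by
    rcases (germV (smallU A) A).mem_or_inv_mem x with h | h
    · exact .inl ⟨1, one_ne_zero, by simpa⟩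
    · exact .inr ⟨1, one_ne_zero, by simpa⟩

theorem const_mem_overV (c : F) : constGerm _ c ∈ overV A := by
  by_cases hc : c = 0
  · rw [hc, map_zero]; exact (overV A).zero_mem
  · refine ⟨c⁻¹, inv_ne_zero hc, ?_⟩
    rw [← map_mul, inv_mul_cancel₀ hc, map_one]
    exact (germV (smallU A) A).one_mem

theorem const_not_mem_nonunits_overV {c : F} (hc : c ≠ 0) :
    constGerm _ c ∉ (overV A).nonunits := by
  rw [ValuationSubring.mem_nonunits_iff_or, not_or, not_not, ← map_inv₀]
  exact ⟨(map_ne_zero _).2 hc, const_mem_overV A _⟩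

/-- The germ of the identity, an infinitesimal element. -/
noncomputable def infinitesimal : Germ (smallU A : Filter F) F := ((id : F → F) : Germ _ F)

theorem infinitesimal_ne_zero : infinitesimal A ≠ 0 := by
  rw [infinitesimal, Ne, germ_coe_eq_zero, ← Ultrafilter.eventually_not]
  exact (eventually_smallU A one_ne_zero).mono fun x hx => hx.1

variable {A}

theorem infinitesimal_mem_nonunits {t : F} (ht : t ∈ A.nonunits) (ht0 : t ≠ 0) :
    infinitesimal A ∈ (overV A).nonunits := by
  rw [ValuationSubring.mem_nonunits_iff_or]
  right
  rintro ⟨f, hf, h⟩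
  have h1 : ((fun x => f * x⁻¹ : F → F) : Germ (smallU A : Filter F) F) ∈ germV (smallU A) A := h
  rw [coe_mem_germV] at h1
  obtain ⟨x, hx, hx0, a, ha, hxa⟩ := (h1.and (eventually_smallU A (mul_ne_zero ht0 hf))).exists
  have ha0 : a ≠ 0 := by rintro rfl; simp [hxa] at hx0
  have h2 : t⁻¹ ∈ A := by
    convert A.mul_mem _ _ hx ha using 1
    rw [hxa]
    field_simp
  exact ((ValuationSubring.mem_nonunits_iff_or A).1 ht).elim ht0 fun h => h h2

/-- Evaluation of polynomials at the infinitesimal. -/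
noncomputable abbrev evalInf : Polynomial F →+* Germ (smallU A : Filter F) F :=
  Polynomial.eval₂RingHom (constGerm _) (infinitesimal A)

theorem evalInf_mem {t : F} (ht : t ∈ A.nonunits) (ht0 : t ≠ 0) (p : Polynomial F) :
    evalInf p ∈ overV A := by
  have hε : infinitesimal A ∈ overV A :=
    (overV A).nonunits_le (infinitesimal_mem_nonunits ht ht0)
  induction p using Polynomial.induction_on' with
  | add p q hp hq => rw [map_add]; exact (overV A).add_mem _ _ hp hq
  | monomial n a =>
    simp only [Polynomial.coe_eval₂RingHom, Polynomial.eval₂_monomial]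
    exact (overV A).mul_mem _ _ (const_mem_overV A a) (pow_mem hε n)

theorem approxHom_trunc {t : F} (ht : t ∈ A.nonunits) (ht0 : t ≠ 0) :
    ApproxHom (overV A) (infinitesimal A) (PowerSeries F)
      (fun n f => evalInf (PowerSeries.trunc n f)) := by
  have hε := infinitesimal_mem_nonunits ht ht0
  have key : ∀ (n : ℕ) (p q : Polynomial F), (∀ d < n, p.coeff d = q.coeff d) →
      ∃ a ∈ overV A, evalInf (A := A) p - evalInf q = infinitesimal A ^ n * a := by
    intro n p q h
    have h1 : Polynomial.X ^ n ∣ p - q := by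
      rw [Polynomial.X_pow_dvd_iff]
      intro d hd
      rw [Polynomial.coeff_sub, h d hd, sub_self]
    obtain ⟨r, hr⟩ := h1
    refine ⟨evalInf r, evalInf_mem ht ht0 r, ?_⟩
    rw [← map_sub, hr, map_mul, map_pow]
    simp
  refine ⟨fun n r => evalInf_mem ht ht0 _, fun n => ?_, fun n => ?_, fun r s n => ?_,
    fun r s n => ?_, fun r hr => ?_⟩
  · have := key n (PowerSeries.trunc n 1) 1 fun d hd => by
      rw [PowerSeries.coeff_trunc, if_pos hd, Polynomial.coeff_one, PowerSeries.coeff_one]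
    rwa [map_one (evalInf (A := A))] at this
  · exact ⟨0, (overV A).zero_mem, by simp⟩
  · refine ⟨0, (overV A).zero_mem, ?_⟩
    simp only [mul_zero, map_add, Pi.add_apply, sub_self]
  · have := key n (PowerSeries.trunc n (r * s)) (PowerSeries.trunc n r * PowerSeries.trunc n s)
      fun d hd => by
        rw [PowerSeries.coeff_trunc, if_pos hd,
          PowerSeries.coeff_mul_eq_coeff_trunc_mul_trunc _ _ hd, ← Polynomial.coe_mul,
          Polynomial.coeff_coe]
    rwa [map_mul (evalInf (A := A))] at this
  · obtain ⟨k, hk, hlow⟩ : ∃ k, PowerSeries.coeff k r ≠ 0 ∧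
        ∀ d < k, PowerSeries.coeff d r = 0 := by
      classical
      have hex : ∃ k, PowerSeries.coeff k r ≠ 0 := by
        by_contra! h
        exact hr (PowerSeries.ext fun n => by simpa using h n)
      exact ⟨Nat.find hex, Nat.find_spec hex, fun d hd => by
        by_contra h; exact Nat.find_min hex hd h⟩
    refine ⟨k + 1, ?_⟩
    filter_upwards [eventually_gt_atTop k] with n hn
    rintro ⟨a, ha, hna⟩
    obtain ⟨b, hb, hb'⟩ := key (k + 1) (PowerSeries.trunc n r)
      (Polynomial.C (PowerSeries.coeff k r) * Polynomial.X ^ k) fun d hd => by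
        rw [PowerSeries.coeff_trunc, if_pos (by omega), Polynomial.coeff_C_mul_X_pow]
        split_ifs with h
        · rw [h]
        · exact hlow d (by omega)
    have h1 : evalInf (A := A) (Polynomial.C (PowerSeries.coeff k r) * Polynomial.X ^ k) =
        infinitesimal A ^ k * constGerm _ (PowerSeries.coeff k r) := by
      rw [map_mul, map_pow, mul_comm]
      simp
    rw [hna, h1] at hb'
    have h2 : constGerm _ (PowerSeries.coeff k r) = infinitesimal A * (a - b) := by
      apply mul_left_cancel₀ (pow_ne_zero k (infinitesimal_ne_zero A))
      linear_combination -hb'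
    apply const_not_mem_nonunits_overV A hk
    rw [h2, ValuationSubring.mem_nonunits_iff, map_mul]
    exact lt_of_le_of_lt (mul_le_of_le_one_right'
      (((overV A).valuation_le_one_iff _).2 ((overV A).sub_mem ha hb))) hε

end Large

theorem largeField_of_hensV {F : Type u} [Field F] {A : ValuationSubring F} (hA : HensV A) {t : F}
    (ht : t ∈ A.nonunits) (ht0 : t ≠ 0) : LargeField F := by
  have hle : germV (smallU A) A ≤ overV A := fun y hy => ⟨1, one_ne_zero, by simpa using hy⟩
  have h1 : ExHom (algebraMap F (LaurentSeries F)) (constGerm (smallU A)) := by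
    refine (approxHom_trunc ht ht0).exHom (hA.germV.of_le hle)
      (infinitesimal_mem_nonunits ht ht0) (infinitesimal_ne_zero A) (constGerm _)
      (sepHom_laurentSeries F) (fun c => ⟨0, by simpa using const_mem_overV A c⟩)
      Set.univ (fun c => ⟨c, trivial, 1, trivial, one_ne_zero, mul_one c⟩) fun a _ => ?_
    refine ⟨const_mem_overV A a, PowerSeries.C a, rfl, fun n => ?_⟩
    rcases Nat.eq_zero_or_pos n with rfl | hn
    · refine ⟨-constGerm _ a, (overV A).neg_mem _ (const_mem_overV A a), ?_⟩
      simp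
    · refine ⟨0, (overV A).zero_mem, ?_⟩
      obtain ⟨n, rfl⟩ := Nat.exists_eq_succ_of_ne_zero hn.ne'
      simp only [Nat.succ_eq_add_one, PowerSeries.trunc_C]
      simp
  have h2 : ExHom (algebraMap F (LaurentSeries F)) (RingHom.id F) :=
    h1.trans (exHom_germ (smallU A) (RingHom.id F))
  rintro φ ⟨n, hφ⟩ h
  exact h2.realize_of_isExistsN hφ h

end Paper

namespace Paper

open IsLocalRing in
theorem exists_isDomain_isDiscreteValuationRing {R : Type*} [CommRing R] [IsLocalRing R] {ϖ : R}
    (hϖ : maximalIdeal R = Ideal.span {ϖ}) (hR : IsHausdorff (maximalIdeal R) R)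
    (h0 : ∀ n : ℕ, ϖ ^ n ≠ 0) : ∃ _ : IsDomain R, IsDiscreteValuationRing R := by
  classical
  have hfac : ∀ x : R, x ≠ 0 → ∃ n : ℕ, Associated (ϖ ^ n) x := by
    intro x hx
    have hex : ∃ n, ¬ ϖ ^ n ∣ x := by
      by_contra! h
      refine hx (hR.haus x fun n => ?_)
      rw [SModEq.zero, smul_eq_mul, Ideal.mul_top, hϖ, Ideal.span_singleton_pow,
        Ideal.mem_span_singleton]
      exact h n
    have hn := Nat.find_spec hex
    obtain ⟨m, hm⟩ : ∃ m, Nat.find hex = m + 1 :=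
      Nat.exists_eq_succ_of_ne_zero fun h => by simp [h] at hn
    obtain ⟨y, hy⟩ : ϖ ^ m ∣ x := not_not.1 (Nat.find_min hex (by omega))
    have hyu : IsUnit y := by
      by_contra h
      have h1 : y ∈ maximalIdeal R := h
      rw [hϖ, Ideal.mem_span_singleton] at h1
      obtain ⟨z, rfl⟩ := h1
      exact hn ⟨z, by rw [hm, hy]; ring⟩
    exact ⟨m, hyu.unit, by simp [hy]⟩
  have : NoZeroDivisors R := by
    refine ⟨fun {x y} hxy => ?_⟩
    by_contra! h
    obtain ⟨n, a, ha⟩ := hfac x h.1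
    obtain ⟨m, b, hb⟩ := hfac y h.2
    refine h0 (n + m) ?_
    have h1 : ϖ ^ (n + m) * (a * b : Rˣ) = 0 := by
      rw [← hxy, ← ha, ← hb, Units.val_mul]; ring
    exact (Units.mul_left_eq_zero _).1 h1
  have : IsDomain R := NoZeroDivisors.to_isDomain R
  refine ⟨this, IsDiscreteValuationRing.ofHasUnitMulPowIrreducibleFactorization
    ⟨ϖ, ?_, fun {x} hx => hfac x hx⟩⟩
  have : Prime ϖ := by
    rw [← Ideal.span_singleton_prime (by simpa using h0 1), ← hϖ]
    infer_instance
  exact this.irreducible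

theorem HenselianLocalRing.of_ringEquiv {R S : Type*} [CommRing R] [CommRing S]
    [HenselianLocalRing R] (e : R ≃+* S) : HenselianLocalRing S := by
  have : IsLocalRing S := e.isLocalRing
  have : IsLocalHom e.symm.toRingHom := ⟨fun a ha => by
    simpa using ha.map e.toRingHom⟩
  refine ⟨fun f hf a h0 h1 => ?_⟩
  obtain ⟨b, hb, hb'⟩ := HenselianLocalRing.is_henselian (f.map e.symm.toRingHom)
    (hf.map _) (e.symm a) (by
      rw [IsLocalRing.mem_maximalIdeal, mem_nonunits_iff] at h0 ⊢
      intro h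
      apply h0
      have h2 := h.map e.toRingHom
      have h3 : Polynomial.eval (e.symm a) (f.map e.symm.toRingHom) = e.symm (f.eval a) :=
        Polynomial.eval_map_apply (f := e.symm.toRingHom) (p := f) a
      rw [h3] at h2
      simpa using h2) (by
      have h3 : Polynomial.eval (e.symm a) (f.map e.symm.toRingHom).derivative =
          e.symm (f.derivative.eval a) := by
        rw [Polynomial.derivative_map]
        exact Polynomial.eval_map_apply (f := e.symm.toRingHom) (p := f.derivative) a
      rw [h3]
      exact h1.map e.symm.toRingHom)
  refine ⟨e b, ?_, ?_⟩
  · have h3 : Polynomial.eval (e.symm (e b)) (f.map e.symm.toRingHom) = e.symm (f.eval (e b)) :=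
        Polynomial.eval_map_apply (f := e.symm.toRingHom) (p := f) (e b)
    rw [e.symm_apply_apply, hb.eq_zero] at h3
    exact (e.symm.injective (by rw [← h3, map_zero]))
  · rw [IsLocalRing.mem_maximalIdeal, mem_nonunits_iff] at hb' ⊢
    intro h
    apply hb'
    simpa using h.map e.symm.toRingHom

section Valued

variable {K : Type*} [Field K] {Γ : Type*} [LinearOrderedCommGroupWithZero Γ] (v : Valuation K Γ)

theorem exists_restrict_eq (γ : (MonoidWithZeroHom.ValueGroup₀ (.ofClass v : K →*₀ Γ))ˣ) :
    ∃ t : K, t ≠ 0 ∧ γ.1 = v.restrict t := by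
  obtain ⟨t, ht⟩ := MonoidWithZeroHom.ValueGroup₀.restrict₀_surjective (f := .ofClass v) γ.1
  refine ⟨t, ?_, ht.symm⟩
  rintro rfl
  rw [map_zero] at ht
  exact γ.ne_zero ht.symm

theorem cauchy_valued_iff (f : Filter K) :
    letI : Valued K Γ := Valued.mk' v
    Cauchy f ↔ f.NeBot ∧ ∀ t : K, t ≠ 0 → ∃ M ∈ f, ∀ x ∈ M, ∀ y ∈ M, v (y - x) < v t := by
  let _ : Valued K Γ := Valued.mk' v
  refine Valued.cauchy_iff.trans (and_congr Iff.rfl ⟨fun h t ht => ?_, fun h γ => ?_⟩)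
  · obtain ⟨M, hM, h⟩ := h (Units.mk0 (v.restrict t) (by simpa using ht))
    exact ⟨M, hM, fun x hx y hy => v.restrict_lt_iff.1 (h x hx y hy)⟩
  · obtain ⟨t, ht, hγ⟩ := exists_restrict_eq v γ
    obtain ⟨M, hM, h⟩ := h t ht
    exact ⟨M, hM, fun x hx y hy => by rw [hγ]; exact v.restrict_lt_iff.2 (h x hx y hy)⟩

theorem mem_nhds_valued_iff (s : Set K) (x : K) :
    letI : Valued K Γ := Valued.mk' v
    s ∈ nhds x ↔ ∃ t : K, t ≠ 0 ∧ {y | v (y - x) < v t} ⊆ s := by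
  let _ : Valued K Γ := Valued.mk' v
  refine Valued.mem_nhds.trans ⟨fun ⟨γ, hγ⟩ => ?_, fun ⟨t, ht, h⟩ => ?_⟩
  · obtain ⟨t, ht, h⟩ := exists_restrict_eq v γ
    exact ⟨t, ht, fun y hy => hγ (by
      change v.restrict (y - x) < γ.1
      rw [h]; exact v.restrict_lt_iff.2 hy)⟩
  · exact ⟨Units.mk0 (v.restrict t) (by simpa using ht), fun y hy => h (v.restrict_lt_iff.1 hy)⟩

end Valued

end Paper

namespace Paper

section DVR

variable (R : Type*) [CommRing R] [IsDomain R] [IsDiscreteValuationRing R]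
  (L : Type*) [Field L] [Algebra R L] [IsFractionRing R L]

/-- The normalized valuation on the fraction field of a discrete valuation ring. -/
noncomputable abbrev dvrVal : Valuation L Zm0 :=
  (IsDiscreteValuationRing.maximalIdeal R).valuation L

variable {R L}

theorem dvrVal_le_one_iff {x : L} : dvrVal R L x ≤ 1 ↔ ∃ a : R, algebraMap R L a = x := by
  refine ⟨fun h => IsDiscreteValuationRing.exists_lift_of_le_one h, ?_⟩
  rintro ⟨a, rfl⟩
  exact IsDedekindDomain.HeightOneSpectrum.valuation_le_one _ _

theorem dvrVal_lt_one_iff {a : R} :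
    dvrVal R L (algebraMap R L a) < 1 ↔ a ∈ IsLocalRing.maximalIdeal R := by
  rw [dvrVal, IsDedekindDomain.HeightOneSpectrum.valuation_lt_one_iff_mem]
  rfl

theorem dvrVal_eq_one_of_unit (a : Rˣ) : dvrVal R L (algebraMap R L a) = 1 := by
  refine le_antisymm (dvrVal_le_one_iff.2 ⟨_, rfl⟩) (not_lt.1 fun h => ?_)
  exact dvrVal_lt_one_iff.1 h a.isUnit

variable (R L) in
theorem dvrVal_surjective : Function.Surjective (dvrVal R L) := by
  obtain ⟨π, hπ⟩ := (IsDiscreteValuationRing.maximalIdeal R).valuation_exists_uniformizer L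
  intro γ
  induction γ using WithZero.recZeroCoe with
  | zero => exact ⟨0, map_zero _⟩
  | coe n =>
    refine ⟨π ^ (-(Multiplicative.toAdd n)), ?_⟩
    rw [map_zpow₀, hπ, ← WithZero.exp_zsmul]
    simp [WithZero.exp]

theorem dvrVal_isUniformizer {ϖ : R} (hϖ : IsLocalRing.maximalIdeal R = Ideal.span {ϖ}) :
    IsUniformizer (dvrVal R L) (algebraMap R L ϖ) := by
  have h0 : ϖ ≠ 0 := by
    rintro rfl
    exact IsDiscreteValuationRing.not_a_field R (by simpa using hϖ)
  refine ⟨?_, ?_, fun x hx => ?_⟩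
  · rw [Valuation.pos_iff]
    simpa using h0
  · rw [dvrVal_lt_one_iff, hϖ]
    exact Ideal.mem_span_singleton_self ϖ
  · obtain ⟨a, rfl⟩ := dvrVal_le_one_iff.1 hx.le
    rw [dvrVal_lt_one_iff, hϖ, Ideal.mem_span_singleton] at hx
    obtain ⟨b, rfl⟩ := hx
    rw [map_mul, map_mul]
    exact mul_le_of_le_one_right' (dvrVal_le_one_iff.2 ⟨b, rfl⟩)

theorem dvrVal_isHenselian [IsAdicComplete (IsLocalRing.maximalIdeal R) R] :
    IsHenselian (dvrVal R L) := by
  have : HenselianLocalRing R :=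
    { is_henselian := fun f hf a h0 h1 =>
        HenselianRing.is_henselian (I := IsLocalRing.maximalIdeal R) f hf a h0 (h1.map _) }
  exact HenselianLocalRing.of_ringEquiv
    (IsDiscreteValuationRing.equivValuationSubring (A := R) (K := L))

theorem dvrVal_lt_pow {ϖ : R} (hϖ : IsLocalRing.maximalIdeal R = Ideal.span {ϖ}) {t : L}
    (ht : t ≠ 0) : ∃ n : ℕ, ∀ x : L, dvrVal R L x ≤ dvrVal R L (algebraMap R L ϖ) ^ n →
      dvrVal R L x < dvrVal R L t := by
  have h0 : ϖ ≠ 0 := by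
    rintro rfl
    exact IsDiscreteValuationRing.not_a_field R (by simpa using hϖ)
  have hirr : Irreducible ϖ := (IsDiscreteValuationRing.irreducible_iff_uniformizer ϖ).2 hϖ
  obtain ⟨a, b, hb, rfl⟩ := IsFractionRing.div_surjective R t
  have ha : a ≠ 0 := by rintro rfl; simp at ht
  obtain ⟨k, w, rfl⟩ := IsDiscreteValuationRing.eq_unit_mul_pow_irreducible ha hirr
  refine ⟨k + 1, fun x hx => lt_of_le_of_lt hx ?_⟩
  have hu := dvrVal_isUniformizer (L := L) hϖ
  rw [map_div₀, map_mul, map_mul, dvrVal_eq_one_of_unit, one_mul, map_pow, map_pow]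
  have hb0 : 0 < dvrVal R L (algebraMap R L b) := by
    rw [Valuation.pos_iff]
    simpa using nonZeroDivisors.ne_zero hb
  have hb1 : dvrVal R L (algebraMap R L b) ≤ 1 := dvrVal_le_one_iff.2 ⟨b, rfl⟩
  calc dvrVal R L (algebraMap R L ϖ) ^ (k + 1)
      < dvrVal R L (algebraMap R L ϖ) ^ k := pow_lt_pow_right_of_lt_one₀ hu.1 hu.2.1 (by omega)
    _ ≤ _ := le_div_iff₀ hb0 |>.2 (mul_le_of_le_one_right' hb1)

theorem dvrVal_le_pow_iff {ϖ : R} (hϖ : IsLocalRing.maximalIdeal R = Ideal.span {ϖ}) {n : ℕ}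
    {a : R} : dvrVal R L (algebraMap R L a) ≤ dvrVal R L (algebraMap R L ϖ) ^ n ↔
      a ∈ IsLocalRing.maximalIdeal R ^ n := by
  have hu := dvrVal_isUniformizer (L := L) hϖ
  rw [hϖ, Ideal.span_singleton_pow, Ideal.mem_span_singleton]
  constructor
  · intro h
    rw [← map_pow, ← div_le_one₀ (by rw [map_pow]; exact pow_pos hu.1 n), ← map_div₀] at h
    obtain ⟨b, hb⟩ := dvrVal_le_one_iff.1 h
    refine ⟨b, IsFractionRing.injective R L ?_⟩
    have : algebraMap R L ϖ ^ n ≠ 0 := pow_ne_zero n ((Valuation.pos_iff _).1 hu.1)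
    rw [map_mul, hb, map_pow]
    field_simp
  · rintro ⟨b, rfl⟩
    rw [map_mul, map_pow, map_mul, map_pow]
    exact mul_le_of_le_one_right' (dvrVal_le_one_iff.2 ⟨b, rfl⟩)

theorem dvrVal_isCompleteValued [IsAdicComplete (IsLocalRing.maximalIdeal R) R] :
    IsCompleteValued (dvrVal R L) := by
  obtain ⟨ϖ, hirr⟩ := IsDiscreteValuationRing.exists_irreducible R
  have hϖ := (IsDiscreteValuationRing.irreducible_iff_uniformizer ϖ).1 hirr
  have hu := dvrVal_isUniformizer (L := L) hϖ
  have hϖ0 : algebraMap R L ϖ ≠ 0 := (Valuation.pos_iff _).1 hu.1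
  let _ : Valued L Zm0 := Valued.mk' (dvrVal R L)
  refine ⟨fun {f} hf => ?_⟩
  obtain ⟨hne, hf⟩ := (cauchy_valued_iff (dvrVal R L) f).1 hf
  choose M hM hMv using fun n : ℕ => hf (algebraMap R L ϖ ^ n) (pow_ne_zero n hϖ0)
  have hN : ∀ n, (⋂ i ∈ Finset.range (n + 1), M i) ∈ f := fun n =>
    (Filter.biInter_finset_mem _).2 fun i _ => hM i
  choose y hy using fun n => hne.nonempty_of_mem (hN n)
  have hyM : ∀ i n, i ≤ n → y n ∈ M i := fun i n hin =>
    Set.mem_iInter₂.1 (hy n) i (Finset.mem_range.2 (by omega))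
  have hlift : ∀ n, ∃ a : R, algebraMap R L a = y n - y 0 := fun n =>
    dvrVal_le_one_iff.1 (by
      have := (hMv 0 (y 0) (hyM 0 0 le_rfl) (y n) (hyM 0 n (by omega))).le
      simpa using this)
  choose a ha using hlift
  obtain ⟨l, hl⟩ := IsPrecomplete.prec (I := IsLocalRing.maximalIdeal R) (M := R)
    inferInstance (f := a) (fun {m n} hmn => by
      rw [SModEq.sub_mem, smul_eq_mul, Ideal.mul_top, ← dvrVal_le_pow_iff (L := L) hϖ, map_sub,
        ha, ha, ← map_pow]
      have := (hMv m (y n) (hyM m n hmn) (y m) (hyM m m le_rfl)).le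
      simpa using this)
  refine ⟨y 0 + algebraMap R L l, fun s hs => ?_⟩
  obtain ⟨t, ht, hts⟩ := (mem_nhds_valued_iff (dvrVal R L) s _).1 hs
  obtain ⟨n, hn⟩ := dvrVal_lt_pow hϖ ht
  refine Filter.mem_of_superset (hM n) fun z hz => hts (hn _ ?_)
  have h1 : z - (y 0 + algebraMap R L l) = (z - y n) + algebraMap R L (a n - l) := by
    rw [map_sub, ha]; ring
  rw [h1]
  refine (Valuation.map_add _ _ _).trans (max_le ?_ ?_)
  · rw [← map_pow]
    exact (hMv n (y n) (hyM n n le_rfl) z hz).le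
  · rw [dvrVal_le_pow_iff hϖ]
    have := hl n
    rwa [SModEq.sub_mem, smul_eq_mul, Ideal.mul_top] at this

end DVR

end Paper

namespace Paper

open IsLocalRing Filter in
theorem exists_completion {K : Type u} [Field K] (A : ValuationSubring K) (t : A)
    (ht : maximalIdeal A = Ideal.span {t}) (ht0 : t ≠ 0) :
    ∃ (R : Type u) (_ : CommRing R) (_ : IsDomain R) (_ : IsDiscreteValuationRing R)
      (_ : IsAdicComplete (maximalIdeal R) R) (ι : A →+* R) (_ : IsLocalHom ι) (τ : ℕ → R → K),
      maximalIdeal R = Ideal.span {ι t} ∧ Function.Bijective (ResidueField.map ι) ∧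
        ApproxHom A (t : K) R τ ∧ ∀ a, ApproxEq A (t : K) (fun n => τ n (ι a)) (fun _ => (a : K)) := by
  let m := maximalIdeal A
  have hfg : m.FG := ⟨{t}, by simp [m, ht]⟩
  let R := AdicCompletion m A
  let _ : IsLocalRing R := AdicCompletion.isLocalRing_of_fg hfg
  have hcomp : IsAdicComplete (maximalIdeal R) R := AdicCompletion.isAdicComplete_of_fg hfg
  let ι : A →+* R := algebraMap A R
  have hloc : IsLocalHom ι := AdicCompletion.algebraMap_isLocalHom_of_fg hfg
  have hbij : Function.Bijective (ResidueField.map ι) :=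
    AdicCompletion.residueField_map_bijective_of_fg hfg
  have hmax : maximalIdeal R = Ideal.span {ι t} := by
    have h1 : maximalIdeal R = m.map ι := AdicCompletion.maximalIdeal_eq_map_of_fg hfg
    rw [h1]
    change Ideal.map ι (maximalIdeal A) = _
    rw [ht, Ideal.map_span, Set.image_singleton]
  have htu : ¬ IsUnit t := by
    have : t ∈ maximalIdeal A := ht ▸ Ideal.mem_span_singleton_self t
    exact this
  have hmn : ∀ n, m ^ n = Ideal.span {t ^ n} := fun n => by
    change maximalIdeal A ^ n = _
    rw [ht, Ideal.span_singleton_pow]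
  let e : ∀ n, R →+* A ⧸ m ^ n := fun n => (AdicCompletion.evalₐ m n).toRingHom
  have heι : ∀ n a, e n (ι a) = Ideal.Quotient.mk _ a := fun n a => by
    exact AlgHom.commutes (AdicCompletion.evalₐ m n) a
  have hpow0 : ∀ n : ℕ, ι t ^ n ≠ 0 := fun n h => by
    have h1 := congrArg (e (n + 1)) h
    rw [← map_pow, heι, map_zero, Ideal.Quotient.eq_zero_iff_mem, hmn,
      Ideal.mem_span_singleton] at h1
    obtain ⟨s, hs⟩ := h1
    apply htu
    have h2 : t ^ n * (t * s) = t ^ n * 1 := by rw [mul_one, ← mul_assoc, ← pow_succ, ← hs]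
    exact IsUnit.of_mul_eq_one s (mul_left_cancel₀ (pow_ne_zero n ht0) h2)
  obtain ⟨hdom, hdvr⟩ := exists_isDomain_isDiscreteValuationRing hmax hcomp.toIsHausdorff hpow0
  let σ : ∀ n, R → A := fun n r => (Ideal.Quotient.mk_surjective (e n r)).choose
  have hσ : ∀ n r, Ideal.Quotient.mk _ (σ n r) = e n r := fun n r =>
    (Ideal.Quotient.mk_surjective (e n r)).choose_spec
  have key : ∀ n (a b : A), Ideal.Quotient.mk (m ^ n) a = Ideal.Quotient.mk _ b →
      ∃ c ∈ A, (a - b : K) = (t : K) ^ n * c := by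
    intro n a b h
    rw [Ideal.Quotient.mk_eq_mk_iff_sub_mem, hmn, Ideal.mem_span_singleton] at h
    obtain ⟨c, hc⟩ := h
    exact ⟨c, c.2, by exact_mod_cast congrArg Subtype.val hc⟩
  refine ⟨R, inferInstance, hdom, hdvr, hcomp, ι, hloc, fun n r => σ n r, hmax, hbij,
    ⟨fun n r => (σ n r).2, fun n => ?_, fun n => ?_, fun r s n => ?_, fun r s n => ?_,
      fun r hr => ?_⟩, fun a n => ?_⟩
  · exact key n (σ n 1) 1 (by rw [hσ, map_one, map_one])
  · exact key n (σ n 0) 0 (by rw [hσ, map_zero, map_zero])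
  · exact key n (σ n (r + s)) (σ n r + σ n s) (by rw [hσ, map_add, map_add, hσ, hσ])
  · exact key n (σ n (r * s)) (σ n r * σ n s) (by rw [hσ, map_mul, map_mul, hσ, hσ])
  · obtain ⟨k, hk⟩ : ∃ k, e k r ≠ 0 := by
      by_contra! h
      exact hr (AdicCompletion.ext_evalₐ fun n => (h n).trans (map_zero (e n)).symm)
    refine ⟨k, ?_⟩
    filter_upwards [eventually_ge_atTop k] with n hn
    rintro ⟨a, ha, hna⟩
    apply hk
    have h1 : σ n r ∈ m ^ k := by
      rw [hmn, Ideal.mem_span_singleton]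
      exact ⟨⟨a, ha⟩, Subtype.ext (by simpa using hna)⟩
    have h2 : Ideal.Quotient.factor (Ideal.pow_le_pow_right (I := m) hn) (e n r) = e k r := by
      obtain ⟨s, rfl⟩ := AdicCompletion.mk_surjective m A r
      have h3 : ∀ n, e n (AdicCompletion.mk m A s) = Ideal.Quotient.mk (m ^ n) (s.val n) :=
        fun n => AdicCompletion.evalₐ_mk m n s
      rw [h3, h3, Ideal.Quotient.factor_mk, Ideal.Quotient.mk_eq_mk_iff_sub_mem]
      have h4 := s.2 hn
      rw [SModEq.sub_mem, smul_eq_mul, Ideal.mul_top] at h4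
      exact (Ideal.neg_mem_iff _).1 (by simpa using h4)
    rw [← h2, ← hσ, Ideal.Quotient.factor_mk, Ideal.Quotient.eq_zero_iff_mem]
    exact h1
  · exact key n (σ n (ι a)) a (by rw [hσ, heι])

end Paper

namespace Paper

theorem sepHom_of_independent {F L : Type*} [Field F] [Field L] {f : F →+* L}
    (H : ∀ p : ℕ, p.Prime → CharP F p → ∀ (r : ℕ) (d : Fin r → F),
      (∀ z : Fin r → F, ∑ j, d j * z j ^ p = 0 → ∀ j, z j = 0) →
      ∀ y : Fin r → L, ∑ j, f (d j) * y j ^ p = 0 → ∀ j, y j = 0) : SepHom f := by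
  let _ : Algebra F L := f.toAlgebra
  refine sepHom_of_forall_linearIndependent (F := F) (L := L) fun p hp hF r x hx => ?_
  have : Fact p.Prime := ⟨hp⟩
  have : CharP L p := (RingHom.charP_iff _ (algebraMap F L).injective p).1 inferInstance
  rw [Fintype.linearIndependent_iff] at hx ⊢
  intro c hc
  obtain ⟨r', d, a, hda, hd⟩ := exists_pow_basis hp c
  have key : ∑ j, algebraMap F L (d j) * (∑ i, a i j • x i) ^ p = 0 := by
    rw [← hc]
    simp_rw [hda, Finset.sum_smul, sum_pow_char]
    rw [Finset.sum_comm]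
    refine Finset.sum_congr rfl fun j _ => ?_
    rw [Finset.mul_sum]
    refine Finset.sum_congr rfl fun i _ => ?_
    rw [Algebra.smul_def, Algebra.smul_def, mul_pow, map_mul, map_pow, mul_assoc]
  have h0 := H p hp hF _ d hd _ key
  intro i
  rw [hda]
  exact Finset.sum_eq_zero fun j _ => by rw [hx _ (h0 j) i, zero_pow hp.ne_zero, mul_zero]

/-- Over every extension `L` of `C`, each `L ^ p`-combination of `c` is one of `d`, and it is
trivial only if the original one is. -/
def FrobLe {C : Type u} [Field C] (p : ℕ) {m : ℕ} (c d : Fin m → C) : Prop :=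
  ∀ (L : Type u) [Field L] (f : C →+* L) (y : Fin m → L), ∃ y' : Fin m → L,
    ∑ i, f (c i) * y i ^ p = ∑ i, f (d i) * y' i ^ p ∧ (y' = 0 → y = 0)

theorem FrobLe.snoc {C : Type u} [Field C] {p : ℕ} (hp : p.Prime) [CharP C p] {m : ℕ}
    {c d : Fin m → C} (h : FrobLe p c d) (a b : C) (s : Fin m → C)
    (hab : a = b + ∑ j, d j * s j ^ p) :
    FrobLe p (Fin.snoc c a : Fin (m + 1) → C) (Fin.snoc d b : Fin (m + 1) → C) := by
  intro L _ f y
  have : Fact p.Prime := ⟨hp⟩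
  have : CharP L p := (RingHom.charP_iff f f.injective p).1 inferInstance
  obtain ⟨y', h1, h2⟩ := h L f (Fin.init y)
  refine ⟨Fin.snoc (α := fun _ => L) (fun j => y' j + f (s j) * y (Fin.last m)) (y (Fin.last m)), ?_, fun h0 => ?_⟩
  · simp only [Fin.sum_univ_castSucc, Fin.snoc_castSucc, Fin.snoc_last]
    simp only [Fin.init] at h1
    rw [h1, hab]
    simp only [add_pow_char, mul_add, Finset.sum_add_distrib, map_add, map_sum, map_mul, map_pow, mul_pow, add_mul, Finset.sum_mul, mul_assoc]
    ring
  · have h3 : y (Fin.last m) = 0 := by simpa using congrFun h0 (Fin.last m)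
    have h4 : y' = 0 := by
      funext j
      simpa [h3] using congrFun h0 j.castSucc
    have h5 := h2 h4
    funext j
    refine Fin.lastCases h3 (fun i => congrFun h5 i) j

section

variable {C : Type u} [Field C] (u : Valuation C Zm0)

/-- Every element of `C` which is a limit of `p`-th power combinations of `d` with convergent
coefficients is such a combination over `L`. -/
def HasPowLimits {L : Type*} [Field L] (f : C →+* L) : Prop :=
  ∀ (p m : ℕ) (d : Fin m → C) (z : ℕ → Fin m → C) (c : C),
    (∀ j, ∀ t : C, t ≠ 0 → ∃ N, ∀ k ≥ N, ∀ l ≥ N, u (z k j - z l j) < u t) →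
    (∀ t : C, t ≠ 0 → ∃ N, ∀ k ≥ N, u (∑ j, d j * z k j ^ p - c) < u t) →
    ∃ x : Fin m → L, f c = ∑ j, f (d j) * x j ^ p

theorem hasPowLimits_completion :
    letI : Valued C Zm0 := Valued.mk' u
    letI : Field (UniformSpace.Completion C) := UniformSpace.Completion.instField
    HasPowLimits u (UniformSpace.Completion.coeRingHom : C →+* UniformSpace.Completion C) := by
  let _ : Valued C Zm0 := Valued.mk' u
  intro p m d z c hz hc
  have h1 : ∀ j, CauchySeq fun n => z n j := fun j => by
    refine (cauchy_valued_iff u _).2 ⟨inferInstance, fun t ht => ?_⟩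
    obtain ⟨N, hN⟩ := hz j t ht
    refine ⟨(fun n => z n j) '' Set.Ici N, Filter.image_mem_map (Filter.Ici_mem_atTop N), ?_⟩
    rintro _ ⟨k, hk, rfl⟩ _ ⟨l, hl, rfl⟩
    exact hN l hl k hk
  have h2 : Filter.Tendsto (fun n => ∑ j, d j * z n j ^ p) Filter.atTop (nhds c) := by
    intro s hs
    obtain ⟨t, ht, h⟩ := (mem_nhds_valued_iff u s c).1 hs
    obtain ⟨N, hN⟩ := hc t ht
    exact Filter.mem_map.2
      (Filter.mem_of_superset (Filter.Ici_mem_atTop N) fun k hk => h (hN k hk))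
  have h3 : ∀ j, ∃ x : UniformSpace.Completion C,
      Filter.Tendsto (fun n => (UniformSpace.Completion.coeRingHom (z n j) :
        UniformSpace.Completion C)) Filter.atTop (nhds x) := fun j =>
    cauchySeq_tendsto_of_complete ((h1 j).map (UniformSpace.Completion.uniformContinuous_coe C))
  choose x hx using h3
  refine ⟨x, tendsto_nhds_unique
    (((UniformSpace.Completion.continuous_coe C).tendsto c).comp h2) ?_⟩
  have h4 : Filter.Tendsto (fun n => ∑ j, (UniformSpace.Completion.coeRingHom (d j) :
      UniformSpace.Completion C) * UniformSpace.Completion.coeRingHom (z n j) ^ p) Filter.atTop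
      (nhds (∑ j, UniformSpace.Completion.coeRingHom (d j) * x j ^ p)) :=
    tendsto_finsetSum _ fun j _ => ((hx j).pow p).const_mul _
  refine h4.congr fun n => ?_
  change _ = UniformSpace.Completion.coeRingHom _
  rw [map_sum]
  simp

/-- Independence for the valuation of the `C ^ p`-combinations of `d`. -/
def ValIndep (p : ℕ) {m : ℕ} (d : Fin m → C) : Prop :=
  ∀ a : Fin m → C, ∀ j, u (d j * a j ^ p) ≤ u (∑ i, d i * a i ^ p)

variable {u}

theorem IsUniformizer.exists_le_mul_pow {π : C} (hπ : IsUniformizer u π) {ι : Type*} [Nonempty ι]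
    (g : ι → C) (h : ∀ i, ∃ j, u (g j) < u (g i)) (i₀ : ι) (n : ℕ) :
    ∃ i, u (g i) ≤ u (g i₀) * u π ^ n := by
  induction n with
  | zero => exact ⟨i₀, by simp⟩
  | succ n ih =>
    obtain ⟨i, hi⟩ := ih
    obtain ⟨j, hj⟩ := h i
    refine ⟨j, ?_⟩
    have h0 : 0 < u (g i) := lt_of_le_of_lt zero_le' hj
    have h1 : u (g j / g i) ≤ u π := hπ.2.2 _ (by rw [map_div₀]; exact (div_lt_one₀ h0).2 hj)
    rw [map_div₀, div_le_iff₀ h0] at h1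
    calc u (g j) ≤ u π * u (g i) := h1
      _ ≤ u π * (u (g i₀) * u π ^ n) := by gcongr
      _ = _ := by rw [pow_succ]; ac_rfl

theorem IsUniformizer.exists_mul_pow_lt {π : C} (hπ : IsUniformizer u π) (c : C) {t : C}
    (ht : t ≠ 0) : ∃ n, ∀ k ≥ n, u c * u π ^ k < u t := by
  have ht' : 0 < u t := (Valuation.pos_iff u).2 ht
  by_cases hc : c = 0
  · exact ⟨0, fun k _ => by simpa [hc] using ht'⟩
  have hc' : 0 < u c := (Valuation.pos_iff u).2 hc
  obtain ⟨n, hn⟩ := exists_pow_lt₀ hπ.2.1 (Units.mk0 (u t / u c) (div_ne_zero ht'.ne' hc'.ne'))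
  refine ⟨n, fun k hk => ?_⟩
  have h1 : u π ^ k < u t / u c := lt_of_le_of_lt (pow_le_pow_right_of_le_one' hπ.2.1.le hk) hn
  rwa [lt_div_iff₀' hc'] at h1

theorem ValIndep.snoc {p : ℕ} (hp : p.Prime) [CharP C p] {m : ℕ} {d : Fin m → C}
    (h : ValIndep u p d) {c : C} {s : Fin m → C}
    (hs : ∀ z : Fin m → C, u (c - ∑ j, d j * s j ^ p) ≤ u (c - ∑ j, d j * z j ^ p)) :
    ValIndep u p (Fin.snoc d (c - ∑ j, d j * s j ^ p) : Fin (m + 1) → C) := by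
  have : Fact p.Prime := ⟨hp⟩
  intro a
  set D := c - ∑ j, d j * s j ^ p with hD
  have hsum : ∑ i, (Fin.snoc d D : Fin (m + 1) → C) i * a i ^ p =
      ∑ i : Fin m, d i * a i.castSucc ^ p + D * a (Fin.last m) ^ p := by
    simp [Fin.sum_univ_castSucc]
  rw [hsum]
  have hlast : u (D * a (Fin.last m) ^ p) ≤
      u (∑ i : Fin m, d i * a i.castSucc ^ p + D * a (Fin.last m) ^ p) := by
    by_cases h0 : a (Fin.last m) = 0
    · simp [h0, zero_pow hp.ne_zero]
    · have h1 : ∑ i : Fin m, d i * a i.castSucc ^ p + D * a (Fin.last m) ^ p =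
          (c - ∑ j, d j * (s j - a j.castSucc / a (Fin.last m)) ^ p) * a (Fin.last m) ^ p := by
        simp only [sub_pow_char, mul_sub, Finset.sum_sub_distrib, div_pow, hD, sub_mul,
          Finset.sum_mul]
        have h2 : ∀ i : Fin m, d i * (a i.castSucc ^ p / a (Fin.last m) ^ p) *
            a (Fin.last m) ^ p = d i * a i.castSucc ^ p := fun i => by
          have := pow_ne_zero p h0
          field_simp
        simp only [h2]
        ring
      rw [h1, map_mul, map_mul]
      gcongr
      exact hs _
  refine Fin.lastCases (by simpa using hlast) fun j => ?_
  simp only [Fin.snoc_castSucc]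
  refine (h (fun i => a i.castSucc) j).trans ?_
  have h3 := u.map_sub (∑ i : Fin m, d i * a i.castSucc ^ p + D * a (Fin.last m) ^ p)
    (D * a (Fin.last m) ^ p)
  rw [add_sub_cancel_right, max_eq_left hlast] at h3
  exact h3

theorem exists_valIndep {π : C} (hπ : IsUniformizer u π) {p : ℕ} (hp : p.Prime) [CharP C p]
    {L : Type u} [Field L] (f : C →+* L) (hf : HasPowLimits u f) (m : ℕ) (c : Fin m → C)
    (hc : ∀ z : Fin m → L, ∑ i, f (c i) * z i ^ p = 0 → ∀ i, z i = 0) :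
    ∃ d : Fin m → C, (∀ j, d j ≠ 0) ∧ ValIndep u p d ∧ FrobLe p c d ∧ FrobLe p d c := by
  have : Fact p.Prime := ⟨hp⟩
  have : CharP L p := (RingHom.charP_iff f f.injective p).1 inferInstance
  induction m with
  | zero => exact ⟨c, fun j => j.elim0, fun _ j => j.elim0, fun L _ f y => ⟨y, rfl, _root_.id⟩,
      fun L _ f y => ⟨y, rfl, _root_.id⟩⟩
  | succ m ih =>
    obtain ⟨d, hd0, hd, h1, h2⟩ := ih (Fin.init c) fun z hz i => by
      have := hc (Fin.snoc (α := fun _ => L) z 0) (by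
        simpa [Fin.sum_univ_castSucc, zero_pow hp.ne_zero, Fin.init] using hz) i.castSucc
      simpa using this
    have hne : ∀ x : Fin m → L, f (c (Fin.last m)) ≠ ∑ j, f (d j) * x j ^ p := by
      intro x hx
      obtain ⟨y, hy, -⟩ := h2 L f x
      have := hc (Fin.snoc (α := fun _ => L) y (-1)) (by
        simp only [Fin.sum_univ_castSucc, Fin.snoc_castSucc, Fin.snoc_last, neg_one_pow_char]
        rw [hx, hy]
        simp [Fin.init]) (Fin.last m)
      simp at this
    have hmin : ∃ s : Fin m → C, ∀ z : Fin m → C,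
        u (c (Fin.last m) - ∑ j, d j * s j ^ p) ≤ u (c (Fin.last m) - ∑ j, d j * z j ^ p) := by
      by_contra! hcon
      choose z hz using hπ.exists_le_mul_pow
        (fun s : Fin m → C => c (Fin.last m) - ∑ j, d j * s j ^ p) hcon 0
      obtain ⟨x, hx⟩ := hf p m d z (c (Fin.last m)) (fun j t ht => by
        obtain ⟨N, hN⟩ := hπ.exists_mul_pow_lt
          (c (Fin.last m) - ∑ j, d j * (0 : Fin m → C) j ^ p)
          (mul_ne_zero (hd0 j) (pow_ne_zero p ht))
        refine ⟨N, fun k hk l hl => ?_⟩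
        have h3 := hd (fun i => z k i - z l i) j
        simp only [sub_pow_char, mul_sub, Finset.sum_sub_distrib] at h3
        have h4 := u.map_sub (c (Fin.last m) - ∑ j, d j * z l j ^ p)
          (c (Fin.last m) - ∑ j, d j * z k j ^ p)
        rw [sub_sub_sub_cancel_left] at h4
        have h5 := (h3.trans h4).trans_lt (max_lt ((hz l).trans_lt (hN l hl))
          ((hz k).trans_lt (hN k hk)))
        rw [← mul_sub, ← sub_pow_char, map_mul, map_mul, map_pow, map_pow] at h5
        exact lt_of_pow_lt_pow_left₀ p zero_le' (lt_of_mul_lt_mul_left' h5)) (fun t ht => by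
        obtain ⟨N, hN⟩ := hπ.exists_mul_pow_lt
          (c (Fin.last m) - ∑ j, d j * (0 : Fin m → C) j ^ p) ht
        exact ⟨N, fun k hk => by
          rw [Valuation.map_sub_swap]
          exact (hz k).trans_lt (hN k hk)⟩)
      exact hne x hx
    obtain ⟨s, hs⟩ := hmin
    have hD : c (Fin.last m) - ∑ j, d j * s j ^ p ≠ 0 := fun h0 => hne (fun j => f (s j)) (by
      rw [sub_eq_zero.1 h0]
      simp)
    have hcc : (Fin.snoc (Fin.init c) (c (Fin.last m)) : Fin (m + 1) → C) = c :=
      Fin.snoc_init_self c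
    refine ⟨Fin.snoc d (c (Fin.last m) - ∑ j, d j * s j ^ p), ?_, hd.snoc hp hs, ?_, ?_⟩
    · exact Fin.lastCases (by simpa using hD) fun j => by simpa using hd0 j
    · rw [← hcc]
      exact h1.snoc hp _ _ s (by simp)
    · rw [← hcc]
      obtain ⟨w, hw, -⟩ := h2 C (RingHom.id C) fun j => -s j
      refine h2.snoc hp _ _ w ?_
      simp only [RingHom.id_apply] at hw
      rw [← hw]
      simp_rw [neg_pow (s _), neg_one_pow_char]
      simp [sub_eq_add_neg]

end

end Paper

namespace Paper

theorem mem_nonunits_valuationSubring_iff {K : Type*} [Field K] {Γ : Type*}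
    [LinearOrderedCommGroupWithZero Γ] {v : Valuation K Γ} (x : K) :
    x ∈ v.valuationSubring.nonunits ↔ v x < 1 := by
  rw [ValuationSubring.mem_nonunits_iff_or, Valuation.mem_valuationSubring_iff, map_inv₀, not_le]
  by_cases h : x = 0
  · simp [h]
  · simp [h, one_lt_inv₀ ((Valuation.pos_iff v).2 h)]

theorem resMap_eq_zero_iff {K : Type*} [Field K] {Γ : Type*} [LinearOrderedCommGroupWithZero Γ]
    {v : Valuation K Γ} (x : v.valuationSubring) : resMap v x = 0 ↔ v x < 1 := by
  rw [IsLocalRing.residue_eq_zero_iff, ← ValuationSubring.coe_mem_nonunits_iff,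
    mem_nonunits_valuationSubring_iff]

theorem sum_subtype_eq_sum {ι M : Type*} [Fintype ι] [AddCommMonoid M] (P : ι → Prop)
    [DecidablePred P] (g : ι → M) (h : ∀ i, ¬P i → g i = 0) :
    ∑ i : {i // P i}, g i = ∑ i, g i := by
  rw [← Fintype.sum_subtype_add_sum_subtype P g,
    Finset.sum_eq_zero (s := (Finset.univ : Finset {i // ¬P i})) fun i _ => h i i.2, add_zero]

theorem sepHom_of_residue {C : Type u} [Field C] {u : Valuation C Zm0} {π : C}
    (hπ : IsUniformizer u π) (hchar : ringChar C = ringChar (ResF u)) {L : Type u} [Field L]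
    {i : C →+* L} (hi : SepHom i) (hlim : HasPowLimits u i) {M : Type u} [Field M] {Γ : Type*}
    [LinearOrderedCommGroupWithZero Γ] {v : Valuation M Γ} {f : C →+* M}
    (hf : (v.comap f).IsEquiv u) (hval : ∀ y : M, y ≠ 0 → ∃ c : C, v y = v (f c))
    {g : ResF u →+* ResF v} (hg : SepHom g)
    (hgf : ∀ (x : u.valuationSubring) (hx : f x ∈ v.valuationSubring),
      g (resMap u x) = resMap v ⟨f x, hx⟩) : SepHom f := by
  classical
  refine sepHom_of_independent fun p hp hC m c hc y hy => ?_
  have : Fact p.Prime := ⟨hp⟩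
  obtain ⟨d, hd0, hd, h1, -⟩ := exists_valIndep hπ hp i hlim m c fun z hz => by
    by_contra! hne
    obtain ⟨z', hz', j, hj⟩ := hi p hp hC m c z hz hne
    exact hj (hc z' hz' j)
  obtain ⟨y', hy', h2⟩ := h1 M f y
  refine congrFun (h2 ?_)
  by_contra hne
  have hle : ∀ x : C, u x ≤ 1 ↔ v (f x) ≤ 1 := fun x => by
    simpa using (hf.le_one_iff_le_one (x := x)).symm
  have hchoose : ∀ j, ∃ (a : C) (w : M), a ≠ 0 ∧ y' j = f a * w ∧ v w ≤ 1 ∧ (y' j ≠ 0 → v w = 1) := by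
    intro j
    by_cases h0 : y' j = 0
    · exact ⟨1, 0, one_ne_zero, by simp [h0], by simp, fun h => (h h0).elim⟩
    · obtain ⟨a, ha⟩ := hval _ h0
      have ha' : v (f a) ≠ 0 := by rw [← ha]; simpa using h0
      have ha0 : f a ≠ 0 := by simpa using ha'
      have : v (y' j / f a) = 1 := by rw [map_div₀, ha, div_self ha']
      exact ⟨a, y' j / f a, by simpa using ha0, by field_simp, this.le, fun _ => this⟩
  choose a w ha hyw hw hw1 using hchoose
  obtain ⟨j₀, hj₀, hmax⟩ : ∃ j₀, y' j₀ ≠ 0 ∧ ∀ j, y' j ≠ 0 →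
      u (d j * a j ^ p) ≤ u (d j₀ * a j₀ ^ p) := by
    have hS : (Finset.univ.filter fun j => y' j ≠ 0).Nonempty := by
      obtain ⟨j, hj⟩ := Function.ne_iff.1 hne
      exact ⟨j, by simpa using hj⟩
    obtain ⟨j₀, h3, h4⟩ := Finset.exists_max_image _ (fun j => u (d j * a j ^ p)) hS
    exact ⟨j₀, by simpa using h3, fun j hj => h4 j (by simpa using hj)⟩
  set b := d j₀ * a j₀ ^ p with hb
  have hb0 : b ≠ 0 := mul_ne_zero (hd0 _) (pow_ne_zero _ (ha _))
  have hub0 : 0 < u b := (Valuation.pos_iff u).2 hb0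
  let e : Fin m → u.valuationSubring := fun j =>
    if h : y' j = 0 then 0 else ⟨d j * a j ^ p / b, by
      change u _ ≤ 1
      rw [map_div₀]
      exact (div_le_one₀ hub0).2 (hmax j h)⟩
  have he : ∀ j, y' j ≠ 0 → (e j : C) = d j * a j ^ p / b := fun j hj => by simp [e, hj]
  have he0 : ∀ j, y' j = 0 → e j = 0 := fun j hj => by simp [e, hj]
  let w' : Fin m → v.valuationSubring := fun j => ⟨w j, hw j⟩
  have hfe : ∀ j, f (e j) ∈ v.valuationSubring := fun j => (hle _).1 (e j).2
  have hsum : ∑ j, (⟨f (e j), hfe j⟩ : v.valuationSubring) * w' j ^ p = 0 := by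
    apply Subtype.ext
    push_cast
    have h3 : ∀ j, f (e j) * w j ^ p * f b = f (d j) * y' j ^ p := fun j => by
      by_cases hj : y' j = 0
      · simp [he0 j hj, hj, zero_pow hp.ne_zero]
      · have hfb : f b ≠ 0 := by simpa using hb0
        rw [he j hj, hyw j, map_div₀, map_mul, map_pow, mul_pow]
        field_simp
    have h4 : (∑ j, f (e j) * w j ^ p) * f b = 0 := by
      rw [Finset.sum_mul]
      simp only [h3]
      rw [← hy', hy]
    exact (mul_eq_zero.1 h4).resolve_right (by simpa using hb0)
  have hres : ∑ j, g (resMap u (e j)) * resMap v (w' j) ^ p = 0 := by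
    rw [← map_zero (resMap v), ← hsum, map_sum]
    simp only [map_mul, map_pow, hgf _ (hfe _)]
  have : CharP (ResF u) p := ringChar.of_eq (hchar ▸ ringChar.eq C p)
  obtain ⟨z, hz, j₁, hj₁⟩ := hg.exists_of_fintype hp (ι := {j // resMap u (e j) ≠ 0})
    (fun j => resMap u (e j)) (fun j => resMap v (w' j)) (by
      rw [← hres]
      exact sum_subtype_eq_sum _ (fun j => g (resMap u (e j)) * resMap v (w' j) ^ p)
        fun j hj => by rw [not_not.1 hj, map_zero, zero_mul]) ⟨⟨j₀, by
        rw [Ne, resMap_eq_zero_iff, he j₀ hj₀, div_self hb0]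
        simp⟩, by
        rw [Ne, resMap_eq_zero_iff]
        simp [w', hw1 j₀ hj₀]⟩
  choose Z hZ using fun j => IsLocalRing.residue_surjective (R := u.valuationSubring) (z j)
  let Z' : Fin m → u.valuationSubring := fun j => if h : resMap u (e j) ≠ 0 then Z ⟨j, h⟩ else 0
  have hZ' : ∀ j : {j // resMap u (e j) ≠ 0}, resMap u (Z' j) = z j := fun j => by
    rw [← hZ, show Z' j = Z j from dif_pos j.2]
  have hbZ : ∀ j, d j * (a j * Z' j) ^ p = b * (e j * Z' j ^ p) := fun j => by
    by_cases hj : resMap u (e j) ≠ 0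
    · have : y' j ≠ 0 := fun h => hj (by rw [he0 j h, map_zero])
      rw [he j this, mul_pow]
      field_simp
    · rw [show Z' j = 0 from dif_neg hj]
      simp [zero_pow hp.ne_zero]
  have hlt : u (∑ j, (e j : C) * (Z' j : C) ^ p) < 1 := by
    have h5 : resMap u (∑ j, e j * Z' j ^ p) = 0 := by
      rw [← hz, map_sum, ← sum_subtype_eq_sum (fun j => resMap u (e j) ≠ 0)]
      · refine Finset.sum_congr rfl fun j _ => ?_
        rw [map_mul, map_pow, hZ' j]
      · intro j hj
        rw [map_mul, not_not.1 hj, zero_mul]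
    rw [resMap_eq_zero_iff] at h5
    simpa using h5
  have h6 := hd (fun j => a j * Z' j) j₁
  simp only [hbZ, ← Finset.mul_sum, map_mul u b] at h6
  have h7 := le_of_mul_le_mul_left h6 hub0
  have h8 : resMap u (e j₁ * Z' j₁ ^ p) ≠ 0 := by
    rw [map_mul, map_pow, hZ' j₁]
    exact mul_ne_zero j₁.2 (pow_ne_zero p hj₁)
  rw [Ne, resMap_eq_zero_iff] at h8
  exact h8 (h7.trans_lt hlt)

end Paper

namespace Paper

theorem SepHom.of_surjective {F L : Type*} [Field F] [Field L] {f : F →+* L}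
    (hf : Function.Surjective f) : SepHom f := by
  intro p hp hF m c y hy ⟨i, hi⟩
  choose z hz using fun i => hf (y i)
  refine ⟨z, f.injective ?_, i, fun h => hi (by rw [← hz, h, map_zero])⟩
  rw [map_zero, ← hy, map_sum]
  simp [hz]

theorem nonempty_elementaryEmbedding_of_ringEquiv {F L : Type*} [Field F] [Field L]
    (e : F ≃+* L) : Nonempty (@Language.ElementaryEmbedding Language.ring F L
      (ringStructure _) (ringStructure _)) := by
  let _ := FirstOrder.Ring.compatibleRingOfRing F
  let _ := FirstOrder.Ring.compatibleRingOfRing L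
  exact ⟨(FirstOrder.Ring.languageEquivEquivRingEquiv.symm e).toElementaryEmbedding⟩

theorem IsUniformizer.maximalIdeal_eq {K : Type*} [Field K] {Γ : Type*}
    [LinearOrderedCommGroupWithZero Γ] {v : Valuation K Γ} {t : K} (ht : IsUniformizer v t) :
    IsLocalRing.maximalIdeal v.valuationSubring =
      Ideal.span {(⟨t, ht.2.1.le⟩ : v.valuationSubring)} := by
  ext x
  rw [← ValuationSubring.coe_mem_nonunits_iff, mem_nonunits_valuationSubring_iff,
    Ideal.mem_span_singleton]
  have ht0 : t ≠ 0 := (Valuation.pos_iff v).1 ht.1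
  constructor
  · intro h
    refine ⟨⟨x / t, ?_⟩, Subtype.ext ?_⟩
    · change v _ ≤ 1
      rw [map_div₀]
      exact (div_le_one₀ ht.1).2 (ht.2.2 _ h)
    · change (x : K) = t * (x / t)
      field_simp
  · rintro ⟨y, rfl⟩
    change v (t * y) < 1
    rw [map_mul]
    exact mul_lt_one_of_nonneg_of_lt_one_left zero_le' ht.2.1 y.2

end Paper

namespace Paper

theorem exists_coarse_hom {K F : Type*} [Field K] [Field F] {A : ValuationSubring K} {t : K}
    (ht : t ∈ A) (ht0 : t ≠ 0) (j : A →+* F) (hj : j ⟨t, ht⟩ ≠ 0) :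
    ∃ g : coarse A t ht →+* F, ∀ a : A, g ⟨a, le_coarse ht a.2⟩ = j a := by
  let i : A →+* coarse A t ht := ValuationSubring.inclusion _ _ (le_coarse ht)
  let _ : Algebra A (coarse A t ht) := i.toAlgebra
  have hi : ∀ a, ((algebraMap A (coarse A t ht) a : coarse A t ht) : K) = a := fun a => rfl
  have hloc : IsLocalization.Away (⟨t, ht⟩ : A) (coarse A t ht) := by
    refine ⟨?_, ?_, ?_⟩
    · rintro ⟨_, n, rfl⟩
      have h1 : t⁻¹ ∈ coarse A t ht := ⟨1, by simp [ht0, A.one_mem]⟩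
      simp only [map_pow]
      refine IsUnit.pow _ (IsUnit.of_mul_eq_one ⟨t⁻¹, h1⟩ (Subtype.ext ?_))
      change t * t⁻¹ = 1
      exact mul_inv_cancel₀ ht0
    · rintro ⟨y, k, hk⟩
      refine ⟨(⟨t ^ k * y, hk⟩, ⟨⟨t, ht⟩ ^ k, k, rfl⟩), Subtype.ext ?_⟩
      change y * t ^ k = t ^ k * y
      exact mul_comm _ _
    · intro x y hxy
      exact ⟨1, by
        have h1 : (x : K) = y := by
          rw [← hi x, ← hi y, hxy]
        rw [Subtype.ext h1]⟩
  exact ⟨IsLocalization.Away.lift (S := coarse A t ht) (⟨t, ht⟩ : A) (g := j) (isUnit_iff_ne_zero.2 hj),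
    fun a => IsLocalization.Away.lift_eq (S := coarse A t ht) _ _ a⟩

/-- The completion of a valued field with uniformizer `t` at the `t`-adic topology. -/
theorem exists_complete_extension {C : Type u} [Field C] {u : Valuation C Zm0} {π : C}
    (hchar : ringChar C = ringChar (ResF u)) (hπu : IsUniformizer u π)
    (hexc : ExcellentCompletion C u) {K : Type u} [Field K] {Γ : Type*}
    [LinearOrderedCommGroupWithZero Γ] (v : Valuation K Γ) (i : C →+* K)
    (hi : (v.comap i).IsEquiv u) (hv : IsHenselian v) (hπv : IsUniformizer v (i π))
    (gK : ResF u →+* ResF v)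
    (hgK : ∀ (x : u.valuationSubring) (hx : i x ∈ v.valuationSubring),
      gK (resMap u x) = resMap v ⟨i x, hx⟩) (hsep : SepHom gK) :
    ∃ (K' : Type u) (_ : Field K') (f : C →+* K') (v' : Valuation K' Zm0)
      (j : v.valuationSubring →+* K'),
      Function.Surjective v' ∧ (v'.comap f).IsEquiv u ∧ IsHenselian v' ∧
      IsUniformizer v' (f π) ∧ IsCompleteValued v' ∧ Nonempty (ResF v ≃+* ResF v') ∧ SepHom f ∧
      ExHom f i ∧
      (∀ (c : C) (hc : i c ∈ v.valuationSubring), f c = j ⟨i c, hc⟩) ∧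
      (∀ a : v.valuationSubring, (∀ k : ℕ, ∃ z ∈ v.valuationSubring, (a : K) = i π ^ k * z) →
        j a = 0) := by
  have hπ0 : i π ≠ 0 := (Valuation.pos_iff v).1 hπv.1
  let A := v.valuationSubring
  let t : A := ⟨i π, hπv.2.1.le⟩
  obtain ⟨R, _, _, _, _, ι, _, τ, hmax, hbij, happ, hι⟩ := exists_completion A t
    hπv.maximalIdeal_eq fun h => hπ0 (congrArg Subtype.val h)
  have hle : ∀ c : C, u c ≤ 1 ↔ i c ∈ A := fun c => by
    exact (hi.le_one_iff_le_one (x := c)).symm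
  have hlt : ∀ c : C, u c < 1 ↔ v (i c) < 1 := fun c => by
    simpa using (hi.lt_one_iff_lt_one (x := c)).symm
  let i₀ : u.valuationSubring →+* A :=
    (i.comp u.valuationSubring.subtype).codRestrict A.toSubring fun x => (hle x).1 x.2
  let K' := FractionRing R
  let j : A →+* K' := (algebraMap R K').comp ι
  have hιt : ι t ≠ 0 := by
    intro h
    refine IsDiscreteValuationRing.not_a_field R ?_
    rw [hmax, h, Ideal.span_singleton_eq_bot]
  have hji : Function.Injective (j.comp i₀) := by
    refine (injective_iff_map_eq_zero _).2 fun x hx => ?_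
    by_contra hx0
    obtain ⟨n, hn⟩ := hπu.exists_mul_pow_lt 1 (t := (x : C)) (by simpa using hx0)
    have hn := hn n le_rfl
    have hx0' : (x : C) ≠ 0 := by simpa using hx0
    have h1 : π ^ n / x ∈ u.valuationSubring := by
      change u _ ≤ 1
      rw [map_div₀, map_pow]
      exact (div_le_one₀ ((Valuation.pos_iff u).2 hx0')).2 (by simpa using hn.le)
    have h2 : (⟨π, hπu.2.1.le⟩ : u.valuationSubring) ^ n = x * ⟨_, h1⟩ := Subtype.ext (by
      change π ^ n = x * (π ^ n / x)
      field_simp)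
    have h3 := congrArg (j.comp i₀) h2
    rw [map_mul, hx, zero_mul, map_pow] at h3
    have h4 := eq_zero_of_pow_eq_zero h3
    exact hιt (IsFractionRing.injective R K' (h4.trans (map_zero _).symm))
  let f : C →+* K' := IsFractionRing.lift (A := u.valuationSubring) hji
  have hf : ∀ x : u.valuationSubring, f x = j (i₀ x) := fun x =>
    IsFractionRing.lift_algebraMap hji x
  let v' : Valuation K' Zm0 := dvrVal R K'
  have hfπ : f π = algebraMap R K' (ι t) := hf ⟨π, hπu.2.1.le⟩
  have hunif : IsUniformizer v' (f π) := hfπ ▸ dvrVal_isUniformizer hmax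
  have hequiv : (v'.comap f).IsEquiv u := by
    refine Valuation.isEquiv_iff_val_le_one.2 fun {x} => ?_
    have h1 : ∀ x, u x ≤ 1 → v' (f x) ≤ 1 := fun x hx =>
      dvrVal_le_one_iff.2 ⟨ι (i₀ ⟨x, hx⟩), (hf ⟨x, hx⟩).symm⟩
    refine ⟨fun h => ?_, h1 x⟩
    by_contra! h2
    have hx0 : x ≠ 0 := by
      rintro rfl
      simp at h2
    have h3 : u x⁻¹ < 1 := by rw [map_inv₀]; exact inv_lt_one_of_one_lt₀ h2
    have h4 : v' (f x⁻¹) < 1 := by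
      rw [hf ⟨x⁻¹, h3.le⟩]
      refine dvrVal_lt_one_iff.2 (map_nonunit ι _ ?_)
      rw [← ValuationSubring.coe_mem_nonunits_iff]
      exact (mem_nonunits_valuationSubring_iff _).2 ((hlt _).1 h3)
    rw [map_inv₀, map_inv₀] at h4
    exact not_lt.2 h ((inv_lt_one₀ ((Valuation.pos_iff v').2 (by simpa using hx0))).1 h4)
  have hfc : ∀ (c : C) (hc : i c ∈ v.valuationSubring), f c = j ⟨i c, hc⟩ := fun c hc =>
    hf ⟨c, (hle c).2 hc⟩
  let E : R ≃+* v'.valuationSubring := IsDiscreteValuationRing.equivValuationSubring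
  have hE : ∀ r, (E r : K') = algebraMap R K' r := fun r => rfl
  let e : ResF v ≃+* ResF v' := (RingEquiv.ofBijective _ hbij).trans
    (IsLocalRing.ResidueField.mapEquiv E)
  have he : ∀ a : A, e (resMap v a) = resMap v' (E (ι a)) := fun a => rfl
  have hsepf : SepHom f := by
    let _ : Valued C Zm0 := Valued.mk' u
    let _ : Field (UniformSpace.Completion C) := UniformSpace.Completion.instField
    let _ : Algebra C (UniformSpace.Completion C) :=
      (UniformSpace.Completion.coeRingHom : C →+* UniformSpace.Completion C).toAlgebra
    refine sepHom_of_residue hπu hchar (sepHom_of_isSepExt hexc) (hasPowLimits_completion u)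
      hequiv ?_ (g := (e : ResF v →+* ResF v').comp gK) (.comp (.of_surjective e.surjective) hsep) ?_
    · have hirr := (IsDiscreteValuationRing.irreducible_iff_uniformizer (ι t)).2 hmax
      have h1 : ∀ r : R, r ≠ 0 → ∃ n : ℕ, v' (algebraMap R K' r) = v' (f π) ^ n := fun r hr => by
        obtain ⟨n, w, rfl⟩ := IsDiscreteValuationRing.eq_unit_mul_pow_irreducible hr hirr
        exact ⟨n, by rw [map_mul, map_mul, dvrVal_eq_one_of_unit, one_mul, map_pow, map_pow, hfπ]⟩
      intro y hy
      obtain ⟨a, b, hb, rfl⟩ := IsFractionRing.div_surjective (A := R) y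
      obtain ⟨k, hk⟩ := h1 a (by rintro rfl; simp at hy)
      obtain ⟨l, hl⟩ := h1 b (nonZeroDivisors.ne_zero hb)
      exact ⟨π ^ k / π ^ l, by rw [map_div₀, hk, hl]; simp⟩
    · intro x hx
      rw [RingHom.comp_apply, hgK x ((hle x).1 x.2)]
      exact (he _).trans (congrArg _ (Subtype.ext (hf x).symm))
  refine ⟨K', inferInstance, f, v', j, dvrVal_surjective R K', hequiv, dvrVal_isHenselian, hunif,
    dvrVal_isCompleteValued, ⟨e⟩, hsepf, ?_, hfc, fun a ha => ?_⟩
  · refine happ.exHom (L := K') (hensV_of_henselianLocalRing (A := A)) ?_ hπ0 i hsepf ?_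
      (u.valuationSubring : Set C) ?_ ?_
    · exact (mem_nonunits_valuationSubring_iff _).2 hπv.2.1
    · intro c
      obtain ⟨n, hn⟩ := hπu.exists_mul_pow_lt c one_ne_zero
      refine ⟨n, ?_⟩
      rw [← map_pow, ← map_mul]
      refine (hle _).1 ?_
      simpa [mul_comm] using (hn n le_rfl).le
    · intro c
      obtain ⟨a, b, hb, h⟩ := IsFractionRing.div_surjective (A := u.valuationSubring) c
      have hb0 : (b : C) ≠ 0 := by simpa using nonZeroDivisors.ne_zero hb
      refine ⟨a, a.2, b, b.2, hb0, ?_⟩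
      rw [← h]
      exact div_mul_cancel₀ _ hb0
    · intro a ha
      exact ⟨(hle a).1 ha, ι (i₀ ⟨a, ha⟩), hf ⟨a, ha⟩, hι _⟩
  · have h0 : ι a ∈ (⨅ k : ℕ, IsLocalRing.maximalIdeal R ^ k) := by
      refine (Submodule.mem_iInf _).2 fun k => ?_
      obtain ⟨z, hz, h⟩ := ha k
      have h1 : a = t ^ k * ⟨z, hz⟩ := Subtype.ext h
      rw [h1, map_mul, map_pow, hmax]
      exact Ideal.mul_mem_right _ _ (Ideal.pow_mem_pow (Ideal.mem_span_singleton_self _) _)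
    rw [Ideal.iInf_pow_eq_bot_of_isLocalRing _ (Ideal.IsPrime.ne_top'), Ideal.mem_bot] at h0
    change algebraMap R K' (ι a) = 0
    rw [h0, map_zero]

end Paper

namespace Paper

/-- A homomorphism to a field which is defined on a valuation ring, does not kill `i π` and kills
the elements infinitely divisible by `i π` embeds the residue field of the coarsening. -/
theorem exists_residueField_coarse_hom {C K F : Type*} [Field C] [Field K] [Field F]
    {A : ValuationSubring K} {i : C →+* K} {π : C} (hπ : i π ∈ A.nonunits) (hπ0 : π ≠ 0)
    (hC : ∀ c, ∃ k : ℕ, i π ^ k * i c ∈ A) {f : C →+* F} (j : A →+* F)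
    (hj : ∀ c (hc : i c ∈ A), f c = j ⟨i c, hc⟩)
    (hker : ∀ a : A, (∀ k : ℕ, ∃ z ∈ A, (a : K) = i π ^ k * z) → j a = 0) :
    ∃ (hW : ∀ c, i c ∈ coarse A (i π) (A.nonunits_le hπ))
      (e : IsLocalRing.ResidueField (coarse A (i π) (A.nonunits_le hπ)) →+* F),
      ∀ c, e (IsLocalRing.residue (coarse A (i π) (A.nonunits_le hπ)) ⟨i c, hW c⟩) = f c := by
  have hiπ0 : i π ≠ 0 := (map_ne_zero i).2 hπ0
  have hfπ0 : f π ≠ 0 := (map_ne_zero f).2 hπ0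
  have hπA : i π ∈ A := A.nonunits_le hπ
  obtain ⟨g, hg⟩ := exists_coarse_hom (A.nonunits_le hπ) hiπ0 j (by rwa [← hj])
  have hloc : IsLocalHom g := by
    refine ⟨fun a ha => ?_⟩
    by_contra hna
    have hna' : (a : K) ∈ (coarse A (i π) (A.nonunits_le hπ)).nonunits :=
      (mem_maximalIdeal_iff_nonunits _).1 ((IsLocalRing.mem_maximalIdeal _).2 hna)
    have h1 := (mem_nonunits_coarse hπ hiπ0).1 hna'
    have haA : (a : K) ∈ A := by
      obtain ⟨z, hz, h⟩ := h1 0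
      rw [h]; simpa using hz
    have h2 : g a = 0 := by
      have := hg ⟨a, haA⟩
      rw [hker _ h1] at this
      exact this
    exact ha.ne_zero h2
  have hW : ∀ c, i c ∈ coarse A (i π) (A.nonunits_le hπ) := hC
  refine ⟨hW, IsLocalRing.ResidueField.lift g, fun c => ?_⟩
  rw [IsLocalRing.ResidueField.lift_residue_apply]
  obtain ⟨k, hk⟩ := hC c
  have hk' : i (π ^ k * c) ∈ A := by simpa using hk
  have h1 := hj _ hk'
  have h2 := hj _ hπA
  rw [← hg] at h1 h2
  have h3 : (⟨i (π ^ k * c), le_coarse hπA hk'⟩ : coarse A (i π) (A.nonunits_le hπ)) =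
      ⟨i π, le_coarse hπA hπA⟩ ^ k * ⟨i c, hW c⟩ := Subtype.ext (by simp)
  have h4 : f π ^ k * f c = f π ^ k * g ⟨i c, hW c⟩ := by
    rw [← map_pow, ← map_mul, h1]
    erw [h3]
    rw [map_mul, map_pow]
    rw [map_pow, h2]
  exact (mul_left_cancel₀ (pow_ne_zero _ hfπ0) h4).symm

end Paper

namespace Paper

/-- The composite of a ring homomorphism into a valuation ring with the residue map. -/
noncomputable def resHom {C K : Type*} [CommRing C] [Field K] (W : ValuationSubring K) (j : C →+* K)
    (hj : ∀ c, j c ∈ W) : C →+* IsLocalRing.ResidueField W :=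
  (IsLocalRing.residue W).comp (j.codRestrict W.toSubring hj)

theorem resHom_apply {C K : Type*} [CommRing C] [Field K] {W : ValuationSubring K} {j : C →+* K}
    {hj : ∀ c, j c ∈ W} (c : C) : resHom W j hj c = IsLocalRing.residue W ⟨j c, hj c⟩ := rfl

section ExHom

variable {C D M N : Type*} [CommRing C] [CommRing D] [CommRing M] [CommRing N]

theorem ExHom.comp {f : C →+* M} {g : C →+* N} (hfg : ExHom f g) (h : D →+* C) :
    ExHom (f.comp h) (g.comp h) := by
  classical
  intro m x P
  obtain ⟨y, hy⟩ := hfg m x (P.image (MvPolynomial.map h))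
  refine ⟨y, fun p hp => ?_⟩
  have := hy _ (Finset.mem_image_of_mem _ hp)
  rwa [MvPolynomial.eval₂_map, MvPolynomial.eval₂_map] at this

theorem ExHom.sepHom {f : C →+* M} (hf : ExHom f (RingHom.id C)) : SepHom f := by
  classical
  intro p _ _ m c y h hy
  obtain ⟨z, hz⟩ := hf m y (insert (∑ i, MvPolynomial.C (c i) * MvPolynomial.X i ^ p)
    (Finset.univ.image MvPolynomial.X))
  refine ⟨z, ?_, ?_⟩
  · have h1 := (hz _ (Finset.mem_insert_self _ _)).1
      (by simpa [MvPolynomial.eval₂_sum, MvPolynomial.eval₂_mul, MvPolynomial.eval₂_pow] using h)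
    simpa [MvPolynomial.eval₂_sum, MvPolynomial.eval₂_mul, MvPolynomial.eval₂_pow] using h1
  · obtain ⟨i, hi⟩ := hy
    refine ⟨i, fun h0 => hi ?_⟩
    have h1 := hz (MvPolynomial.X i) (Finset.mem_insert_of_mem
      (Finset.mem_image_of_mem _ (Finset.mem_univ _)))
    simpa [h0] using h1

end ExHom

open Filter

section Germ

variable {I : Type*} (U : Ultrafilter I) {K : Type*} [Field K]

theorem constGerm_mem_germV {A : ValuationSubring K} {x : K} :
    constGerm U x ∈ germV U A ↔ x ∈ A := by
  rw [constGerm_apply, coe_mem_germV, eventually_const]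

/-- The residue field of an ultrapower of a valuation ring satisfies no more existential
sentences than the residue field. -/
theorem exHom_residueField_germV (W : ValuationSubring K)
    (ψ : IsLocalRing.ResidueField W →+* IsLocalRing.ResidueField (germV U W))
    (hψ : ∀ x : W, ψ (IsLocalRing.residue W x) =
      IsLocalRing.residue (germV U W) ⟨constGerm U x, (constGerm_mem_germV U).2 x.2⟩) :
    ExHom ψ (RingHom.id _) := by
  intro m x P
  have hx : ∀ i, ∃ X : I → K, ∃ h : (X : Germ (U : Filter I) K) ∈ germV U W,
      x i = IsLocalRing.residue (germV U W) ⟨X, h⟩ := by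
    intro i
    obtain ⟨⟨z, hz⟩, hzi⟩ := IsLocalRing.residue_surjective (x i)
    obtain ⟨X, hX⟩ := Quotient.exists_rep z
    subst hX
    exact ⟨X, hz, hzi.symm⟩
  choose X hX hxX using hx
  have hmap := MvPolynomial.map_surjective (σ := Fin m) (IsLocalRing.residue W)
    IsLocalRing.residue_surjective
  choose lift hlift using hmap
  let gW : W →+* germV U W :=
    ((constGerm U).comp W.subtype).codRestrict (germV U W).toSubring
      fun x => (constGerm_mem_germV U).2 x.2
  have hψ' : ψ.comp (IsLocalRing.residue W) = (IsLocalRing.residue (germV U W)).comp gW :=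
    RingHom.ext hψ
  have key : ∀ p ∈ P, ∀ᶠ s in (U : Filter I), MvPolynomial.eval₂ ψ x p = 0 ↔
      MvPolynomial.eval₂ W.subtype (fun i => X i s) (lift p) ∈ W.nonunits := by
    intro p _
    have h1 : MvPolynomial.eval₂ ψ x p = IsLocalRing.residue (germV U W)
        (MvPolynomial.eval₂ gW (fun i => ⟨X i, hX i⟩) (lift p)) := by
      conv_lhs => rw [← hlift p, MvPolynomial.eval₂_map, hψ', funext hxX]
      exact (MvPolynomial.eval₂_comp_left (IsLocalRing.residue (germV U W)) gW
        (fun i => ⟨X i, hX i⟩) (lift p)).symm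
    have h2 : ((MvPolynomial.eval₂ gW (fun i => ⟨X i, hX i⟩) (lift p) : germV U W) :
        Germ (U : Filter I) K) =
        ((fun s => MvPolynomial.eval₂ W.subtype (fun i => X i s) (lift p) : I → K) :
          Germ (U : Filter I) K) := by
      rw [← eval₂_germ]
      exact MvPolynomial.eval₂_comp_left (germV U W).subtype gW _ (lift p)
    rw [h1, IsLocalRing.residue_eq_zero_iff, mem_maximalIdeal_iff_nonunits, h2,
      coe_mem_nonunits_germV]
    by_cases h : ∀ᶠ s in (U : Filter I),
      MvPolynomial.eval₂ W.subtype (fun i => X i s) (lift p) ∈ W.nonunits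
    · filter_upwards [h] with i hi
      simp [h, hi]
    · filter_upwards [Ultrafilter.eventually_not.2 h] with i hi
      exact iff_of_false h hi
  have hXW : ∀ᶠ s in (U : Filter I), ∀ i, X i s ∈ W :=
    eventually_all.2 fun i => coe_mem_germV.1 (hX i)
  obtain ⟨s, hs, hsW⟩ := (((eventually_all_finset P).2 key).and hXW).exists
  refine ⟨fun i => IsLocalRing.residue W ⟨X i s, hsW i⟩, fun p hp => (hs p hp).trans ?_⟩
  have h3 : MvPolynomial.eval₂ (RingHom.id _) (fun i => IsLocalRing.residue W ⟨X i s, hsW i⟩) p =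
      IsLocalRing.residue W
        (MvPolynomial.eval₂ (RingHom.id W) (fun i => ⟨X i s, hsW i⟩) (lift p)) := by
    conv_lhs => rw [← hlift p, MvPolynomial.eval₂_map]
    exact (MvPolynomial.eval₂_comp_left (IsLocalRing.residue W) (RingHom.id W)
      (fun i => ⟨X i s, hsW i⟩) (lift p)).symm
  have h4 : ((MvPolynomial.eval₂ (RingHom.id W) (fun i => ⟨X i s, hsW i⟩) (lift p) : W) : K) =
      MvPolynomial.eval₂ W.subtype (fun i => X i s) (lift p) :=
    MvPolynomial.eval₂_comp_left W.subtype (RingHom.id W) _ (lift p)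
  rw [h3, IsLocalRing.residue_eq_zero_iff, mem_maximalIdeal_iff_nonunits, h4]

end Germ

end Paper

namespace Paper

open Filter

/-- In a suitable ultrapower, a partial section of the residue map of a henselian valuation ring
over a subfield with separable residue extension extends to the whole residue field. -/
theorem exists_section_of_hensV {K : Type u} [Field K] {W : ValuationSubring K} (hW : HensV W)
    (F : Subfield K) (hF : ∀ x : F, F.subtype x ∈ W) (hsep : SepHom (resHom W F.subtype hF)) :
    ∃ (I : Type u) (U : Ultrafilter I)
      (s : IsLocalRing.ResidueField W →+* Germ (U : Filter I) K),
      (∀ x : F, s (resHom W F.subtype hF x) = constGerm U (x : K)) ∧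
      (∀ a, s a ∈ germV U W) ∧
      ∀ x : W, constGerm U (x : K) - s (IsLocalRing.residue W x) ∈ (germV U W).nonunits := by
  classical
  let κ := IsLocalRing.ResidueField W
  let _ : Algebra F W := (F.subtype.codRestrict W.toSubring hF).toAlgebra
  let _ : Algebra F κ := (resHom W F.subtype hF).toAlgebra
  choose l hl1 hl2 using hW.exists_lift_adjoin (C := F) (L := κ) hsep (RingHom.id κ)
    (fun c => rfl)
  let I := Finset κ
  let U : Ultrafilter I := Ultrafilter.of atTop
  have hU : ∀ a : κ, ∀ᶠ S : Finset κ in (U : Filter (Finset κ)), a ∈ IntermediateField.adjoin F (S : Set κ) := by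
    intro a
    refine (Ultrafilter.of_le (atTop : Filter I)) ?_
    filter_upwards [eventually_ge_atTop ({a} : Finset κ)] with S hS
    exact IntermediateField.subset_adjoin _ _ (hS (Finset.mem_singleton_self a))
  let lam : κ → I → K := fun a S =>
    if h : a ∈ IntermediateField.adjoin F (S : Set κ) then (l S ⟨a, h⟩ : K) else 0
  have hlam : ∀ {a : κ} {S : I} (h : a ∈ IntermediateField.adjoin F (S : Set κ)),
      lam a S = (l S ⟨a, h⟩ : K) := fun h => dif_pos h
  let s : κ →+* Germ (U : Filter I) K :=
    { toFun := fun a => (lam a : Germ (U : Filter I) K)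
      map_one' := Germ.coe_eq.2 (by
        filter_upwards [hU 1] with S h
        rw [hlam h]
        exact congrArg Subtype.val (map_one (l S)))
      map_zero' := Germ.coe_eq.2 (by
        filter_upwards [hU 0] with S h
        rw [hlam h]
        exact congrArg Subtype.val (map_zero (l S)))
      map_mul' := fun a b => Germ.coe_eq.2 (by
        filter_upwards [hU a, hU b] with S ha hb
        rw [hlam (mul_mem ha hb)]
        change _ = lam a S * lam b S
        rw [hlam ha, hlam hb]
        exact congrArg Subtype.val (map_mul (l S) ⟨a, ha⟩ ⟨b, hb⟩))
      map_add' := fun a b => Germ.coe_eq.2 (by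
        filter_upwards [hU a, hU b] with S ha hb
        rw [hlam (add_mem ha hb)]
        change _ = lam a S + lam b S
        rw [hlam ha, hlam hb]
        exact congrArg Subtype.val (map_add (l S) ⟨a, ha⟩ ⟨b, hb⟩)) }
  refine ⟨I, U, s, fun x => Germ.coe_eq.2 ?_, fun a => coe_mem_germV.2 ?_, fun x => ?_⟩
  · filter_upwards [hU (resHom W F.subtype hF x)] with S h
    rw [hlam h]
    exact congrArg Subtype.val (hl1 S x)
  · filter_upwards [hU a] with S h
    rw [hlam h]
    exact (l S ⟨a, h⟩).2
  · change ((fun S => (x : K) - lam (IsLocalRing.residue W x) S : I → K) :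
      Germ (U : Filter I) K) ∈ _
    rw [coe_mem_nonunits_germV]
    filter_upwards [hU (IsLocalRing.residue W x)] with S h
    rw [hlam h, ← residue_eq_iff, hl2]
    rfl

/-- A henselian valued field with a partial section of the residue map of a coarsening embeds
into one where the partial section is defined on the image of the residue field. -/
theorem exists_residue_section_step {K : Type u} [Field K] {V W : ValuationSubring K} (hVW : V ≤ W)
    (hV : HensV V) (F : Subfield K) (hF : ∀ x : F, F.subtype x ∈ W)
    (hsep : SepHom (resHom W F.subtype hF)) :
    ∃ (K' : Type u) (_ : Field K') (g : K →+* K') (V' W' : ValuationSubring K') (F' : Subfield K')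
      (hF' : ∀ x : F', F'.subtype x ∈ W'),
      V' ≤ W' ∧ HensV V' ∧ (∀ x, g x ∈ V' ↔ x ∈ V) ∧ (∀ x, g x ∈ W' ↔ x ∈ W) ∧
      (∀ x ∈ F, g x ∈ F') ∧ (∀ x ∈ W, ∃ y ∈ F', g x - y ∈ W'.nonunits) ∧
      SepHom (resHom W' F'.subtype hF') ∧
      ∀ (C : Type u) [Field C] (i : C →+* K) (hi : ∀ c, i c ∈ W) (hi' : ∀ c, g.comp i c ∈ W'),
        ExHom (resHom W' (g.comp i) hi') (resHom W i hi) := by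
  obtain ⟨I, U, s, hs1, hs2, hs3⟩ := exists_section_of_hensV (hV.of_le hVW) F hF hsep
  have hF' : ∀ x : s.fieldRange, s.fieldRange.subtype x ∈ germV U W := by
    rintro ⟨_, a, rfl⟩
    exact hs2 a
  have hψ := exHom_residueField_germV U W (resHom (germV U W) s hs2) fun x => by
    rw [resHom_apply, residue_eq_iff, ← neg_mem_iff, neg_sub]
    exact hs3 x
  refine ⟨Germ (U : Filter I) K, inferInstance, constGerm U, germV U V, germV U W,
    s.fieldRange, hF', ?_, hV.germV, fun _ => constGerm_mem_germV U,
    fun _ => constGerm_mem_germV U, ?_, ?_, ?_, ?_⟩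
  · intro x
    refine Germ.inductionOn x fun x hx => ?_
    exact hx.mono fun i hi => hVW hi
  · intro x hx
    exact ⟨_, hs1 ⟨x, hx⟩⟩
  · intro x hx
    exact ⟨_, ⟨_, rfl⟩, hs3 ⟨x, hx⟩⟩
  · refine SepHom.of_comp_bijective (f := s.rangeRestrictField) ?_ ⟨RingHom.injective _, ?_⟩
    · exact hψ.sepHom
    · rintro ⟨_, a, rfl⟩
      exact ⟨a, rfl⟩
  · intro C _ i hi hi'
    have := hψ.comp (resHom W i hi)
    refine Eq.subst (motive := fun f => ExHom f (resHom W i hi)) (RingHom.ext fun c => ?_) this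
    change IsLocalRing.residue _ (⟨s (resHom W i hi c), hs2 _⟩ : germV U W) = _
    rw [resHom_apply, resHom_apply, residue_eq_iff, ← neg_mem_iff, neg_sub]
    exact hs3 ⟨i c, hi c⟩

end Paper

namespace Paper

/-- The direct limit of a sequence of fields. -/
theorem exists_field_directLimit (K : ℕ → Type u) [∀ n, Field (K n)]
    (g : ∀ n, K n →+* K (n + 1)) :
    ∃ (E : Type u) (_ : Field E) (ι : ∀ n, K n →+* E),
      (∀ n x, ι (n + 1) (g n x) = ι n x) ∧ ∀ z, ∃ n x, z = ι n x := by
  let f : ∀ m n : ℕ, m ≤ n → K m →+* K n := fun m n h =>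
    Nat.leRecOn h (fun {k} t => (g k).comp t) (RingHom.id (K m))
  have hf : ∀ m n (h : m ≤ n) x, f m n h x = Nat.leRecOn h (fun {k} => g k) x := by
    intro m n h
    obtain ⟨k, rfl⟩ := Nat.exists_eq_add_of_le h
    induction k with
    | zero => intro x; simp [f, Nat.leRecOn_self]
    | succ k ih =>
      intro x
      have h1 : f m (m + (k + 1)) h = (g (m + k)).comp (f m (m + k) le_self_add) :=
        Nat.leRecOn_succ le_self_add _
      rw [h1]
      refine Eq.trans ?_ (Nat.leRecOn_succ (le_self_add : m ≤ m + k) x).symm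
      exact congrArg (g (m + k)) (ih le_self_add x)
  have : DirectedSystem K fun m n h => f m n h :=
    ⟨fun m x => by rw [hf, Nat.leRecOn_self], fun {m n k} hmn hnk x => by
      rw [hf, hf, hf, Nat.leRecOn_trans hmn hnk]⟩
  refine ⟨DirectLimit K f, inferInstance, fun n => DirectLimit.Ring.of K f n, fun n x => ?_, ?_⟩
  · have h1 := DirectLimit.Ring.of_f (G := K) (f := f) (Nat.le_succ n) x
    rwa [hf, Nat.leRecOn_succ' ] at h1
  · intro z
    obtain ⟨n, x, rfl⟩ := DirectLimit.exists_eq_mk f z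
    exact ⟨n, x, rfl⟩

end Paper

namespace Paper

section Limit

variable {K : ℕ → Type u} [∀ n, Field (K n)] {g : ∀ n, K n →+* K (n + 1)} {E : Type u} [Field E]
  {ι : ∀ n, K n →+* E}

theorem exists_transition (hι : ∀ n x, ι (n + 1) (g n x) = ι n x) {m n : ℕ} (h : m ≤ n) :
    ∃ t : K m → K n, (∀ x, ι n (t x) = ι m x) ∧
      ∀ P : ∀ n, K n → Prop, (∀ n x, P n x → P (n + 1) (g n x)) → ∀ x, P m x → P n (t x) := by
  induction n, h using Nat.le_induction with
  | base => exact ⟨id, fun _ => rfl, fun _ _ _ => id⟩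
  | succ n _ ih =>
    obtain ⟨t, ht, hP⟩ := ih
    exact ⟨g n ∘ t, fun x => (hι n _).trans (ht x), fun P h x hx => h _ _ (hP P h x hx)⟩

theorem exists_common_stage (hι : ∀ n x, ι (n + 1) (g n x) = ι n x) (P : ∀ n, K n → Prop)
    (hP : ∀ n x, P n x → P (n + 1) (g n x)) {J : Type*} (s : Finset J) (z : J → E)
    (hz : ∀ j ∈ s, ∃ n x, P n x ∧ ι n x = z j) :
    ∃ n, ∃ x : J → K n, ∀ j ∈ s, P n (x j) ∧ ι n (x j) = z j := by
  classical
  choose! N x hx using hz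
  refine ⟨s.sup N, fun j => if h : j ∈ s then
    (exists_transition hι (Finset.le_sup (f := N) h)).choose (x j) else 0, fun j hj => ?_⟩
  have h := (exists_transition hι (Finset.le_sup (f := N) hj)).choose_spec
  beta_reduce
  rw [dif_pos hj, h.1]
  exact ⟨h.2 P hP _ (hx j hj).1, (hx j hj).2⟩

theorem exists_limit_subfield (hι : ∀ n x, ι (n + 1) (g n x) = ι n x) (F : ∀ n, Subfield (K n))
    (hF : ∀ n, ∀ x ∈ F n, g n x ∈ F (n + 1)) :
    ∃ F' : Subfield E, ∀ z, z ∈ F' ↔ ∃ n x, x ∈ F n ∧ ι n x = z := by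
  have key : ∀ {a b : E}, (∃ n x, x ∈ F n ∧ ι n x = a) → (∃ n x, x ∈ F n ∧ ι n x = b) →
      ∃ n x y, x ∈ F n ∧ y ∈ F n ∧ ι n x = a ∧ ι n y = b := by
    intro a b ha hb
    obtain ⟨n, x, hx⟩ := exists_common_stage hι (fun n x => x ∈ F n) hF Finset.univ ![a, b]
      (by simpa [Fin.forall_fin_two] using And.intro ha hb)
    exact ⟨n, x 0, x 1, (hx 0 (by simp)).1, (hx 1 (by simp)).1, (hx 0 (by simp)).2,
      (hx 1 (by simp)).2⟩
  refine ⟨{ carrier := {z | ∃ n x, x ∈ F n ∧ ι n x = z}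
            mul_mem' := ?_, one_mem' := ⟨0, 1, one_mem _, map_one _⟩, add_mem' := ?_
            zero_mem' := ⟨0, 0, zero_mem _, map_zero _⟩, neg_mem' := ?_, inv_mem' := ?_ },
          fun z => Iff.rfl⟩
  · intro a b ha hb
    obtain ⟨n, x, y, hx, hy, rfl, rfl⟩ := key ha hb
    exact ⟨n, x * y, mul_mem hx hy, map_mul _ _ _⟩
  · intro a b ha hb
    obtain ⟨n, x, y, hx, hy, rfl, rfl⟩ := key ha hb
    exact ⟨n, x + y, add_mem hx hy, map_add _ _ _⟩
  · rintro _ ⟨n, x, hx, rfl⟩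
    exact ⟨n, -x, neg_mem hx, map_neg _ _⟩
  · rintro _ ⟨n, x, hx, rfl⟩
    exact ⟨n, x⁻¹, inv_mem hx, map_inv₀ _ _⟩

theorem exists_limit_valuationSubring (hι : ∀ n x, ι (n + 1) (g n x) = ι n x)
    (hι' : ∀ z, ∃ n x, z = ι n x) (V : ∀ n, ValuationSubring (K n))
    (hV : ∀ n x, g n x ∈ V (n + 1) ↔ x ∈ V n) :
    ∃ V' : ValuationSubring E, ∀ n x, ι n x ∈ V' ↔ x ∈ V n := by
  have key : ∀ {a b : E}, (∃ n x, x ∈ V n ∧ ι n x = a) → (∃ n x, x ∈ V n ∧ ι n x = b) →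
      ∃ n x y, x ∈ V n ∧ y ∈ V n ∧ ι n x = a ∧ ι n y = b := by
    intro a b ha hb
    obtain ⟨n, x, hx⟩ := exists_common_stage hι (fun n x => x ∈ V n) (fun n x => (hV n x).2)
      Finset.univ ![a, b] (by simpa [Fin.forall_fin_two] using And.intro ha hb)
    exact ⟨n, x 0, x 1, (hx 0 (by simp)).1, (hx 1 (by simp)).1, (hx 0 (by simp)).2,
      (hx 1 (by simp)).2⟩
  refine ⟨{ carrier := {z | ∃ n x, x ∈ V n ∧ ι n x = z}
            mul_mem' := ?_, one_mem' := ⟨0, 1, one_mem _, map_one _⟩, add_mem' := ?_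
            zero_mem' := ⟨0, 0, zero_mem _, map_zero _⟩, neg_mem' := ?_, mem_or_inv_mem' := ?_ },
          fun n x => ⟨?_, fun hx => ⟨n, x, hx, rfl⟩⟩⟩
  · intro a b ha hb
    obtain ⟨n, x, y, hx, hy, rfl, rfl⟩ := key ha hb
    exact ⟨n, x * y, mul_mem hx hy, map_mul _ _ _⟩
  · intro a b ha hb
    obtain ⟨n, x, y, hx, hy, rfl, rfl⟩ := key ha hb
    exact ⟨n, x + y, add_mem hx hy, map_add _ _ _⟩
  · rintro _ ⟨n, x, hx, rfl⟩
    exact ⟨n, -x, neg_mem hx, map_neg _ _⟩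
  · intro z
    obtain ⟨n, x, rfl⟩ := hι' z
    rcases (V n).mem_or_inv_mem x with h | h
    · exact .inl ⟨n, x, h, rfl⟩
    · exact .inr ⟨n, x⁻¹, h, map_inv₀ _ _⟩
  · rintro ⟨m, y, hy, hyx⟩
    obtain ⟨t, ht, htP⟩ := exists_transition hι (le_max_left m n)
    obtain ⟨t', ht', htP'⟩ := exists_transition hι (le_max_right m n)
    have h1 : t y = t' x := (ι (max m n)).injective (by rw [ht, ht', hyx])
    have h2 := htP (fun n x => x ∈ V n) (fun n x => (hV n x).2) y hy
    by_contra hx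
    have h3 := htP' (fun n x => x ∉ V n) (fun n x h => mt (hV n x).1 h) x hx
    exact h3 (h1 ▸ h2)

end Limit

theorem map_mem_nonunits_iff {K L : Type*} [Field K] [Field L] {f : K →+* L}
    {A : ValuationSubring K} {B : ValuationSubring L} (h : ∀ x, f x ∈ B ↔ x ∈ A) {x : K} :
    f x ∈ B.nonunits ↔ x ∈ A.nonunits := by
  rw [ValuationSubring.mem_nonunits_iff_or, ValuationSubring.mem_nonunits_iff_or, ← map_inv₀, h,
    map_eq_zero]

theorem eq_zero_of_mem_nonunits {K : Type*} [Field K] {W : ValuationSubring K} {F : Subfield K}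
    (hF : ∀ x : F, F.subtype x ∈ W) {x : K} (hx : x ∈ F) (h : x ∈ W.nonunits) : x = 0 := by
  by_contra h0
  exact ((ValuationSubring.mem_nonunits_iff_or W).1 h).elim h0 fun h1 => h1 (hF ⟨_, inv_mem hx⟩)

end Paper

namespace Paper

/-- A henselian valued field over `C` together with a coarsening `W` of the valuation and a partial
section `F` of the residue map of `W`. -/
structure PartialSection (C : Type u) [Field C] (π : C) {Q : Type u} [Field Q] (q : C →+* Q) :
    Type (u + 1) where
  K : Type u
  [field : Field K]
  i : C →+* K
  V : ValuationSubring K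
  W : ValuationSubring K
  F : Subfield K
  le : V ≤ W
  hens : HensV V
  nonunit : i π ∈ V.nonunits
  mem_W : ∀ x : F, F.subtype x ∈ W
  sep : SepHom (resHom W F.subtype mem_W)
  mem_F : ∀ c, i c ∈ F
  exHom : ExHom (resHom W i fun c => mem_W ⟨i c, mem_F c⟩) q

attribute [instance] PartialSection.field

section

variable {C : Type u} [Field C] {π : C} {Q : Type u} [Field Q] {q : C →+* Q}

theorem PartialSection.exists_next (S : PartialSection C π q) :
    ∃ (T : PartialSection C π q) (g : S.K →+* T.K), (∀ c, g (S.i c) = T.i c) ∧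
      (∀ x, g x ∈ T.V ↔ x ∈ S.V) ∧ (∀ x, g x ∈ T.W ↔ x ∈ S.W) ∧ (∀ x ∈ S.F, g x ∈ T.F) ∧
      ∀ x ∈ S.W, ∃ y ∈ T.F, g x - y ∈ T.W.nonunits := by
  obtain ⟨K', _, g, V', W', F', hF', hle, hV', hgV, hgW, hgF, happ, hsep, hex⟩ :=
    exists_residue_section_step S.le S.hens S.F S.mem_W S.sep
  exact ⟨{ K := K', i := g.comp S.i, V := V', W := W', F := F', le := hle, hens := hV'
           nonunit := (map_mem_nonunits_iff hgV).2 S.nonunit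
           mem_W := hF', sep := hsep, mem_F := fun c => hgF _ (S.mem_F c)
           exHom := (hex C S.i (fun c => S.mem_W ⟨S.i c, S.mem_F c⟩)
            fun c => hF' ⟨_, hgF _ (S.mem_F c)⟩).trans S.exHom },
    g, fun _ => rfl, hgV, hgW, hgF, happ⟩

/-- A partial section of the residue map extends, in a suitable extension, to a section with image
a large field. -/
theorem PartialSection.exists_large_section (S : PartialSection C π q) (hπ : π ≠ 0) :
    ∃ (E : Type u) (_ : Field E) (e : S.K →+* E) (W : ValuationSubring E) (F : Subfield E)
      (hF : ∀ c, e (S.i c) ∈ F),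
      LargeField F ∧ (∀ x : F, F.subtype x ∈ W) ∧ (∀ x ∈ W, ∃ y ∈ F, x - y ∈ W.nonunits) ∧
      ExHom ((e.comp S.i).codRestrict F hF) q := by
  choose next g hgi hgV hgW hgF happ using
    fun T : PartialSection C π q => T.exists_next
  let T : ℕ → PartialSection C π q := fun n =>
    Nat.rec (motive := fun _ => PartialSection C π q) S (fun _ => next) n
  obtain ⟨E, _, ι, hι, hι'⟩ := exists_field_directLimit (fun n => (T n).K) fun n => g (T n)
  obtain ⟨V, hV⟩ := exists_limit_valuationSubring (K := fun n => (T n).K) hι hι' (fun n => (T n).V) fun n => hgV (T n)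
  obtain ⟨W, hW⟩ := exists_limit_valuationSubring (K := fun n => (T n).K) hι hι' (fun n => (T n).W) fun n => hgW (T n)
  obtain ⟨F, hF⟩ := exists_limit_subfield (K := fun n => (T n).K) hι (fun n => (T n).F) fun n => hgF (T n)
  have hιF : ∀ n (x : (T n).F), ι n x ∈ F := fun n x => (hF _).2 ⟨n, x, x.2, rfl⟩
  have hFW : ∀ x : F, F.subtype x ∈ W := by
    rintro ⟨_, hx⟩
    obtain ⟨n, x, hxF, rfl⟩ := (hF _).1 hx
    exact (hW n x).2 ((T n).mem_W ⟨x, hxF⟩)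
  have hιi : ∀ n c, ι n ((T n).i c) = ι 0 (S.i c) := by
    intro n c
    induction n with
    | zero => rfl
    | succ n ih =>
      rw [← ih, ← hι n]
      exact congrArg (ι (n + 1)) (hgi (T n) c).symm
  have hFi : ∀ c, ι 0 (S.i c) ∈ F := fun c => hιF 0 ⟨_, S.mem_F c⟩
  refine ⟨E, inferInstance, ι 0, W, F, hFi, ?_, hFW, ?_, ?_⟩
  · have hVF : HensV (V.comap F.subtype) := by
      intro k a ha
      obtain ⟨n, x, hx⟩ := exists_common_stage (K := fun n => (T n).K) hι (fun n x => x ∈ (T n).F) (fun n => hgF (T n))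
        (Finset.range k) (fun j => (a j : E)) fun j _ => (hF _).1 (a j).2
      have hxV : ∀ j < k, x j ∈ (T n).V.nonunits := by
        intro j hj
        rw [← map_mem_nonunits_iff (hV n), (hx j (Finset.mem_range.2 hj)).2]
        exact (map_mem_nonunits_iff (f := F.subtype) (A := V.comap F.subtype)
          fun x => Iff.rfl).2 (ha j hj)
      obtain ⟨y, hy, hy0⟩ := (T n).hens k x hxV
      obtain ⟨z, hz, hyz⟩ := happ (T n) y ((T n).le hy)
      let L := T (n + 1)
      have hzV : z ∈ L.V := by
        have h1 := L.V.nonunits_le (ValuationSubring.nonunits_le_nonunits.2 L.le hyz)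
        simpa using sub_mem ((hgV (T n) y).2 hy) h1
      have hxF : ∀ j ∈ Finset.range k, g (T n) (x j) ∈ L.F := fun j hj => hgF _ _ (hx j hj).1
      have hpF : 1 + z + ∑ j ∈ Finset.range k, g (T n) (x j) * z ^ (j + 2) ∈ L.F :=
        add_mem (add_mem (one_mem _) hz)
          (sum_mem fun j hj => mul_mem (hxF j hj) (pow_mem hz _))
      have hp0 : 1 + z + ∑ j ∈ Finset.range k, g (T n) (x j) * z ^ (j + 2) = 0 := by
        refine eq_zero_of_mem_nonunits L.mem_W hpF ?_
        have h1 : 1 + g (T n) y + ∑ j ∈ Finset.range k, g (T n) (x j) * g (T n) y ^ (j + 2) = 0 := by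
          rw [← map_zero (g (T n)), ← hy0]
          simp
        have h2 : ∀ j ∈ Finset.range k, g (T n) (x j) * g (T n) y ^ (j + 2) -
            g (T n) (x j) * z ^ (j + 2) ∈ L.W.nonunits := by
          intro j hj
          let a' : L.W := ⟨g (T n) (x j), L.mem_W ⟨_, hxF j hj⟩⟩
          let y' : L.W := ⟨g (T n) y, (hgW (T n) y).2 ((T n).le hy)⟩
          let z' : L.W := ⟨z, L.mem_W ⟨z, hz⟩⟩
          have h3 : IsLocalRing.residue L.W y' = IsLocalRing.residue L.W z' :=
            residue_eq_iff.2 hyz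
          exact residue_eq_iff.1 (show IsLocalRing.residue L.W (a' * y' ^ (j + 2)) =
            IsLocalRing.residue L.W (a' * z' ^ (j + 2)) by
              rw [map_mul, map_mul, map_pow, map_pow, h3])
        have h3 := add_mem hyz (sum_mem h2)
        rw [Finset.sum_sub_distrib] at h3
        rw [← neg_mem_iff]
        convert h3 using 1
        linear_combination -h1
      refine ⟨⟨ι (n + 1) z, hιF (n + 1) ⟨z, hz⟩⟩, (hV (n + 1) z).2 hzV, Subtype.ext ?_⟩
      have h4 := congrArg (ι (n + 1)) hp0
      rw [map_zero, map_add, map_add, map_one, map_sum] at h4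
      refine Eq.trans ?_ h4
      rw [Subfield.coe_add, Subfield.coe_add, Subfield.coe_one, AddSubmonoidClass.coe_finsetSum]
      congr 1
      refine Finset.sum_congr rfl fun j hj => ?_
      rw [map_mul, map_pow, hι, (hx j hj).2]
      rfl
    refine largeField_of_hensV hVF (t := ⟨ι 0 (S.i π), hFi π⟩) ?_ ?_
    · refine (map_mem_nonunits_iff (f := F.subtype) (A := V.comap F.subtype) (B := V)
          fun x => Iff.rfl).1 ?_
      exact (map_mem_nonunits_iff (hV 0)).2 S.nonunit
    · intro h
      have h' : ι 0 (S.i π) = 0 := congrArg Subtype.val h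
      simp [hπ] at h'
  · intro z hz
    obtain ⟨n, x, rfl⟩ := hι' z
    obtain ⟨y, hy, hxy⟩ := happ (T n) x ((hW n x).1 hz)
    refine ⟨ι (n + 1) y, hιF (n + 1) ⟨y, hy⟩, ?_⟩
    rw [← hι, ← map_sub]
    exact (map_mem_nonunits_iff (hW (n + 1))).2 hxy
  · intro m x P
    obtain ⟨n, y, hy⟩ := exists_common_stage (K := fun n => (T n).K) hι (fun n x => x ∈ (T n).F) (fun n => hgF (T n))
      Finset.univ (fun j => (x j : E)) fun j _ => (hF _).1 (x j).2
    let L := T n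
    let Y : Fin m → L.F := fun j => ⟨y j, (hy j (Finset.mem_univ j)).1⟩
    let c : C →+* L.F := L.i.codRestrict L.F L.mem_F
    let r := resHom L.W L.F.subtype L.mem_W
    obtain ⟨z, hz⟩ := L.exHom m (r ∘ Y) P
    refine ⟨z, fun p hp => Iff.trans ?_ (hz p hp)⟩
    have h1 : MvPolynomial.eval₂ (resHom L.W L.i fun c => L.mem_W ⟨L.i c, L.mem_F c⟩) (r ∘ Y) p =
        r (MvPolynomial.eval₂ c Y p) := (MvPolynomial.eval₂_comp_left r c Y p).symm
    have h2 : ((ι n).comp L.F.subtype) (MvPolynomial.eval₂ c Y p) =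
        F.subtype (MvPolynomial.eval₂ (((ι 0).comp S.i).codRestrict F hFi) x p) := by
      rw [MvPolynomial.eval₂_comp_left, MvPolynomial.eval₂_comp_left]
      congr 1
      · exact RingHom.ext fun c => hιi n c
      · exact funext fun j => (hy j (Finset.mem_univ j)).2
    rw [h1, map_eq_zero, ← map_eq_zero F.subtype, ← h2, map_eq_zero]

end

end Paper

namespace Paper

/-- Existential sentences with at most `n` quantifiers pass from a field with a partial section of
the residue map to the target of the section, given `R4N n`. -/
theorem PartialSection.realize_of_isExistsN {n : ℕ} (hR4 : R4N.{u} n) {C : Type u} [Field C] {π : C}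
    {Q : Type u} [Field Q] {q : C →+* Q} (S : PartialSection C π q) (hπ : π ≠ 0)
    {φ : (Language.ring[[C]]).Sentence} (hφ : IsExistsN n φ) (h : RealizeRing S.K S.i φ) :
    RealizeRing Q q φ := by
  obtain ⟨E, _, e, W, F, hF, hlarge, hFW, happ, hex⟩ := S.exists_large_section hπ
  refine hex.realize_of_isExistsN hφ ?_
  let c := (e.comp S.i).codRestrict F hF
  have h1 : RealizeRing E (((↑) : F → E) ∘ c) φ :=
    (ExHom.of_injective (g := e.comp S.i) e e.injective rfl).realize_of_isExistsN hφ h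
  refine (realizeRing_onSentence c (id : F → F) φ).1 ?_
  refine hR4 E W.ValueGroup W.valuation F hlarge ?_ ?_ _ (isExistsN_onBoundedFormula _ hφ)
    ((realizeRing_onSentence c _ φ).2 h1)
  · intro y hy
    refine le_antisymm ((W.valuation_le_one_iff _).2 (hFW y)) (not_lt.1 fun hlt => ?_)
    exact hy (eq_zero_of_mem_nonunits hFW y.2 ((ValuationSubring.mem_nonunits_iff W).2 hlt))
  · intro y hy
    obtain ⟨z, hz, hyz⟩ := happ y ((W.valuation_le_one_iff _).1 hy)
    exact ⟨⟨z, hz⟩, (ValuationSubring.mem_nonunits_iff W).1 hyz⟩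

/-- A homomorphism from `C` to a field which is separable and factors, modulo infinitely divisible
elements, through a henselian valuation ring yields a partial section. -/
theorem exists_partialSection {C K Q : Type u} [Field C] [Field K] [Field Q] {A : ValuationSubring K}
    (hA : HensV A) {i : C →+* K} {π : C} (hπ : i π ∈ A.nonunits) (hπ0 : π ≠ 0)
    (hC : ∀ c, ∃ k : ℕ, i π ^ k * i c ∈ A) {f : C →+* Q} (hf : SepHom f) (j : A →+* Q)
    (hj : ∀ c (hc : i c ∈ A), f c = j ⟨i c, hc⟩)
    (hker : ∀ a : A, (∀ k : ℕ, ∃ z ∈ A, (a : K) = i π ^ k * z) → j a = 0)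
    {φ : (Language.ring[[C]]).Sentence} (h : RealizeRing K i φ) :
    ∃ S : PartialSection C π f, RealizeRing S.K S.i φ := by
  obtain ⟨hW, e, he⟩ := exists_residueField_coarse_hom hπ hπ0 hC j hj hker
  have hef : e.comp (resHom (coarse A (i π) (A.nonunits_le hπ)) i hW) = f := RingHom.ext he
  have hFW : ∀ x : i.fieldRange, i.fieldRange.subtype x ∈ coarse A (i π) (A.nonunits_le hπ) := by
    rintro ⟨_, c, rfl⟩
    exact hW c
  refine ⟨{ K := K, i := i, V := A, W := coarse A (i π) (A.nonunits_le hπ), F := i.fieldRange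
            le := le_coarse _, hens := hA, nonunit := hπ, mem_W := hFW, sep := ?_
            mem_F := fun c => ⟨c, rfl⟩, exHom := ExHom.of_injective e e.injective hef }, h⟩
  refine SepHom.of_comp_bijective (f := i.rangeRestrictField) ?_ ⟨RingHom.injective _, ?_⟩
  · exact SepHom.of_comp (g := e) (f := resHom _ i hW) (by rwa [hef]) e.injective
  · rintro ⟨_, c, rfl⟩
    exact ⟨c, rfl⟩

end Paper


namespace Paper

/-- Lemma `lem:reduce_to_rank_one` of the paper.
Let `(C, u)` be an equicharacteristic `ℤ`-valued field with uniformizer `π` and excellent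
valuation ring, and `(K, v)` a henselian extension with uniformizer `π` and `Kv/Cu` separable.
If `(R4_n)` holds, there is a complete `ℤ`-valued henselian extension `(K', v')` of `(C, u)`
with uniformizer `π` such that `Th_{∃_n}(K', C) = Th_{∃_n}(K, C)` and `K'v'` is an
elementary extension of `Kv`. -/
theorem statement6 (n : ℕ)
    (C : Type u) [Field C] (u : Valuation C Zm0) (hZ : Function.Surjective u)
    (hequichar : ringChar C = ringChar (ResF u))
    (π : C) (hπu : IsUniformizer u π)
    (hexc : ExcellentCompletion C u)
    (K : Type u) [Field K] [Algebra C K]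
    (ΓK : Type u) [LinearOrderedCommGroupWithZero ΓK] (v : Valuation K ΓK)
    (hKC : (v.comap (algebraMap C K)).IsEquiv u)
    (hKhens : IsHenselian v) (hπv : IsUniformizer v (algebraMap C K π))
    (gK : ResF u →+* ResF v) (hgK : ResCompat u v gK) (hsepK : IsSepExtHom gK)
    -- `(R4_n)`
    (hR4 : R4N.{u} n) :
    ∃ (K' : Type u) (instK' : Field K'),
      letI := instK'
      ∃ (instA : Algebra C K'),
        letI := instA
        ∃ v' : Valuation K' Zm0,
          -- `(K', v')` is a `ℤ`-valued henselian extension of `(C, u)` with uniformizer `π`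
          Function.Surjective v' ∧
          (v'.comap (algebraMap C K')).IsEquiv u ∧
          IsHenselian v' ∧
          IsUniformizer v' (algebraMap C K' π) ∧
          -- `(K', v')` is complete
          IsCompleteValued v' ∧
          -- `Th_{∃_n}(K', C) = Th_{∃_n}(K, C)`
          ThRingSub (fun {k} φ => IsExistsN n φ) K' (algebraMap C K') K (algebraMap C K) ∧
          ThRingSub (fun {k} φ => IsExistsN n φ) K (algebraMap C K) K' (algebraMap C K') ∧
          -- `Kv ≺ K'v'` : there is an elementary embedding of `Kv` into `K'v'`
          Nonempty (@Language.ElementaryEmbedding Language.ring (ResF v) (ResF v')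
            (ringStructure _) (ringStructure _)) := by
  let _ := gK.toAlgebra
  have hsep : SepHom gK := sepHom_of_isSepExt (F := ResF u) (L := ResF v) hsepK
  obtain ⟨K', instK', f, v', j, hsurj, hext, hhens, hunif, hcomp, ⟨e⟩, hf, hex, hfj, hker⟩ :=
    exists_complete_extension hequichar hπu hexc v (algebraMap C K) hKC hKhens hπv gK hgK hsep
  refine ⟨K', instK', f.toAlgebra, v', hsurj, hext, hhens, hunif, hcomp, ?_, ?_,
    nonempty_elementaryEmbedding_of_ringEquiv e⟩
  · exact thRingSub_of_forall_isExistsN fun φ hφ => hex.realize_of_isExistsN hφ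
  · refine thRingSub_of_forall_isExistsN fun φ hφ h => ?_
    have hπ0 : π ≠ 0 := (Valuation.pos_iff u).1 hπu.1
    have hC : ∀ c, ∃ k : ℕ, algebraMap C K π ^ k * algebraMap C K c ∈ v.valuationSubring := by
      intro c
      obtain ⟨k, hk⟩ := hπu.exists_mul_pow_lt c (t := 1) one_ne_zero
      refine ⟨k, ?_⟩
      have h1 : u (π ^ k * c) ≤ 1 := by
        rw [map_mul, map_pow, mul_comm, ← map_one u]
        exact (hk k le_rfl).le
      have h2 := (hKC.le_one_iff_le_one (x := π ^ k * c)).2 h1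
      rwa [Valuation.comap_apply, map_mul, map_pow] at h2
    obtain ⟨S, hS⟩ := exists_partialSection (hensV_of_henselianLocalRing (A := v.valuationSubring))
      ((mem_nonunits_valuationSubring_iff _).2 hπv.2.1) hπ0 hC hf j hfj hker h
    exact S.realize_of_isExistsN hR4 hπ0 hφ hS

end Paper
end

section
/- Let K and L be field extensions of a field C. The following are equivalent: (1) Th_{∃_1}(K,C) ⊆ Th_{∃_1}(L,C); (2) (a) there exists a field embedding over C of the relative algebraic closure of C in K into L, and (b) if K is infinite then L is infinite. -/
open FirstOrder FirstOrder.Language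

universe u v w x

namespace Paper

open Polynomial FirstOrder.Ring

section AlgebraStructure

variable {C : Type u} [Field C]

/-- The `L_ring(C)`-structure on a `C`-algebra. -/
noncomputable local instance algebraStructure (R : Type*) [CommRing R] [Algebra C R] :
    (Language.ring[[C]]).Structure R :=
  ringConStructure (algebraMap C R)

theorem realizeRing_iff_realize {R : Type*} [CommRing R] [Algebra C R]
    (φ : (Language.ring[[C]]).Sentence) (v : Fin 0 → R) :
    RealizeRing R (algebraMap C R) φ ↔ BoundedFormula.Realize φ Empty.elim v := by
  rw [Subsingleton.elim Empty.elim default, Subsingleton.elim v default]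
  rfl

/-- A homomorphism of `C`-algebras is a homomorphism of `L_ring(C)`-structures. -/
def algHomToHom {R S : Type*} [CommRing R] [CommRing S] [Algebra C R] [Algebra C S]
    (f : R →ₐ[C] S) : R →[Language.ring[[C]]] S where
  toFun := f
  map_fun' {n} g x := by
    rcases g with g | g
    · cases g
      · exact map_add f _ _
      · exact map_mul f _ _
      · exact map_neg f _
      · exact map_zero f
      · exact map_one f
    · cases n with
      | zero => exact f.commutes g
      | succ n => exact isEmptyElim (α := (constantsOn C).Functions (n + 1)) g
  map_rel' {n} r x := by
    rcases r with r | r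
    · exact Empty.elim r
    · exact isEmptyElim (α := (constantsOn C).Relations n) r

/-- An injective homomorphism of `C`-algebras is an embedding of `L_ring(C)`-structures. -/
def algHomToEmbedding {R S : Type*} [CommRing R] [CommRing S] [Algebra C R] [Algebra C S]
    (f : R →ₐ[C] S) (hf : Function.Injective f) : R ↪[Language.ring[[C]]] S where
  toFun := f
  inj' := hf
  map_fun' := (algHomToHom f).map_fun'
  map_rel' {n} r x := by
    rcases r with r | r
    · exact Empty.elim r
    · exact isEmptyElim (α := (constantsOn C).Relations n) r

theorem realize_algHom_comp_iff {R S : Type*} [CommRing R] [CommRing S] [Algebra C R] [Algebra C S]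
    (f : R →ₐ[C] S) (hf : Function.Injective f) {k : ℕ}
    {φ : (Language.ring[[C]]).BoundedFormula Empty k} (hφ : φ.IsQF) (v : Fin k → R) :
    φ.Realize Empty.elim (f ∘ v) ↔ φ.Realize Empty.elim v := by
  rw [Subsingleton.elim (Empty.elim : Empty → S) (f ∘ Empty.elim)]
  exact hφ.realize_embedding (algHomToEmbedding f hf)

theorem realize_term_algHom_comp {R S : Type*} [CommRing R] [CommRing S]
    [Algebra C R] [Algebra C S] (f : R →ₐ[C] S) {k : ℕ}
    (t : (Language.ring[[C]]).Term (Empty ⊕ Fin k)) (v : Fin k → R) :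
    t.realize (Sum.elim Empty.elim (f ∘ v)) = f (t.realize (Sum.elim Empty.elim v)) := by
  rw [Subsingleton.elim (Empty.elim : Empty → S) (f ∘ Empty.elim), ← Sum.comp_elim]
  exact HomClass.realize_term (algHomToHom f)

/-- A quantifier-free formula evaluated at polynomials has the same truth value after
specialization at any point outside the zero set of a suitable nonzero polynomial. -/
theorem exists_ne_zero_forall_realize_aeval_iff {k : ℕ}
    {φ : (Language.ring[[C]]).BoundedFormula Empty k} (hφ : φ.IsQF) (v : Fin k → C[X])
    (L : Type*) [Field L] [Algebra C L] :
    ∃ p : C[X], p ≠ 0 ∧ ∀ z : L, aeval z p ≠ 0 →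
      (φ.Realize Empty.elim (aeval z ∘ v) ↔ φ.Realize Empty.elim v) := by
  induction hφ with
  | falsum => exact ⟨1, one_ne_zero, fun _ _ => Iff.rfl⟩
  | of_isAtomic h =>
    cases h with
    | rel r ts =>
      rcases r with r | r
      · exact Empty.elim r
      · exact isEmptyElim (α := (constantsOn C).Relations _) r
    | equal t₁ t₂ =>
      simp only [BoundedFormula.realize_bdEqual, realize_term_algHom_comp]
      by_cases h : t₁.realize (Sum.elim Empty.elim v) = t₂.realize (Sum.elim Empty.elim v)
      · exact ⟨1, one_ne_zero, fun _ _ => by simp [h]⟩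
      · refine ⟨_, sub_ne_zero.2 h, fun z hz => ?_⟩
        rw [map_sub, sub_ne_zero] at hz
        exact iff_of_false hz h
  | imp _ _ ih₁ ih₂ =>
    obtain ⟨p, hp, h₁⟩ := ih₁
    obtain ⟨q, hq, h₂⟩ := ih₂
    refine ⟨p * q, mul_ne_zero hp hq, fun z hz => ?_⟩
    rw [map_mul] at hz
    simp only [BoundedFormula.realize_imp, h₁ z (left_ne_zero_of_mul hz),
      h₂ z (right_ne_zero_of_mul hz)]

theorem comp_snoc_algebraMap {R S : Type*} [CommRing R] [CommRing S] [Algebra C R] [Algebra C S]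
    (f : R →ₐ[C] S) {k : ℕ} (v : Fin k → C) (y : R) :
    f ∘ (Fin.snoc (algebraMap C R ∘ v) y : Fin (k + 1) → R) =
      Fin.snoc (algebraMap C S ∘ v) (f y) := by
  rw [Fin.comp_snoc, ← Function.comp_assoc]
  congr 2
  ext c
  exact f.commutes _

theorem exists_realize_snoc {K L : Type*} [Field K] [Field L] [Algebra C K] [Algebra C L]
    (σ : algebraicClosure C K →ₐ[C] L) (hinf : Infinite K → Infinite L) {k : ℕ}
    {φ : (Language.ring[[C]]).BoundedFormula Empty (k + 1)} (hφ : φ.IsQF) (v : Fin k → C) (y : K)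
    (h : φ.Realize Empty.elim (Fin.snoc (algebraMap C K ∘ v) y)) :
    ∃ z : L, φ.Realize Empty.elim (Fin.snoc (algebraMap C L ∘ v) z) := by
  by_cases hy : IsAlgebraic C y
  · let y' : algebraicClosure C K := ⟨y, mem_algebraicClosure_iff.2 hy⟩
    refine ⟨σ y', ?_⟩
    rw [← comp_snoc_algebraMap, realize_algHom_comp_iff σ σ.injective hφ,
      ← realize_algHom_comp_iff (algebraicClosure C K).val (algebraicClosure C K).val.injective hφ,
      comp_snoc_algebraMap]
    exact h
  · have hy : Transcendental C y := hy
    have : Infinite L := hinf <| Infinite.of_injective _ (transcendental_iff_injective.1 hy)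
    rw [← aeval_X (R := C) y, ← comp_snoc_algebraMap,
      realize_algHom_comp_iff _ (transcendental_iff_injective.1 hy) hφ] at h
    obtain ⟨p, hp, hpz⟩ := exists_ne_zero_forall_realize_aeval_iff hφ
      (Fin.snoc (algebraMap C C[X] ∘ v) X) L
    obtain ⟨z, hz⟩ : ∃ z : L, aeval z p ≠ 0 := by
      by_contra! hz
      refine hp (Polynomial.map_injective _ (algebraMap C L).injective ?_)
      rw [Polynomial.map_zero]
      exact Polynomial.funext fun z => by simpa using hz z
    refine ⟨z, ?_⟩
    rw [← aeval_X (R := C) z, ← comp_snoc_algebraMap]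
    exact (hpz z hz).2 h

theorem realize_of_isExistsN_one {K L : Type*} [Field K] [Field L] [Algebra C K] [Algebra C L]
    (σ : algebraicClosure C K →ₐ[C] L) (hinf : Infinite K → Infinite L) {k : ℕ}
    {φ : (Language.ring[[C]]).BoundedFormula Empty k} (hφ : IsExistsN 1 φ) (v : Fin k → C)
    (h : φ.Realize Empty.elim (algebraMap C K ∘ v)) : φ.Realize Empty.elim (algebraMap C L ∘ v) := by
  cases hφ with
  | qf hφ =>
    exact (realize_algHom_comp_iff (Algebra.ofId C L) (algebraMap C L).injective hφ v).2
      ((realize_algHom_comp_iff (Algebra.ofId C K) (algebraMap C K).injective hφ v).1 h)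
  | ex hφ =>
    cases hφ with
    | qf hφ =>
      obtain ⟨y, hy⟩ := BoundedFormula.realize_ex.1 h
      exact BoundedFormula.realize_ex.2 (exists_realize_snoc σ hinf hφ v y hy)

theorem realize_of_isPosBC {K L : Type*} [Field K] [Field L] [Algebra C K] [Algebra C L]
    (σ : algebraicClosure C K →ₐ[C] L) (hinf : Infinite K → Infinite L) {k : ℕ}
    {φ : (Language.ring[[C]]).BoundedFormula Empty k}
    (hφ : IsPosBC (fun {_} φ => IsExistsN 1 φ) φ) (v : Fin k → C)
    (h : φ.Realize Empty.elim (algebraMap C K ∘ v)) : φ.Realize Empty.elim (algebraMap C L ∘ v) := by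
  induction hφ with
  | base hφ => exact realize_of_isExistsN_one σ hinf hφ v h
  | inf _ _ ih₁ ih₂ =>
    rw [BoundedFormula.realize_inf] at h ⊢
    exact ⟨ih₁ h.1, ih₂ h.2⟩
  | sup _ _ ih₁ ih₂ =>
    rw [BoundedFormula.realize_sup] at h ⊢
    exact h.imp ih₁ ih₂

/-- Every polynomial over `C` is represented by an `L_ring(C)`-term in one variable. -/
theorem exists_term_realize_eq_aeval (p : C[X]) :
    ∃ t : (Language.ring[[C]]).Term (Empty ⊕ Fin 1),
      ∀ (R : Type w) [CommRing R] [Algebra C R] (v : Fin 1 → R),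
        t.realize (Sum.elim Empty.elim v) = aeval (v 0) p := by
  let con (c : C) : (Language.ring[[C]]).Term (Empty ⊕ Fin 1) :=
    Constants.term (Language.ring.con c)
  have con_spec (c : C) (R : Type w) [CommRing R] [Algebra C R] (v : Fin 1 → R) :
      (con c).realize (Sum.elim Empty.elim v) = algebraMap C R c := rfl
  induction p using Polynomial.induction_on with
  | C a => exact ⟨con a, fun R _ _ v => by rw [con_spec, aeval_C]⟩
  | add p q hp hq =>
    obtain ⟨s, hs⟩ := hp
    obtain ⟨t, ht⟩ := hq
    refine ⟨Functions.apply₂ ((Language.ring.lhomWithConstants C).onFunction addFunc) s t, fun R _ _ v => ?_⟩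
    rw [Term.realize_functions_apply₂, map_add, ← hs, ← ht]
    rfl
  | monomial n a hp =>
    obtain ⟨s, hs⟩ := hp
    refine ⟨Functions.apply₂ ((Language.ring.lhomWithConstants C).onFunction mulFunc) s (Term.var (Sum.inr 0)), fun R _ _ v => ?_⟩
    rw [Term.realize_functions_apply₂, pow_succ, ← mul_assoc, map_mul, ← hs, aeval_X]
    rfl

/-- For every polynomial over `C`, having a root is expressed by an `∃₁`-sentence. -/
theorem exists_sentence_realizeRing_iff_exists_aeval_eq_zero (p : C[X]) :
    ∃ φ : (Language.ring[[C]]).Sentence, IsExistsN 1 φ ∧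
      ∀ (R : Type w) [CommRing R] [Algebra C R],
        RealizeRing R (algebraMap C R) φ ↔ ∃ y : R, aeval y p = 0 := by
  obtain ⟨t, ht⟩ := exists_term_realize_eq_aeval.{u, w} p
  obtain ⟨s, hs⟩ := exists_term_realize_eq_aeval.{u, w} (0 : C[X])
  refine ⟨(t.bdEqual s).ex, .ex (.qf (BoundedFormula.IsAtomic.equal t s).isQF), fun R _ _ => ?_⟩
  rw [realizeRing_iff_realize _ default, BoundedFormula.realize_ex]
  refine exists_congr fun y => ?_
  rw [BoundedFormula.realize_bdEqual, ht, hs, map_zero]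
  rfl

/-- For every polynomial over `C`, having a non-root is expressed by an `∃₁`-sentence. -/
theorem exists_sentence_realizeRing_iff_exists_aeval_ne_zero (p : C[X]) :
    ∃ φ : (Language.ring[[C]]).Sentence, IsExistsN 1 φ ∧
      ∀ (R : Type w) [CommRing R] [Algebra C R],
        RealizeRing R (algebraMap C R) φ ↔ ∃ y : R, aeval y p ≠ 0 := by
  obtain ⟨t, ht⟩ := exists_term_realize_eq_aeval.{u, w} p
  obtain ⟨s, hs⟩ := exists_term_realize_eq_aeval.{u, w} (0 : C[X])
  refine ⟨(t.bdEqual s).not.ex, .ex (.qf (BoundedFormula.IsAtomic.equal t s).isQF.not),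
    fun R _ _ => ?_⟩
  rw [realizeRing_iff_realize _ default, BoundedFormula.realize_ex]
  refine exists_congr fun y => ?_
  rw [BoundedFormula.realize_not, BoundedFormula.realize_bdEqual, ht, hs, map_zero]
  rfl

end AlgebraStructure

/-- Lemma `lem:E1` of the paper.
Let `K, L` be field extensions of a field `C`.  Then `Th_{∃_1}(K, C) ⊆ Th_{∃_1}(L, C)`
if and only if (a) the relative algebraic closure of `C` in `K` embeds into `L` over `C`,
and (b) if `K` is infinite then so is `L`. -/
theorem statement10 (C : Type u) [Field C]
    (K : Type u) [Field K] [Algebra C K]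
    (L : Type u) [Field L] [Algebra C L] :
    ThRingSub (fun {k} φ => IsExistsN 1 φ) K (algebraMap C K) L (algebraMap C L) ↔
      (Nonempty (integralClosure C K →ₐ[C] L) ∧ (Infinite K → Infinite L)) := by
  constructor
  · refine fun h => ⟨?_, fun hK => ?_⟩
    · suffices Nonempty (algebraicClosure C K →ₐ[C] L) from this
      refine Field.nonempty_algHom_of_exists_root fun x => ?_
      obtain ⟨φ, hφ, hiff⟩ :=
        exists_sentence_realizeRing_iff_exists_aeval_eq_zero.{u, u} (minpoly C x)
      refine (hiff L).1 (h φ (.base hφ) ((hiff K).2 ⟨x, ?_⟩))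
      refine (aeval_algHom_apply (algebraicClosure C K).val x _).trans ?_
      rw [minpoly.aeval, map_zero]
    · by_contra hL
      rw [not_infinite_iff_finite] at hL
      have := Fintype.ofFinite L
      have hp := FiniteField.X_pow_card_sub_X_ne_zero K (Fintype.one_lt_card (α := L))
      obtain ⟨φ, hφ, hiff⟩ := exists_sentence_realizeRing_iff_exists_aeval_ne_zero.{u, u}
        (X ^ Fintype.card L - X : C[X])
      obtain ⟨z, hz⟩ := (hiff L).1 <| h φ (.base hφ) <| (hiff K).2 <| by
        by_contra! hK
        exact hp (Polynomial.funext fun y => by simpa using hK y)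
      exact hz (by simp [FiniteField.pow_card])
  · rintro ⟨⟨σ⟩, hinf⟩ φ hφ h
    rw [realizeRing_iff_realize _ (algebraMap C _ ∘ default)] at h ⊢
    exact realize_of_isPosBC σ hinf hφ default h

end Paper
end
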